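/- Let p ≥ 1 and let T₁, …, T_p be furry ℝ-trees. Let P = T₁ × ⋯ × T_p, equipped with the ℓ¹ product metric dist((x₁,…,x_p), (y₁,…,y_p)) = Σᵢ dist(xᵢ, yᵢ). If ν and ν' are two Lipschitz median operators on P, then ν = ν'; that is, P admits at most one Lipschitz median operator. -/

import Mathlib

open Metric Set

universe u

/-- A `C`-coarse median on a metric space `X`. -/
def IsCoarseMedian {X : Type*} [MetricSpace X] (C : ℝ) (μ : X → X → X → X) : Prop :=
  (∀ x y z : X, μ x y z = μ y x z) ∧
  (∀ x y z : X, μ x y z = μ x z y) ∧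
  (∀ x y : X, μ x x y = x) ∧
  (∀ x y z w : X, dist (μ (μ x w y) w z) (μ x w (μ y w z)) ≤ C) ∧
  (∀ x y z w : X, dist (μ x y z) (μ w y z) ≤ C * dist x w + C)

/-- The coarse median interval `[x,y]_μ = {μ x y z : z ∈ X}`. -/
def cmInterval {X : Type*} [MetricSpace X] (μ : X → X → X → X) (x y : X) : Set X :=
  {w : X | ∃ z : X, μ x y z = w}

/-- The closed `R`-neighbourhood `{x : dist(x, A) ≤ R}` of a set. -/
def closedNbhd {X : Type*} [MetricSpace X] (R : ℝ) (A : Set X) : Set X :=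
  {x : X | Metric.infDist x A ≤ R}

/-- `A` is `D`-quasiconvex with respect to the coarse median `μ`. -/
def IsCMQuasiconvex {X : Type*} [MetricSpace X] (μ : X → X → X → X) (D : ℝ) (A : Set X) :
    Prop :=
  ∀ a₁ ∈ A, ∀ a₂ ∈ A, cmInterval μ a₁ a₂ ⊆ closedNbhd D A

/-- A metric space is geodesic if any two points are joined by an isometrically embedded
compact real interval. -/
def IsGeodesicSpace (X : Type*) [MetricSpace X] : Prop :=
  ∀ x y : X, ∃ γ : ℝ → X, γ 0 = x ∧ γ (dist x y) = y ∧
    ∀ s ∈ Set.Icc (0 : ℝ) (dist x y), ∀ t ∈ Set.Icc (0 : ℝ) (dist x y),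
      dist (γ s) (γ t) = |s - t|

/-- An `(L, A)`-quasigeodesic from `x` to `y`, defined on the interval `[a, b]`. -/
def IsQuasigeodesicOn {X : Type*} [MetricSpace X] (L A a b : ℝ) (γ : ℝ → X) (x y : X) :
    Prop :=
  a ≤ b ∧ γ a = x ∧ γ b = y ∧
    ∀ s ∈ Set.Icc a b, ∀ t ∈ Set.Icc a b,
      |s - t| / L - A ≤ dist (γ s) (γ t) ∧ dist (γ s) (γ t) ≤ L * |s - t| + A

/-- The Gromov product `⟨y,z⟩_x`. -/
noncomputable def gromovProd {X : Type*} [MetricSpace X] (x y z : X) : ℝ :=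
  (dist x y + dist x z - dist y z) / 2

/-- `X` is `δ`-hyperbolic (four-point condition on Gromov products). -/
def IsDeltaHyperbolic (X : Type*) [MetricSpace X] (δ : ℝ) : Prop :=
  ∀ w x y z : X, min (gromovProd w x y) (gromovProd w y z) ≤ gromovProd w x z + δ

/-- An `ℝ`-tree: a geodesic, `0`-hyperbolic metric space. -/
def IsRTree (T : Type*) [MetricSpace T] : Prop :=
  IsGeodesicSpace T ∧ IsDeltaHyperbolic T 0

/-- An `ℝ`-tree is furry if removing any point leaves at least three connected components. -/
def Furry (T : Type*) [MetricSpace T] : Prop :=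
  ∀ t : T, ∃ a b c : T, a ∈ ({t}ᶜ : Set T) ∧ b ∈ ({t}ᶜ : Set T) ∧ c ∈ ({t}ᶜ : Set T) ∧
    connectedComponentIn ({t}ᶜ : Set T) a ≠ connectedComponentIn ({t}ᶜ : Set T) b ∧
    connectedComponentIn ({t}ᶜ : Set T) b ≠ connectedComponentIn ({t}ᶜ : Set T) c ∧
    connectedComponentIn ({t}ᶜ : Set T) a ≠ connectedComponentIn ({t}ᶜ : Set T) c

/-- A median operator on a set. -/
def IsMedianOp {Ω : Type*} (m : Ω → Ω → Ω → Ω) : Prop :=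
  (∀ x y z : Ω, m x y z = m y x z) ∧
  (∀ x y z : Ω, m x y z = m x z y) ∧
  (∀ x y : Ω, m x x y = x) ∧
  (∀ x y z w : Ω, m (m x w y) w z = m x w (m y w z))

/-- A Lipschitz median operator on a metric space. -/
def IsLipschitzMedianOp {Ω : Type*} [MetricSpace Ω] (m : Ω → Ω → Ω → Ω) : Prop :=
  IsMedianOp m ∧ ∃ L : ℝ, 1 ≤ L ∧
    ∀ x x' y z : Ω, dist (m x y z) (m x' y z) ≤ L * dist x x'

section MedianAlgebra

/-- The interval between `x` and `y` determined by a ternary operation `m`. -/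
def medInt {Ω : Type*} (m : Ω → Ω → Ω → Ω) (x y : Ω) : Set Ω := {z | m x y z = z}

/-- A half of a median algebra: both the set and its complement are convex. -/
def IsHalf {Ω : Type*} (m : Ω → Ω → Ω → Ω) (h : Set Ω) : Prop :=
  ∀ x y z, m x y z ∈ h ↔ (x ∈ h ∧ y ∈ h) ∨ (y ∈ h ∧ z ∈ h) ∨ (x ∈ h ∧ z ∈ h)

end MedianAlgebra

namespace IsMedianOp

variable {Ω : Type*} {m : Ω → Ω → Ω → Ω}

theorem swap12 (hm : IsMedianOp m) (x y z : Ω) : m x y z = m y x z := hm.1 x y z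

theorem swap23 (hm : IsMedianOp m) (x y z : Ω) : m x y z = m x z y := hm.2.1 x y z

theorem swap13 (hm : IsMedianOp m) (x y z : Ω) : m x y z = m z y x := by
  rw [hm.swap12, hm.swap23, hm.swap12]

theorem self_left (hm : IsMedianOp m) (x y : Ω) : m x x y = x := hm.2.2.1 x y

theorem self_right (hm : IsMedianOp m) (x y : Ω) : m x y y = y := by
  rw [hm.swap13, hm.self_left]

theorem self_outer (hm : IsMedianOp m) (x y : Ω) : m x y x = x := by
  rw [hm.swap23, hm.self_left]

theorem assoc (hm : IsMedianOp m) (x y z w : Ω) : m (m x w y) w z = m x w (m y w z) :=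
  hm.2.2.2 x y z w

theorem left_mem (hm : IsMedianOp m) (x y : Ω) : x ∈ medInt m x y := hm.self_outer x y

theorem right_mem (hm : IsMedianOp m) (x y : Ω) : y ∈ medInt m x y := hm.self_right x y

theorem int_symm (hm : IsMedianOp m) {x y z : Ω} (h : z ∈ medInt m x y) : z ∈ medInt m y x := by
  change m y x z = z
  rw [hm.swap12]
  exact h

theorem med_mem (hm : IsMedianOp m) (x y z : Ω) : m x y z ∈ medInt m x y := by
  change m x y (m x y z) = m x y z
  have := hm.assoc x x z y
  rw [hm.self_outer] at this
  exact this.symm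

theorem med_mem' (hm : IsMedianOp m) (x y z : Ω) : m x y z ∈ medInt m y z := by
  rw [hm.swap12, hm.swap23]
  exact hm.med_mem y z x

theorem med_mem'' (hm : IsMedianOp m) (x y z : Ω) : m x y z ∈ medInt m x z := by
  rw [hm.swap23]
  exact hm.med_mem x z y

/-- Transitivity of the order based at `a`. -/
theorem int_trans (hm : IsMedianOp m) {a b c d : Ω} (hd : d ∈ medInt m a c)
    (hc : c ∈ medInt m a b) : d ∈ medInt m a b := by
  change m a c d = d at hd
  change m a b c = c at hc
  change m a b d = d
  have h := hm.assoc b c d a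
  rw [hm.swap12 b a c, hc, hm.swap12 c a d, hd, hm.swap12 b a d] at h
  exact h.symm

/-- In the situation of transitivity, the larger point is between the smaller one and the top. -/
theorem int_shift (hm : IsMedianOp m) {a b c d : Ω} (hd : d ∈ medInt m a c)
    (hc : c ∈ medInt m a b) : c ∈ medInt m d b := by
  change m a c d = d at hd
  change m a b c = c at hc
  change m d b c = c
  have h := hm.assoc d a b c
  have h1 : m d c a = d := by rw [hm.swap13, hd]
  have h2 : m a c b = c := by rw [hm.swap23, hc]
  rw [h1, h2, hm.self_right] at h
  rw [hm.swap23, h]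

theorem int_antisymm (hm : IsMedianOp m) {a b c : Ω} (h1 : b ∈ medInt m a c)
    (h2 : c ∈ medInt m a b) : b = c := by
  change m a c b = b at h1
  change m a b c = c at h2
  rw [← h1, hm.swap23, h2]

/-- The base point order has meets. -/
theorem le_meet (hm : IsMedianOp m) {x y z w : Ω} (h1 : w ∈ medInt m x y)
    (h2 : w ∈ medInt m x z) : w ∈ medInt m x (m x y z) := by
  change m x y w = w at h1
  change m x z w = w at h2
  change m x (m x y z) w = w
  have h := hm.assoc y z w x
  rw [hm.swap12 z x w, h2, hm.swap12 y x w, h1, hm.swap12 y x z, hm.swap12 _ x w] at h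
  exact h

theorem eq_med (hm : IsMedianOp m) {x y z w : Ω} (h1 : w ∈ medInt m x y) (h2 : w ∈ medInt m y z)
    (h3 : w ∈ medInt m x z) : w = m x y z := by
  have a1 := hm.le_meet h1 h3
  have a2 : w ∈ medInt m y (m x y z) := by
    rw [hm.swap12]; exact hm.le_meet (hm.int_symm h1) h2
  have a3 : m x y z ∈ medInt m w y := hm.int_shift a1 (hm.med_mem x y z)
  exact hm.int_antisymm a2 (hm.int_symm a3)

theorem square_aux (hm : IsMedianOp m) {q s c : Ω} (hc : c ∈ medInt m q s) (z : Ω) :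
    m c z q ∈ medInt m q (m q s z) := by
  set z' := m q s z with hz'
  set α := m c z q with hα
  set c1 := m c z z' with hc1
  have z'q : z' ∈ medInt m z q := by rw [hz', hm.swap23]; exact hm.int_symm (hm.med_mem q z s)
  have z's : z' ∈ medInt m z s := hm.int_symm (hm.med_mem' q s z)
  have c1z' : c1 ∈ medInt m z z' := hm.med_mem' c z z'
  have e1 : z' = m q s c1 := hm.eq_med (hm.med_mem q s z) (hm.int_symm (hm.int_shift c1z' z's))
    (hm.int_symm (hm.int_shift c1z' z'q))
  have αz : α ∈ medInt m z c := hm.int_symm (hm.med_mem c z q)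
  have αzq : α ∈ medInt m z q := hm.med_mem' c z q
  have c1q : c1 ∈ medInt m z q := hm.int_trans c1z' z'q
  have c1zc : c1 ∈ medInt m z c := hm.int_symm (hm.med_mem c z z')
  have c1α : c1 ∈ medInt m z α := by
    rw [hα, hm.swap12, hm.swap23]
    have := hm.le_meet c1q c1zc
    exact this
  have e2 : α = m c c1 q := hm.eq_med (hm.int_symm (hm.int_shift c1α αz))
    (hm.int_shift c1α αzq) (hm.med_mem'' c z q)
  have h := hm.assoc c s c1 q
  have h0 : m c q s = c := by rw [hm.swap12, hm.swap23]; exact hc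
  have h1 : m c q c1 = α := by rw [e2, hm.swap23]
  have h2 : m s q c1 = z' := by rw [hm.swap12, ← e1]
  rw [h0, h1, h2] at h
  have : α ∈ medInt m q z' := by rw [h]; exact hm.med_mem' c q z'
  exact this

theorem square_conv (hm : IsMedianOp m) {q s c d z : Ω} (hc : c ∈ medInt m q s)
    (hd : d ∈ medInt m q s) (hz : z ∈ medInt m c d) : z ∈ medInt m q s := by
  have a1 := hm.square_aux hc z
  have a2 := hm.square_aux hd z
  set z' := m q s z with hz'
  have z'q : z' ∈ medInt m q z := by rw [hz', hm.swap23]; exact (hm.med_mem q z s)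
  have b1 : z' ∈ medInt m z (m c z q) := hm.int_symm (hm.int_shift a1 z'q)
  have b2 : z' ∈ medInt m z (m d z q) := hm.int_symm (hm.int_shift a2 z'q)
  have e : m z (m c z q) (m d z q) = z := by
    have h := hm.assoc c q (m d z q) z
    rw [hm.swap12, h]
    have h' := hm.assoc q q d z
    rw [hm.self_outer] at h'
    have : m d z q = m q z d := hm.swap13 _ _ _
    rw [this, ← h', ← hm.assoc, hm.swap13 c z q, hm.assoc, hm.swap23 c z d,
      show m c d z = z from hz, hm.self_right]
  have b3 := hm.le_meet b1 b2
  rw [e] at b3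
  have : z' = z := by
    have h : m z z z' = z' := b3
    rw [← h, hm.self_left]
  exact this

theorem int_convex (hm : IsMedianOp m) {a b c d e : Ω} (hc : c ∈ medInt m a b)
    (hd : d ∈ medInt m a b) (he : e ∈ medInt m c d) : e ∈ medInt m a b := by
  have key : ∀ {x y : Ω}, c ∈ medInt m x y → d ∈ medInt m x y →
      m x c d ∈ medInt m x (m y c d) ∧ c ∈ medInt m (m x c d) (m y c d) ∧
      d ∈ medInt m (m x c d) (m y c d) ∧ m y c d ∈ medInt m x y := by
    intro x y hc hd
    have s1 : m y c d ∈ medInt m y c := hm.med_mem y c d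
    have s2 : m y c d ∈ medInt m y d := hm.med_mem'' y c d
    have q1 : m x c d ∈ medInt m x c := hm.med_mem x c d
    have q2 : m x c d ∈ medInt m x d := hm.med_mem'' x c d
    have c1 : c ∈ medInt m x (m y c d) :=
      hm.int_symm (hm.int_shift s1 (hm.int_symm hc))
    have d1 : d ∈ medInt m x (m y c d) :=
      hm.int_symm (hm.int_shift s2 (hm.int_symm hd))
    exact ⟨hm.int_trans q1 c1, hm.int_shift q1 c1, hm.int_shift q2 d1,
      hm.int_symm (hm.int_trans s1 (hm.int_symm hc))⟩
  obtain ⟨k1, k2, k3, k4⟩ := key hc hd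
  have e1 := hm.square_conv k2 k3 he
  have e2 : e ∈ medInt m a (m b c d) :=
    hm.int_symm (hm.int_trans (hm.int_symm e1) (hm.int_symm k1))
  exact hm.int_trans e2 k4

/-- Intervals are gated. -/
theorem gate (hm : IsMedianOp m) {a b c : Ω} (hc : c ∈ medInt m a b) (e : Ω) :
    m a b e ∈ medInt m c e := by
  set e' := m a b e with he'
  have g1 : m c e e' ∈ medInt m a b :=
    hm.int_convex hc (hm.med_mem a b e) (hm.med_mem'' c e e')
  have g2 : m c e e' ∈ medInt m e e' := hm.med_mem' c e e'
  have g3 := hm.eq_med g1 (hm.int_symm (hm.int_trans g2 (hm.int_symm (hm.med_mem' a b e))))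
    (hm.int_symm (hm.int_trans g2 (hm.int_symm (hm.med_mem'' a b e))))
  exact g3

theorem map_int (hm : IsMedianOp m) (a b : Ω) {c d e : Ω} (he : e ∈ medInt m c d) :
    m a b e ∈ medInt m (m a b c) (m a b d) := by
  set g := m (m a b c) (m a b d) (m a b e) with hg
  have hgab : g ∈ medInt m a b :=
    hm.int_convex (hm.med_mem a b c) (hm.med_mem a b d) (hm.med_mem _ _ _)
  have h1 : g ∈ medInt m (m a b e) c :=
    hm.int_trans (hm.int_symm (hm.med_mem'' _ _ _)) (hm.gate (hm.med_mem a b e) c)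
  have h2 : g ∈ medInt m (m a b e) d :=
    hm.int_trans (hm.int_symm (hm.med_mem' _ _ _)) (hm.gate (hm.med_mem a b e) d)
  have h3 := hm.le_meet h1 h2
  have h4 : m (m a b e) c d ∈ medInt m (m a b e) e := by
    have := hm.gate he (m a b e)
    rw [hm.swap12 _ c d, hm.swap23 c]
    exact hm.int_symm this
  have h5 : g ∈ medInt m (m a b e) e := hm.int_trans h3 h4
  exact (hm.int_antisymm (hm.int_symm h5) (hm.int_symm (hm.gate hgab e)) : g = m a b e)

theorem distrib (hm : IsMedianOp m) (a b x y z : Ω) :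
    m a b (m x y z) = m (m a b x) (m a b y) (m a b z) :=
  hm.eq_med (hm.map_int a b (hm.med_mem x y z)) (hm.map_int a b (hm.med_mem' x y z))
    (hm.map_int a b (hm.med_mem'' x y z))

end IsMedianOp

namespace IsMedianOp

variable {Ω : Type*} {m : Ω → Ω → Ω → Ω}

/-- The join of a convex set with a point is convex. -/
theorem join_convex (hm : IsMedianOp m) {C : Set Ω}
    (hC : ∀ a ∈ C, ∀ b ∈ C, ∀ z, m a b z ∈ C) (u : Ω) {e e' c c' : Ω} (hc : c ∈ C) (hc' : c' ∈ C)
    (he : e ∈ medInt m u c) (he' : e' ∈ medInt m u c') (z : Ω) :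
    ∃ d ∈ C, m e e' z ∈ medInt m u d := by
  set f := m e e' z with hf
  refine ⟨m c c' f, hC c hc c' hc' f, ?_⟩
  have hlow : ∀ {e c : Ω}, e ∈ medInt m u c → m u f c ∈ medInt m f (m u f e) := by
    intro e c he
    have h1 : m u f e ∈ medInt m u (m u f c) := by
      have := hm.map_int u f he
      rwa [hm.self_outer] at this
    exact hm.int_symm (hm.int_shift h1 (hm.med_mem u f c))
  have hff : m f (m u f e) (m u f e') = f := by
    have := hm.map_int u f (hm.med_mem e e' z)
    rw [← hf, hm.self_right] at this
    rw [hm.swap12, hm.swap23]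
    exact this
  have h1 : m f (m u f c) (m u f c') ∈ medInt m f (m f (m u f e) (m u f e')) :=
    hm.le_meet (hm.int_trans (hm.med_mem _ _ _) (hlow he))
      (hm.int_trans (hm.med_mem'' _ _ _) (hlow he'))
  rw [hff] at h1
  have h2 : m f (m u f c) (m u f c') = f := by
    have h : m f f (m f (m u f c) (m u f c')) = _ := h1
    rw [← h, hm.self_left]
  change m u (m c c' f) f = f
  rw [hm.swap23, hm.distrib, hm.self_right, hm.swap23, hm.swap12]
  exact h2

/-- Distinct points are separated by a half. -/
theorem exists_half (hm : IsMedianOp m) {x y : Ω} (hxy : x ≠ y) :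
    ∃ h : Set Ω, IsHalf m h ∧ x ∈ h ∧ y ∉ h := by
  let S : Set (Set Ω) := {C | (∀ a ∈ C, ∀ b ∈ C, ∀ z, m a b z ∈ C) ∧ y ∉ C}
  have hx : {x} ∈ S := by
    refine ⟨?_, fun h => hxy (by simpa using h.symm)⟩
    rintro a rfl b rfl z
    exact hm.self_left _ _
  obtain ⟨C, hxC, hmax⟩ := zorn_subset_nonempty S (by
    intro c hcS hchain hne
    refine ⟨⋃₀ c, ⟨?_, ?_⟩, fun s hs => subset_sUnion_of_mem hs⟩
    · rintro a ⟨s, hs, has⟩ b ⟨t, ht, hbt⟩ z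
      rcases hchain.total hs ht with h | h
      · exact ⟨t, ht, (hcS ht).1 a (h has) b hbt z⟩
      · exact ⟨s, hs, (hcS hs).1 a has b (h hbt) z⟩
    · rintro ⟨s, hs, hys⟩
      exact (hcS hs).2 hys) {x} hx
  have hC := hmax.prop
  have hxC : x ∈ C := hxC rfl
  have hjoin : ∀ u ∉ C, ∃ c ∈ C, y ∈ medInt m u c := by
    intro u hu
    by_contra hcon
    push Not at hcon
    let D : Set Ω := {e | ∃ c ∈ C, e ∈ medInt m u c}
    have hD : D ∈ S := by
      refine ⟨?_, ?_⟩
      · rintro a ⟨c, hc, ha⟩ b ⟨c', hc', hb⟩ z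
        exact hm.join_convex hC.1 u hc hc' ha hb z
      · rintro ⟨c, hc, hy⟩
        exact hcon c hc hy
    have := hmax.le_of_ge hD (fun c hc => ⟨c, hc, hm.right_mem u c⟩)
    exact hu (this ⟨x, hxC, hm.left_mem u x⟩)
  have hco : ∀ u ∉ C, ∀ v ∉ C, ∀ z, m u v z ∉ C := by
    intro u hu v hv z hk
    obtain ⟨c, hc, hyc⟩ := hjoin u hu
    obtain ⟨c', hc', hyc'⟩ := hjoin v hv
    set q := m c c' y with hq
    have hqC : q ∈ C := hC.1 c hc c' hc' y
    have e1 : m q y u = y := by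
      have h1 : q ∈ medInt m y c := hm.int_symm (hm.med_mem'' c c' y)
      have h2 := hm.int_shift (hm.int_symm h1) (hm.int_symm hyc)
      rw [hm.swap23]; exact h2
    have e2 : m q y v = y := by
      have h1 : q ∈ medInt m y c' := hm.int_symm (hm.med_mem' c c' y)
      have h2 := hm.int_shift (hm.int_symm h1) (hm.int_symm hyc')
      rw [hm.swap23]; exact h2
    have e3 : m q y (m u v z) = y := by rw [hm.distrib, e1, e2, hm.self_left]
    have : m q (m u v z) y ∈ C := hC.1 q hqC _ hk y
    rw [hm.swap23, e3] at this
    exact hC.2 this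
  refine ⟨C, ?_, hxC, hC.2⟩
  intro a b c
  constructor
  · intro h
    by_contra hcon
    have : (a ∉ C ∧ b ∉ C) ∨ (b ∉ C ∧ c ∉ C) ∨ (a ∉ C ∧ c ∉ C) := by tauto
    rcases this with ⟨h1, h2⟩ | ⟨h1, h2⟩ | ⟨h1, h2⟩
    · exact hco a h1 b h2 c h
    · exact hco b h1 c h2 a (by rwa [hm.swap12, hm.swap23] at h)
    · exact hco a h1 c h2 b (by rwa [hm.swap23] at h)
  · rintro (⟨h1, h2⟩ | ⟨h1, h2⟩ | ⟨h1, h2⟩)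
    · exact hC.1 a h1 b h2 c
    · rw [hm.swap12, hm.swap23]; exact hC.1 b h1 c h2 a
    · rw [hm.swap23]; exact hC.1 a h1 c h2 b

theorem ext_half (hm : IsMedianOp m) {x y : Ω} (h : ∀ k, IsHalf m k → (x ∈ k → y ∈ k)) :
    x = y := by
  by_contra hne
  obtain ⟨k, hk, hx, hy⟩ := hm.exists_half hne
  exact hy (h k hk hx)

end IsMedianOp

theorem IsHalf.compl {Ω : Type*} {m : Ω → Ω → Ω → Ω} {h : Set Ω} (hh : IsHalf m h) :
    IsHalf m hᶜ := by
  intro x y z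
  have := hh x y z
  simp only [mem_compl_iff]
  tauto

theorem IsHalf.int {Ω : Type*} {m : Ω → Ω → Ω → Ω} {h : Set Ω} (hh : IsHalf m h) {x y z : Ω}
    (hz : z ∈ medInt m x y) (hx : x ∈ h) (hy : y ∈ h) : z ∈ h := by
  have e : m x y z = z := hz
  rw [← e, hh]
  exact Or.inl ⟨hx, hy⟩

theorem IsHalf.int_or {Ω : Type*} {m : Ω → Ω → Ω → Ω} {h : Set Ω} (hh : IsHalf m h) {x y z : Ω}
    (hz : z ∈ medInt m x y) (h' : z ∈ h) : x ∈ h ∨ y ∈ h := by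
  by_contra hcon
  push Not at hcon
  exact hh.compl.int hz hcon.1 hcon.2 h'

theorem IsMedianOp.mem_int_iff {Ω : Type*} {m : Ω → Ω → Ω → Ω} (hm : IsMedianOp m) {x y z : Ω} :
    z ∈ medInt m x y ↔ ∀ h, IsHalf m h → x ∈ h → y ∈ h → z ∈ h := by
  refine ⟨fun hz h hh => hh.int hz, fun H => ?_⟩
  refine hm.ext_half fun k hk h => ?_
  rw [hk] at h
  have := H k hk
  tauto

/-- The points `b j` span a cube with bottom corner `x` and top corner `t`. -/
def Ortho {Ω ι : Type*} (m : Ω → Ω → Ω → Ω) (x : Ω) (b : ι → Ω) (t : Ω) : Prop :=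
  (∀ j, b j ≠ x) ∧ ∀ h, IsHalf m h → x ∉ h →
    (t ∈ h ↔ ∃ j, b j ∈ h) ∧ ∀ i j, b i ∈ h → b j ∈ h → i = j

/-- The join, in the interval from `x` to `t`, of a family of points. -/
noncomputable def jn {Ω ι : Type*} [Fintype ι] (m : Ω → Ω → Ω → Ω) (x t : Ω) (c : ι → Ω) : Ω :=
  Finset.univ.toList.foldr (fun j acc => m t acc (c j)) x

theorem IsHalf.mem_of_int {Ω : Type*} {m : Ω → Ω → Ω → Ω} {h : Set Ω} (hh : IsHalf m h)
    {x y z : Ω} (hz : z ∈ medInt m x y) (hx : x ∉ h) (hzh : z ∈ h) : y ∈ h :=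
  (hh.int_or hz hzh).resolve_left hx

section Ortho

variable {Ω ι : Type*} {m : Ω → Ω → Ω → Ω} {x t : Ω} {b : ι → Ω}

theorem Ortho.top_mem (ho : Ortho m x b t) {h : Set Ω} (hh : IsHalf m h) (hx : x ∉ h) :
    t ∈ h ↔ ∃ j, b j ∈ h := (ho.2 h hh hx).1

theorem Ortho.unique (ho : Ortho m x b t) {h : Set Ω} (hh : IsHalf m h) (hx : x ∉ h) {i j : ι}
    (hi : b i ∈ h) (hj : b j ∈ h) : i = j := (ho.2 h hh hx).2 i j hi hj

theorem Ortho.mem_int (hm : IsMedianOp m) (ho : Ortho m x b t) (j : ι) :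
    b j ∈ medInt m x t := by
  rw [hm.mem_int_iff]
  intro h hh hx ht
  by_contra hj
  exact absurd ht ((ho.top_mem hh.compl (by simpa using hx)).2 ⟨j, hj⟩)

variable [Fintype ι]

theorem jn_mem (ho : Ortho m x b t) {c : ι → Ω} (hc : ∀ j, c j ∈ medInt m x (b j)) {h : Set Ω}
    (hh : IsHalf m h) (hx : x ∉ h) : jn m x t c ∈ h ↔ ∃ j, c j ∈ h := by
  have ht : ∀ j, c j ∈ h → t ∈ h := fun j hj =>
    (ho.top_mem hh hx).2 ⟨j, hh.mem_of_int (hc j) hx hj⟩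
  have key : ∀ l : List ι, l.foldr (fun j acc => m t acc (c j)) x ∈ h ↔ ∃ j ∈ l, c j ∈ h := by
    intro l
    induction l with
    | nil => simp [hx]
    | cons a l ih =>
      rw [List.foldr_cons, hh, ih]
      simp only [List.mem_cons, exists_eq_or_imp]
      constructor
      · rintro (⟨-, h1⟩ | ⟨-, h1⟩ | ⟨-, h1⟩)
        · exact Or.inr h1
        · exact Or.inl h1
        · exact Or.inl h1
      · rintro (h1 | ⟨j, hj, h1⟩)
        · exact Or.inr (Or.inr ⟨ht _ h1, h1⟩)
        · exact Or.inl ⟨ht _ h1, j, hj, h1⟩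
  rw [jn, key]
  simp

theorem jn_mem_of_mem (ho : Ortho m x b t) {c : ι → Ω} (hc : ∀ j, c j ∈ medInt m x (b j))
    {h : Set Ω} (hh : IsHalf m h) (hx : x ∈ h) : jn m x t c ∈ h ↔ ∀ j, c j ∈ h := by
  have := jn_mem ho hc hh.compl (by simpa using hx)
  simp only [mem_compl_iff] at this
  rw [← not_iff_not, this]
  simp

theorem jn_mem_int (hm : IsMedianOp m) (ho : Ortho m x b t) {c : ι → Ω}
    (hc : ∀ j, c j ∈ medInt m x (b j)) : jn m x t c ∈ medInt m x t := by
  rw [hm.mem_int_iff]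
  intro h hh hx ht
  rw [jn_mem_of_mem ho hc hh hx]
  intro j
  exact hh.int (hc j) hx (hh.int (ho.mem_int hm j) hx ht)

theorem proj_jn (hm : IsMedianOp m) (ho : Ortho m x b t) {c : ι → Ω}
    (hc : ∀ j, c j ∈ medInt m x (b j)) (j : ι) : m x (b j) (jn m x t c) = c j := by
  refine (hm.ext_half fun h hh hcj => ?_).symm
  rw [hh]
  by_cases hx : x ∈ h
  · rw [jn_mem_of_mem ho hc hh hx]
    by_cases hb : b j ∈ h
    · exact Or.inl ⟨hx, hb⟩
    · refine Or.inr (Or.inr ⟨hx, fun i => ?_⟩)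
      by_contra hi
      have hbi : b i ∉ h := fun hbi => hi (hh.int (hc i) hx hbi)
      have := ho.unique hh.compl (by simpa using hx) (i := i) (j := j) hbi hb
      exact hi (this ▸ hcj)
  · have hb := hh.mem_of_int (hc j) hx hcj
    exact Or.inr (Or.inl ⟨hb, (jn_mem ho hc hh hx).2 ⟨j, hcj⟩⟩)

theorem jn_proj (hm : IsMedianOp m) (ho : Ortho m x b t) {y : Ω} (hy : y ∈ medInt m x t) :
    jn m x t (fun j => m x (b j) y) = y := by
  have hc : ∀ j, m x (b j) y ∈ medInt m x (b j) := fun j => hm.med_mem _ _ _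
  refine hm.ext_half fun h hh hj => ?_
  by_cases hx : x ∈ h
  · rw [jn_mem_of_mem ho hc hh hx] at hj
    by_contra hyh
    have ht : t ∉ h := fun ht => hyh (hh.int hy hx ht)
    obtain ⟨j, hbj⟩ := (ho.top_mem hh.compl (by simpa using hx)).1 ht
    have := hj j
    rw [hh] at this
    simp only [mem_compl_iff] at hbj
    tauto
  · rw [jn_mem ho hc hh hx] at hj
    obtain ⟨j, hj⟩ := hj
    rw [hh] at hj
    tauto

/-- A family of pairwise orthogonal directions which pairwise span squares spans a cube. -/
theorem exists_ortho_of_flag (hb : ∀ j, b j ≠ x)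
    (hx : ∀ i j, i ≠ j → x ∈ medInt m (b i) (b j))
    (hq : ∀ i j, i ≠ j → ∃ q, b i ∈ medInt m x q ∧ b j ∈ medInt m x q) :
    ∃ t, Ortho m x b t := by
  classical
  have key : ∀ S : Finset ι, ∃ v, ∀ h, IsHalf m h → x ∉ h → (v ∈ h ↔ ∃ j ∈ S, b j ∈ h) := by
    intro S
    induction S using Finset.strongInduction with
    | H S ih =>
      rcases Nat.lt_or_ge 2 S.card with h3 | h3
      · obtain ⟨i, j, k, hi, hj, hk, hij, hik, hjk⟩ := Finset.two_lt_card_iff.1 h3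
        obtain ⟨v1, h1⟩ := ih _ (Finset.erase_ssubset hi)
        obtain ⟨v2, h2⟩ := ih _ (Finset.erase_ssubset hj)
        obtain ⟨v3, h3⟩ := ih _ (Finset.erase_ssubset hk)
        refine ⟨m v1 v2 v3, fun h hh hxh => ?_⟩
        rw [hh, h1 h hh hxh, h2 h hh hxh, h3 h hh hxh]
        constructor
        · rintro (⟨⟨l, hl, h⟩, -⟩ | ⟨⟨l, hl, h⟩, -⟩ | ⟨⟨l, hl, h⟩, -⟩) <;>
            exact ⟨l, Finset.mem_of_mem_erase hl, h⟩
        · rintro ⟨l, hl, hbl⟩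
          by_cases e1 : l = i
          · subst e1
            exact Or.inr (Or.inl ⟨⟨l, Finset.mem_erase.2 ⟨hij, hl⟩, hbl⟩,
              ⟨l, Finset.mem_erase.2 ⟨hik, hl⟩, hbl⟩⟩)
          · by_cases e2 : l = j
            · subst e2
              exact Or.inr (Or.inr ⟨⟨l, Finset.mem_erase.2 ⟨e1, hl⟩, hbl⟩,
                ⟨l, Finset.mem_erase.2 ⟨hjk, hl⟩, hbl⟩⟩)
            · exact Or.inl ⟨⟨l, Finset.mem_erase.2 ⟨e1, hl⟩, hbl⟩,
                ⟨l, Finset.mem_erase.2 ⟨e2, hl⟩, hbl⟩⟩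
      · rcases Nat.lt_or_ge 1 S.card with h2 | h2
        · obtain ⟨i, j, hij, rfl⟩ := Finset.card_eq_two.1 (le_antisymm h3 h2)
          obtain ⟨q, hi, hj⟩ := hq i j hij
          refine ⟨m (b i) (b j) q, fun h hh hxh => ?_⟩
          have := hh.mem_of_int hi hxh
          have := hh.mem_of_int hj hxh
          rw [hh]
          simp only [Finset.mem_insert, Finset.mem_singleton, exists_eq_or_imp, exists_eq_left]
          tauto
        · rcases Finset.card_le_one_iff_subsingleton.1 h2 |>.eq_empty_or_singleton with h0 | ⟨i, h1⟩
          · refine ⟨x, fun h hh hxh => ?_⟩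
            have : S = ∅ := by simpa using h0
            simp [this, hxh]
          · refine ⟨b i, fun h hh hxh => ?_⟩
            have : S = {i} := by exact_mod_cast h1
            simp [this]
  obtain ⟨t, ht⟩ := key Finset.univ
  refine ⟨t, hb, fun h hh hxh => ⟨by simpa using ht h hh hxh, fun i j hi hj => ?_⟩⟩
  by_contra hij
  exact hxh (hh.int (hx i j hij) hi hj)

end Ortho

/-- A finite subset of a median algebra is contained in a finite subalgebra. -/
theorem IsMedianOp.exists_finite_subalgebra {Ω : Type*} {m : Ω → Ω → Ω → Ω} (hm : IsMedianOp m)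
    {A : Set Ω} (hA : A.Finite) :
    ∃ M : Finset Ω, A ⊆ M ∧ ∀ x ∈ M, ∀ y ∈ M, ∀ z ∈ M, m x y z ∈ M := by
  let M : Set Ω := ⋂₀ {C | A ⊆ C ∧ ∀ x ∈ C, ∀ y ∈ C, ∀ z ∈ C, m x y z ∈ C}
  have hcl : ∀ x ∈ M, ∀ y ∈ M, ∀ z ∈ M, m x y z ∈ M := fun x hx y hy z hz C hC =>
    hC.2 x (hx C hC) y (hy C hC) z (hz C hC)
  have htr : ∀ h h', IsHalf m h → IsHalf m h' → (h ∩ A = h' ∩ A) → ∀ y ∈ M, y ∈ h → y ∈ h' := by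
    intro h h' hh hh' e y hy
    have : M ⊆ {y | y ∈ h ↔ y ∈ h'} := by
      refine sInter_subset_of_mem ⟨fun a ha => ?_, fun a ha b hb c hc => ?_⟩
      · have : a ∈ h ∩ A ↔ a ∈ h' ∩ A := by rw [e]
        simpa [ha] using this
      · simp only [mem_ofPred_eq] at *
        rw [hh, hh', ha, hb, hc]
    exact (this hy).1
  let F : Ω → Set (Set Ω) := fun y => {s | ∃ h, IsHalf m h ∧ y ∈ h ∧ s = h ∩ A}
  have hinj : InjOn F M := by
    intro y hy y' hy' e
    refine hm.ext_half fun k hk hyk => ?_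
    have : k ∩ A ∈ F y := ⟨k, hk, hyk, rfl⟩
    rw [e] at this
    obtain ⟨h', hh', hy'h, e'⟩ := this
    exact htr h' k hh' hk e'.symm y' hy' hy'h
  have hfin : M.Finite := by
    refine Set.Finite.of_finite_image (f := F) ?_ hinj
    refine (hA.finite_subsets.finite_subsets).subset ?_
    rintro _ ⟨y, -, rfl⟩ s ⟨h, -, -, rfl⟩
    exact inter_subset_right
  refine ⟨hfin.toFinset, ?_, ?_⟩
  · rw [hfin.coe_toFinset]
    exact subset_sInter fun C hC => hC.1
  · simpa using hcl

/-- Helly's theorem for finite families of convex sets in a median algebra. -/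
theorem IsMedianOp.helly {Ω : Type*} {m : Ω → Ω → Ω → Ω} (hm : IsMedianOp m)
    {M : Set Ω} (hM : ∀ x ∈ M, ∀ y ∈ M, ∀ z ∈ M, m x y z ∈ M) (hne : M.Nonempty) {ι : Type*}
    (s : Finset ι) (C : ι → Set Ω)
    (hC : ∀ i ∈ s, ∀ a ∈ M, ∀ b ∈ M, ∀ z ∈ M, a ∈ C i → b ∈ C i → m a b z ∈ C i)
    (hp : ∀ i ∈ s, ∀ j ∈ s, ∃ a ∈ M, a ∈ C i ∧ a ∈ C j) : ∃ a ∈ M, ∀ i ∈ s, a ∈ C i := by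
  classical
  induction s using Finset.induction_on generalizing C with
  | empty => obtain ⟨a, ha⟩ := hne; exact ⟨a, ha, by simp⟩
  | insert i s hi ih =>
    have hii := Finset.mem_insert_self i s
    rcases s.eq_empty_or_nonempty with rfl | ⟨k, hk⟩
    · obtain ⟨a, ha, h, -⟩ := hp i hii i hii
      exact ⟨a, ha, by simpa using h⟩
    · obtain ⟨a, ha, h⟩ := ih (fun j => C j ∩ C i) (by
        intro j hj a ha b hb z hz ha' hb'
        exact ⟨hC j (Finset.mem_insert_of_mem hj) a ha b hb z hz ha'.1 hb'.1,
          hC i hii a ha b hb z hz ha'.2 hb'.2⟩) (by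
        intro j hj l hl
        have hj' := (Finset.mem_insert_of_mem hj : j ∈ insert i s)
        have hl' := (Finset.mem_insert_of_mem hl : l ∈ insert i s)
        obtain ⟨a, ha, a1, a2⟩ := hp j hj' l hl'
        obtain ⟨b, hb, b1, b2⟩ := hp j hj' i hii
        obtain ⟨c, hc, c1, c2⟩ := hp l hl' i hii
        have e1 : m a b c ∈ C j := hC j hj' a ha b hb c hc a1 b1
        have e2 : m a b c ∈ C i := by
          rw [hm.swap12, hm.swap23]; exact hC i hii b hb c hc a ha b2 c2
        have e3 : m a b c ∈ C l := by
          rw [hm.swap23]; exact hC l hl' a ha c hc b hb a2 c1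
        exact ⟨m a b c, hM a ha b hb c hc, ⟨e1, e2⟩, ⟨e3, e2⟩⟩)
      refine ⟨a, ha, fun j hj => ?_⟩
      rcases Finset.mem_insert.1 hj with rfl | hj
      · exact (h k hk).2
      · exact (h j hj).1

/-! ### The Poincaré–Miranda theorem -/

section Miranda

variable {n : ℕ}

/-- The indicator of a set of directions. -/
def dirSum (J : Finset (Fin n)) : Fin n → ℕ := fun i => if i ∈ J then 1 else 0

/-- The iterated cup product of the coboundaries of the first `k` functions, on the cube
with corner `z` and directions `J`, modulo two. -/
def cupProd (a : ℕ → (Fin n → ℕ) → ZMod 2) : ℕ → Finset (Fin n) → (Fin n → ℕ) → ZMod 2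
  | 0, J, _ => if J = ∅ then 1 else 0
  | k + 1, J, z => ∑ j ∈ J, cupProd a k (J.erase j) z *
      (a k (z + dirSum J) + a k (z + dirSum (J.erase j)))

theorem dirSum_erase {J : Finset (Fin n)} {i : Fin n} (hi : i ∈ J) (z : Fin n → ℕ) :
    z + dirSum {i} + dirSum (J.erase i) = z + dirSum J := by
  funext l
  by_cases h : l = i
  · subst h; simp [dirSum, hi]
  · simp [dirSum, h]

theorem sum_offDiag_eq_zero {J : Finset (Fin n)} (f : Fin n → Fin n → ZMod 2)
    (hf : ∀ i j, f i j = f j i) : ∑ j ∈ J, ∑ i ∈ J.erase j, f i j = 0 := by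
  induction J using Finset.induction_on with
  | empty => simp
  | insert k J hk ih =>
    rw [Finset.sum_insert hk, Finset.erase_insert hk]
    have : ∀ j ∈ J, ∑ i ∈ (insert k J).erase j, f i j = f k j + ∑ i ∈ J.erase j, f i j := by
      intro j hj
      have hkj : k ≠ j := fun h => hk (h ▸ hj)
      rw [Finset.erase_insert_of_ne hkj, Finset.sum_insert (by simp [hk])]
    rw [Finset.sum_congr rfl this, Finset.sum_add_distrib, ih, add_zero,
      Finset.sum_congr rfl (fun i _ => hf i k), CharTwo.add_self_eq_zero]

theorem sum_erase_comm {J : Finset (Fin n)} (f : Fin n → Fin n → ZMod 2) :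
    ∑ i ∈ J, ∑ j ∈ J.erase i, f i j = ∑ j ∈ J, ∑ i ∈ J.erase j, f i j := by
  refine Finset.sum_comm' fun x y => ?_
  simp only [Finset.mem_erase, ne_eq]
  constructor
  · rintro ⟨h1, h2, h3⟩; exact ⟨⟨fun h => h2 h.symm, h1⟩, h3⟩
  · rintro ⟨⟨h1, h2⟩, h3⟩; exact ⟨h2, fun h => h1 h.symm, h3⟩

theorem cupProd_cocycle (a : ℕ → (Fin n → ℕ) → ZMod 2) (k : ℕ) (J : Finset (Fin n))
    (z : Fin n → ℕ) :
    ∑ i ∈ J, (cupProd a k (J.erase i) (z + dirSum {i}) + cupProd a k (J.erase i) z) = 0 := by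
  induction k generalizing J z with
  | zero =>
    refine Finset.sum_eq_zero fun i _ => ?_
    simp only [cupProd]
    exact CharTwo.add_self_eq_zero _
  | succ k ih =>
    set C := fun i j => cupProd a k ((J.erase i).erase j) with hC
    have hCs : ∀ i j, C i j = C j i := fun i j => by simp only [hC, Finset.erase_right_comm]
    have e : ∀ i ∈ J, cupProd a (k+1) (J.erase i) (z + dirSum {i}) + cupProd a (k+1) (J.erase i) z
        = ∑ j ∈ J.erase i, ((C i j (z + dirSum {i}) + C i j z) * a k (z + dirSum (J.erase j))
          + (C i j z * a k (z + dirSum (J.erase j)) + C i j z * a k (z + dirSum (J.erase i)))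
          + (C i j (z + dirSum {i})) * a k (z + dirSum J)
          + C i j z * a k (z + dirSum ((J.erase i).erase j))) := by
      intro i hi
      rw [cupProd, cupProd, ← Finset.sum_add_distrib]
      refine Finset.sum_congr rfl fun j hj => ?_
      have hij : i ∈ J.erase j := by
        simp only [Finset.mem_erase, ne_eq] at hj ⊢
        exact ⟨fun h => hj.1 h.symm, hi⟩
      rw [dirSum_erase hi, Finset.erase_right_comm (a := i), dirSum_erase hij]
      simp only [hC, Finset.erase_right_comm (a := i)]
      have := CharTwo.add_self_eq_zero (cupProd a k ((J.erase j).erase i) z * 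
        a k (z + dirSum (J.erase j)))
      linear_combination (-1 : ZMod 2) * this
    rw [Finset.sum_congr rfl e]
    simp only [Finset.sum_add_distrib]
    have ih' : ∀ j, ∑ i ∈ J.erase j, (C i j (z + dirSum {i}) + C i j z) = 0 := by
      intro j
      have := ih (J.erase j) z
      simpa only [hC, Finset.erase_right_comm (a := j)] using this
    have hB : ∑ i ∈ J, ∑ j ∈ J.erase i, C i j z = 0 := by
      rw [sum_erase_comm]
      exact sum_offDiag_eq_zero _ fun i j => by rw [hCs]
    have h1 : ∑ i ∈ J, ∑ j ∈ J.erase i,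
        (C i j (z + dirSum {i}) + C i j z) * a k (z + dirSum (J.erase j)) = 0 := by
      rw [sum_erase_comm]
      refine Finset.sum_eq_zero fun j _ => ?_
      rw [← Finset.sum_mul, ih', zero_mul]
    have h2 : ∑ i ∈ J, ∑ j ∈ J.erase i, C i j z * a k (z + dirSum (J.erase j)) +
        ∑ i ∈ J, ∑ j ∈ J.erase i, C i j z * a k (z + dirSum (J.erase i)) = 0 := by
      rw [sum_erase_comm]
      rw [Finset.sum_congr rfl fun j _ => Finset.sum_congr rfl fun i _ => by rw [hCs i j]]
      exact CharTwo.add_self_eq_zero _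
    have h3 : ∑ i ∈ J, ∑ j ∈ J.erase i, C i j (z + dirSum {i}) * a k (z + dirSum J) = 0 := by
      have : ∑ i ∈ J, ∑ j ∈ J.erase i, (C i j (z + dirSum {i}) + C i j z) = 0 := by
        rw [sum_erase_comm]
        exact Finset.sum_eq_zero fun j _ => ih' j
      simp only [Finset.sum_add_distrib] at this
      rw [hB, add_zero] at this
      simp only [← Finset.sum_mul, this, zero_mul]
    have h4 : ∑ i ∈ J, ∑ j ∈ J.erase i, C i j z * a k (z + dirSum ((J.erase i).erase j)) = 0 := by
      rw [sum_erase_comm]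
      refine sum_offDiag_eq_zero _ fun i j => ?_
      rw [hCs, Finset.erase_right_comm]
    rw [h1, h2, h3, h4]
    simp

/-- The top cup product is the coboundary of a product. -/
theorem cupProd_succ_eq (a : ℕ → (Fin n → ℕ) → ZMod 2) (k : ℕ) (J : Finset (Fin n))
    (z : Fin n → ℕ) :
    cupProd a (k + 1) J z = ∑ j ∈ J,
      (cupProd a k (J.erase j) (z + dirSum {j}) * a k (z + dirSum {j} + dirSum (J.erase j)) +
        cupProd a k (J.erase j) z * a k (z + dirSum (J.erase j))) := by
  have h := cupProd_cocycle a k J z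
  have e : ∀ j ∈ J,
      (cupProd a k (J.erase j) (z + dirSum {j}) * a k (z + dirSum {j} + dirSum (J.erase j)) +
        cupProd a k (J.erase j) z * a k (z + dirSum (J.erase j))) =
      cupProd a k (J.erase j) z * (a k (z + dirSum J) + a k (z + dirSum (J.erase j))) +
      (cupProd a k (J.erase j) (z + dirSum {j}) + cupProd a k (J.erase j) z) *
        a k (z + dirSum J) := by
    intro j hj
    rw [dirSum_erase hj]
    have := CharTwo.add_self_eq_zero (cupProd a k (J.erase j) z * a k (z + dirSum J))
    linear_combination (-1 : ZMod 2) * this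
  rw [Finset.sum_congr rfl e, Finset.sum_add_distrib, ← Finset.sum_mul, h, zero_mul, add_zero,
    cupProd]

/-- The cup product vanishes when one of the functions is constant on the cube. -/
theorem cupProd_eq_zero (a : ℕ → (Fin n → ℕ) → ZMod 2) {k j : ℕ} (hj : j < k)
    (J : Finset (Fin n)) (z : Fin n → ℕ) (r : ZMod 2)
    (hc : ∀ K ⊆ J, a j (z + dirSum K) = r) : cupProd a k J z = 0 := by
  induction k generalizing J with
  | zero => omega
  | succ k ih =>
    rw [cupProd]
    refine Finset.sum_eq_zero fun i hi => ?_
    rcases Nat.lt_succ_iff_lt_or_eq.1 hj with h | rfl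
    · rw [ih h _ fun K hK => hc K (hK.trans (Finset.erase_subset _ _)), zero_mul]
    · rw [hc _ subset_rfl, hc _ (Finset.erase_subset _ _), CharTwo.add_self_eq_zero, mul_zero]

theorem sum_piFinset_update (S : Fin n → Finset ℕ) (j : Fin n) (A : Finset ℕ)
    (F : (Fin n → ℕ) → ZMod 2) :
    ∑ z ∈ Fintype.piFinset (Function.update S j A), F z =
      ∑ r ∈ A, ∑ z ∈ Fintype.piFinset (Function.update S j {r}), F z := by
  rw [← Finset.sum_biUnion]
  · refine Finset.sum_congr ?_ fun _ _ => rfl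
    ext z
    simp only [Fintype.mem_piFinset, Finset.mem_biUnion]
    constructor
    · intro h
      refine ⟨z j, by simpa using h j, fun i => ?_⟩
      by_cases hi : i = j
      · subst hi; simp
      · simpa [hi] using h i
    · rintro ⟨r, hr, h⟩ i
      by_cases hi : i = j
      · subst hi
        have := h i
        simp only [Function.update_self, Finset.mem_singleton] at this
        simpa [this] using hr
      · simpa [hi] using h i
  · intro r _ r' _ hrr'
    refine Finset.disjoint_left.2 fun z hz hz' => hrr' ?_
    simp only [Fintype.mem_piFinset] at hz hz'
    have h1 := hz j
    have h2 := hz' j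
    simp only [Function.update_self, Finset.mem_singleton] at h1 h2
    rw [← h1, ← h2]

theorem sum_piFinset_shift (S : Fin n → Finset ℕ) (j : Fin n) (r : ℕ)
    (F : (Fin n → ℕ) → ZMod 2) :
    ∑ z ∈ Fintype.piFinset (Function.update S j {r}), F (z + dirSum {j}) =
      ∑ z ∈ Fintype.piFinset (Function.update S j {r + 1}), F z := by
  refine Finset.sum_nbij' (fun z => z + dirSum {j}) (fun z => z - dirSum {j}) ?_ ?_ ?_ ?_ ?_
  · intro z hz
    simp only [Fintype.mem_piFinset] at hz ⊢
    intro i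
    have := hz i
    by_cases hi : i = j
    · subst hi; simp [dirSum] at this ⊢; exact this
    · simpa [dirSum, hi] using this
  · intro z hz
    simp only [Fintype.mem_piFinset] at hz ⊢
    intro i
    have := hz i
    by_cases hi : i = j
    · subst hi; simp [dirSum] at this ⊢; omega
    · simpa [dirSum, hi] using this
  · intro z _
    funext i
    simp
  · intro z hz
    simp only [Fintype.mem_piFinset] at hz
    funext i
    by_cases hi : i = j
    · subst hi
      have := hz i
      simp at this
      simp [dirSum, this]
    · simp [dirSum, hi]
  · intro z _
    rfl

/-- Summation by parts along one direction. -/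
theorem sum_piFinset_telescope (S : Fin n → Finset ℕ) (j : Fin n) (N : ℕ)
    (hS : S j = Finset.range N) (F : (Fin n → ℕ) → ZMod 2) :
    ∑ z ∈ Fintype.piFinset S, (F (z + dirSum {j}) + F z) =
      ∑ z ∈ Fintype.piFinset (Function.update S j {N}), F z +
      ∑ z ∈ Fintype.piFinset (Function.update S j {0}), F z := by
  have hS' : S = Function.update S j (Finset.range N) := by rw [← hS, Function.update_eq_self]
  conv_lhs => rw [hS', sum_piFinset_update]
  simp only [Finset.sum_add_distrib, sum_piFinset_shift]
  have := Finset.sum_range_sub (fun r => ∑ z ∈ Fintype.piFinset (Function.update S j {r}), F z) N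
  simp only [CharTwo.sub_eq_add, Finset.sum_add_distrib] at this
  exact this

/-- A cubical form of Sperner's lemma. -/
theorem sum_cupProd (a : ℕ → (Fin n → ℕ) → ZMod 2) (N : ℕ)
    (h0 : ∀ (i : Fin n) z, z i = 0 → a i z = 0) (hN : ∀ (i : Fin n) z, z i = N → a i z = 1)
    (k : ℕ) (hk : k ≤ n) :
    ∑ z ∈ Fintype.piFinset (fun i : Fin n => if (i : ℕ) < k then Finset.range N else {N}),
      cupProd a k (Finset.univ.filter fun i : Fin n => (i : ℕ) < k) z = 1 := by
  induction k with
  | zero => simp [cupProd]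
  | succ k ih =>
    set J := Finset.univ.filter fun i : Fin n => (i : ℕ) < k + 1 with hJ
    set S := fun i : Fin n => if (i : ℕ) < k + 1 then Finset.range N else {N} with hS
    simp only [cupProd_succ_eq]
    rw [Finset.sum_comm]
    have e : ∀ j ∈ J, ∑ z ∈ Fintype.piFinset S,
        (cupProd a k (J.erase j) (z + dirSum {j}) * a k (z + dirSum {j} + dirSum (J.erase j)) +
        cupProd a k (J.erase j) z * a k (z + dirSum (J.erase j))) = 
        if (j : ℕ) = k then 1 else 0 := by
      intro j hj
      have hjk : (j : ℕ) < k + 1 := by simpa [hJ] using hj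
      rw [sum_piFinset_telescope S j N (if_pos hjk)
        (fun z => cupProd a k (J.erase j) z * a k (z + dirSum (J.erase j)))]
      have hzj : ∀ r z, z ∈ Fintype.piFinset (Function.update S j {r}) → ∀ K ⊆ J.erase j,
          (z + dirSum K) j = r := by
        intro r z hz K hK
        have h1 := Fintype.mem_piFinset.1 hz j
        have : j ∉ K := fun h => by simpa using hK h
        simpa [dirSum, this] using h1
      split_ifs with hjk'
      · have e0 : ∀ z ∈ Fintype.piFinset (Function.update S j {0}),
            cupProd a k (J.erase j) z * a k (z + dirSum (J.erase j)) = 0 := by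
          intro z hz
          rw [← hjk', h0 j _ (hzj 0 z hz _ subset_rfl), mul_zero]
        have e1 : ∀ z ∈ Fintype.piFinset (Function.update S j {N}),
            cupProd a k (J.erase j) z * a k (z + dirSum (J.erase j)) = cupProd a k
              (Finset.univ.filter fun i : Fin n => (i : ℕ) < k) z := by
          intro z hz
          have : J.erase j = Finset.univ.filter fun i : Fin n => (i : ℕ) < k := by
            ext i
            simp only [hJ, Finset.mem_erase, Finset.mem_filter, Finset.mem_univ, true_and, ne_eq,
              Fin.ext_iff]
            omega
          rw [← this]
          conv_lhs => rw [← hjk', hN j _ (hzj N z hz _ subset_rfl), mul_one]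
          rw [hjk']
        rw [Finset.sum_congr rfl e0, Finset.sum_congr rfl e1, Finset.sum_const_zero, add_zero,
          ← ih (by omega)]
        congr 2
        funext i
        by_cases hi : i = j
        · subst hi; simp [hjk']
        · have : (i : ℕ) ≠ k := fun h => hi (Fin.ext (h.trans hjk'.symm))
          have : (i : ℕ) < k + 1 ↔ (i : ℕ) < k := by omega
          simp only [hS, Function.update_of_ne hi, this]
      · have hlt : (j : ℕ) < k := by omega
        rw [Finset.sum_eq_zero, Finset.sum_eq_zero, add_zero]
        · intro z hz
          rw [cupProd_eq_zero a hlt _ z 0 fun K hK => h0 j _ (hzj 0 z hz K hK), zero_mul]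
        · intro z hz
          rw [cupProd_eq_zero a hlt _ z 1 fun K hK => hN j _ (hzj N z hz K hK), zero_mul]
    rw [Finset.sum_congr rfl e]
    rw [Finset.sum_eq_single_of_mem (⟨k, by omega⟩ : Fin n) (by simp [hJ])]
    · simp
    · intro j _ hj
      rw [if_neg]
      intro h
      exact hj (Fin.ext h)

theorem exists_rainbow_cube (a : Fin n → (Fin n → ℕ) → ZMod 2) (N : ℕ)
    (h0 : ∀ (i : Fin n) z, z i = 0 → a i z = 0) (hN : ∀ (i : Fin n) z, z i = N → a i z = 1) :
    ∃ z : Fin n → ℕ, (∀ i, z i < N) ∧ ∀ i r, ∃ K, a i (z + dirSum K) = r := by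
  let a' : ℕ → (Fin n → ℕ) → ZMod 2 := fun k => if h : k < n then a ⟨k, h⟩ else 0
  have ha' : ∀ i : Fin n, a' i = a i := fun i => by simp [a']
  have h := sum_cupProd a' N (by simpa [ha'] using h0) (by simpa [ha'] using hN) n le_rfl
  obtain ⟨z, hz, hne⟩ := Finset.exists_ne_zero_of_sum_ne_zero (h.trans_ne one_ne_zero)
  refine ⟨z, fun i => by simpa using Fintype.mem_piFinset.1 hz i, fun i r => ?_⟩
  by_contra hcon
  push Not at hcon
  refine hne (cupProd_eq_zero a' i.2 _ z (r + 1) fun K _ => ?_)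
  have := hcon K
  rw [ha']
  exact (show ∀ s r : ZMod 2, s ≠ r → s = r + 1 by decide) _ _ this

/-- The Poincaré–Miranda theorem on the unit cube. -/
theorem poincare_miranda (f : Fin n → (Fin n → unitInterval) → ℝ) (hf : ∀ i, Continuous (f i))
    (h0 : ∀ i s, s i = 0 → f i s ≤ 0) (h1 : ∀ i s, s i = 1 → 0 ≤ f i s) :
    ∃ s, ∀ i, f i s = 0 := by
  by_contra hcon
  push Not at hcon
  have hc : ∃ c > 0, ∀ s, ∃ i, c ≤ |f i s| := by
    have hcont : Continuous fun s => ∑ i, |f i s| :=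
      continuous_finsetSum _ fun i _ => (hf i).abs
    obtain ⟨s0, -, hs0⟩ := isCompact_univ.exists_isMinOn univ_nonempty hcont.continuousOn
    obtain ⟨i0, hi0⟩ := hcon s0
    have hn : 0 < (n : ℝ) := by exact_mod_cast i0.pos
    have hpos : 0 < ∑ i, |f i s0| :=
      Finset.sum_pos' (fun i _ => abs_nonneg _) ⟨i0, Finset.mem_univ _, abs_pos.2 hi0⟩
    refine ⟨(∑ i, |f i s0|) / n, by positivity, fun s => ?_⟩
    by_contra hlt
    push Not at hlt
    have h2 : ∑ i, |f i s| < ∑ _i : Fin n, (∑ i, |f i s0|) / n :=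
      Finset.sum_lt_sum_of_nonempty ⟨i0, Finset.mem_univ _⟩ fun i _ => hlt i
    have h3 := hs0 (mem_univ s)
    simp only [mem_ofPred_eq] at h3
    rw [Finset.sum_const, Finset.card_univ, Fintype.card_fin, nsmul_eq_mul,
      mul_div_cancel₀ _ hn.ne'] at h2
    linarith
  obtain ⟨c, hc0, hc⟩ := hc
  have hu : ∀ i, ∃ δ > 0, ∀ s s', dist s s' < δ → dist (f i s) (f i s') < c := fun i => by
    have := (Metric.uniformContinuous_iff.1
      (CompactSpace.uniformContinuous_of_continuous (hf i))) c hc0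
    obtain ⟨δ, h, h'⟩ := this
    exact ⟨δ, h, fun s s' => h' (a := s) (b := s')⟩
  choose δ hδ hδ' using hu
  have hδm : ∃ d > 0, ∀ i, d ≤ δ i := by
    rcases isEmpty_or_nonempty (Fin n) with he | he
    · exact ⟨1, one_pos, fun i => he.elim i⟩
    · obtain ⟨i, hi⟩ := Finite.exists_min δ
      exact ⟨δ i, hδ i, hi⟩
  obtain ⟨d, hd, hdδ⟩ := hδm
  obtain ⟨N, hN⟩ := exists_nat_gt (1 / d)
  have hNpos : (0 : ℝ) < N := lt_trans (by positivity) hN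
  let pt : (Fin n → ℕ) → (Fin n → unitInterval) := fun v i =>
    Set.projIcc 0 1 zero_le_one ((v i : ℝ) / N)
  classical
  obtain ⟨z, hz, hr⟩ := exists_rainbow_cube
    (fun i v => if v i = 0 then 0 else if v i = N then 1 else if 0 < f i (pt v) then 1 else 0) N
    (by intro i z h; simp [h]) (by
      intro i z h
      have : N ≠ 0 := by exact_mod_cast hNpos.ne'
      simp [h, this])
  have hclose : ∀ K, dist (pt (z + dirSum K)) (pt z) < d := by
    intro K
    refine (dist_pi_lt_iff hd).2 fun i => ?_
    refine lt_of_le_of_lt ((LipschitzWith.projIcc zero_le_one).dist_le_mul _ _) ?_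
    rw [NNReal.coe_one, one_mul, Real.dist_eq]
    have : ((z + dirSum K) i : ℝ) / N - (z i : ℝ) / N = (dirSum K i : ℝ) / N := by
      simp [add_div]
    rw [this, abs_of_nonneg (by positivity)]
    have h1 : (dirSum K i : ℝ) ≤ 1 := by
      simp only [dirSum]; split_ifs <;> simp
    calc (dirSum K i : ℝ) / N ≤ 1 / N := by gcongr
      _ < d := by rw [div_lt_comm₀ hNpos hd]; exact hN
  obtain ⟨i, hi⟩ := hc (pt z)
  have hval : ∀ K, |f i (pt (z + dirSum K)) - f i (pt z)| < c := fun K =>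
    hδ' i _ _ (lt_of_lt_of_le (hclose K) (hdδ i))
  obtain ⟨K1, hK1⟩ := hr i 1
  obtain ⟨K0, hK0⟩ := hr i 0
  have g1 : 0 ≤ f i (pt (z + dirSum K1)) := by
    split_ifs at hK1 with e1 e2 e3
    · simp at hK1
    · exact h1 i _ (by
        simp only [pt, e2]
        rw [div_self hNpos.ne']
        simp)
    · exact e3.le
    · simp at hK1
  have g0 : f i (pt (z + dirSum K0)) ≤ 0 := by
    split_ifs at hK0 with e1 e2 e3
    · exact h0 i _ (by simp [pt, e1])
    · simp at hK0
    · simp at hK0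
    · exact not_lt.1 e3
  have b1 := abs_lt.1 (hval K1)
  have b0 := abs_lt.1 (hval K0)
  rcases le_abs.1 hi with h | h <;> linarith

end Miranda

/-- A median operator which is `L`-Lipschitz in each variable. -/
def LipMed {Ω : Type*} [MetricSpace Ω] (m : Ω → Ω → Ω → Ω) (L : ℝ) : Prop :=
  IsMedianOp m ∧ 1 ≤ L ∧ ∀ x x' y z : Ω, dist (m x y z) (m x' y z) ≤ L * dist x x'

section LipMed

variable {Ω : Type*} [MetricSpace Ω] {m : Ω → Ω → Ω → Ω} {L : ℝ}

theorem LipMed.dist_le (h : LipMed m L) (x y z x' y' z' : Ω) :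
    dist (m x y z) (m x' y' z') ≤ L * (dist x x' + dist y y' + dist z z') := by
  obtain ⟨hm, -, hl⟩ := h
  have h1 := hl x x' y z
  have h2 : dist (m x' y z) (m x' y' z) ≤ L * dist y y' := by
    rw [hm.swap12 x' y, hm.swap12 x' y']; exact hl _ _ _ _
  have h3 : dist (m x' y' z) (m x' y' z') ≤ L * dist z z' := by
    rw [hm.swap13 x' y' z, hm.swap13 x' y' z']; exact hl _ _ _ _
  calc dist (m x y z) (m x' y' z') ≤ _ := dist_triangle4 _ _ _ _
    _ ≤ _ := by linarith

theorem LipMed.pos (h : LipMed m L) : 0 < L := lt_of_lt_of_le one_pos h.2.1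

theorem LipMed.continuous_med (h : LipMed m L) :
    Continuous fun q : Ω × Ω × Ω => m q.1 q.2.1 q.2.2 := by
  have : LipschitzWith (Real.toNNReal (L * 3)) fun q : Ω × Ω × Ω => m q.1 q.2.1 q.2.2 := by
    refine LipschitzWith.of_dist_le_mul fun q q' => (h.dist_le _ _ _ _ _ _).trans ?_
    rw [Real.coe_toNNReal _ (by have := h.pos; positivity), mul_assoc]
    have h1 : dist q.1 q'.1 ≤ dist q q' := le_max_left _ _
    have h2 : dist q.2 q'.2 ≤ dist q q' := le_max_right _ _
    have h3 : dist q.2.1 q'.2.1 ≤ dist q.2 q'.2 := le_max_left _ _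
    have h4 : dist q.2.2 q'.2.2 ≤ dist q.2 q'.2 := le_max_right _ _
    have := h.pos
    gcongr
    linarith
  exact this.continuous

theorem LipMed.continuous (h : LipMed m L) {X : Type*} [TopologicalSpace X] {f g k : X → Ω}
    (hf : Continuous f) (hg : Continuous g) (hk : Continuous k) :
    Continuous fun a => m (f a) (g a) (k a) :=
  h.continuous_med.comp (hf.prodMk (hg.prodMk hk))

theorem LipMed.exists_jn_lipschitz (h : LipMed m L) {ι : Type*} [Fintype ι] (x t : Ω) :
    ∃ K : NNReal, LipschitzWith K (jn m x t : (ι → Ω) → Ω) := by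
  have key : ∀ l : List ι, ∃ K : ℝ, 0 ≤ K ∧ ∀ c c' : ι → Ω,
      dist (l.foldr (fun j acc => m t acc (c j)) x) (l.foldr (fun j acc => m t acc (c' j)) x) ≤
        K * dist c c' := by
    intro l
    induction l with
    | nil => exact ⟨0, le_rfl, by simp⟩
    | cons a l ih =>
      obtain ⟨K, hK, ih⟩ := ih
      have := h.pos
      refine ⟨L * (K + 1), by positivity, fun c c' => ?_⟩
      simp only [List.foldr_cons]
      refine (h.dist_le _ _ _ _ _ _).trans ?_
      rw [dist_self, zero_add, mul_assoc]
      gcongr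
      rw [add_mul, one_mul]
      exact add_le_add (ih c c') (dist_le_pi_dist c c' a)
  obtain ⟨K, hK, hl⟩ := key Finset.univ.toList
  exact ⟨⟨K, hK⟩, LipschitzWith.of_dist_le_mul hl⟩

theorem LipMed.continuous_jn (h : LipMed m L) {ι : Type*} [Fintype ι] (x t : Ω) :
    Continuous (jn m x t : (ι → Ω) → Ω) := by
  obtain ⟨K, hK⟩ := h.exists_jn_lipschitz (ι := ι) x t
  exact hK.continuous

/-- A point in the convex hull of few nearby points is near them. -/
theorem LipMed.dist_hull_le (h : LipMed m L) {ι : Type*} [Fintype ι] [Nonempty ι] (x : ι → Ω)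
    (c y : Ω) (δ : ℝ) (hδ : ∀ i, dist (x i) c ≤ δ)
    (hy : ∀ k, IsHalf m k → (∀ i, x i ∈ k) → y ∈ k) :
    dist y c ≤ (2 * L) ^ Fintype.card ι * δ := by
  obtain ⟨i0⟩ := ‹Nonempty ι›
  set F := fun l : List ι => l.foldr (fun i acc => m (x i) y acc) (x i0) with hF
  have hmem : ∀ l k, IsHalf m k → y ∉ k → (F l ∈ k ↔ x i0 ∈ k ∧ ∀ i ∈ l, x i ∈ k) := by
    intro l k hk hyk
    induction l with
    | nil => simp [hF]
    | cons a l ih =>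
      simp only [hF, List.foldr_cons] at ih ⊢
      rw [hk, ih]
      simp only [List.mem_cons, forall_eq_or_imp]
      tauto
  have hδ0 : 0 ≤ δ := dist_nonneg.trans (hδ i0)
  have hL := h.2.1
  have hdist : ∀ l, dist (F l) c ≤ (2 * L) ^ l.length * δ := by
    intro l
    induction l with
    | nil => simpa [hF] using hδ i0
    | cons a l ih =>
      have e : F (a :: l) = m (x a) y (F l) := rfl
      have e' : c = m c y c := (h.1.self_outer c y).symm
      rw [e]
      conv_lhs => rw [e']
      refine (h.dist_le _ _ _ _ _ _).trans ?_
      rw [dist_self, add_zero, List.length_cons, pow_succ]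
      have h1 : (1 : ℝ) ≤ (2 * L) ^ l.length := one_le_pow₀ (by linarith)
      have h2 : δ ≤ (2 * L) ^ l.length * δ := by nlinarith
      have := hδ a
      have : L * (dist (x a) c + dist (F l) c) ≤ L * ((2 * L) ^ l.length * δ + (2 * L) ^ l.length * δ) := by
        gcongr
        linarith
      linarith
  have hFy : F Finset.univ.toList = y := by
    refine h.1.ext_half fun k hk hFk => ?_
    by_contra hyk
    rw [hmem _ k hk hyk] at hFk
    exact hyk (hy k hk fun i => hFk.2 i (by simp))
  have := hdist Finset.univ.toList
  rwa [hFy, Finset.length_toList, Finset.card_univ] at this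

end LipMed

section Walls

variable {Ω : Type*} {m : Ω → Ω → Ω → Ω}

/-- A cube of the finite subalgebra `M`, with bottom corner closest to `o`. -/
def MCube {ι : Type*} (m : Ω → Ω → Ω → Ω) (M : Finset Ω) (o x : Ω) (b : ι → Ω) (t : Ω) : Prop :=
  x ∈ M ∧ (∀ j, b j ∈ M) ∧ t ∈ M ∧ Ortho m x b t ∧
    (∀ j, ∀ y ∈ M, m x (b j) y = x ∨ m x (b j) y = b j) ∧ ∀ j, x ∈ medInt m o (b j)

open Classical in
/-- The trace on `M` of a set. -/
noncomputable def trc (M : Finset Ω) (h : Set Ω) : Finset Ω := M.filter (· ∈ h)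

open Classical in
/-- The nonempty traces on `M` of halves avoiding `o`. -/
noncomputable def walls (m : Ω → Ω → Ω → Ω) (M : Finset Ω) (o : Ω) : Finset (Finset Ω) :=
  M.powerset.filter fun χ => χ.Nonempty ∧ ∃ h, IsHalf m h ∧ o ∉ h ∧ χ = trc M h

theorem mem_trc {M : Finset Ω} {h : Set Ω} {a : Ω} : a ∈ trc M h ↔ a ∈ M ∧ a ∈ h := by
  simp [trc]

theorem mem_walls {M : Finset Ω} {o : Ω} {χ : Finset Ω} :
    χ ∈ walls m M o ↔ χ.Nonempty ∧ ∃ h, IsHalf m h ∧ o ∉ h ∧ χ = trc M h := by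
  simp only [walls, Finset.mem_filter, Finset.mem_powerset, and_iff_right_iff_imp]
  rintro ⟨-, h, -, -, rfl⟩
  exact fun a ha => (mem_trc.1 ha).1

theorem trc_mem_walls {M : Finset Ω} {o : Ω} {h : Set Ω} (hh : IsHalf m h) (ho : o ∉ h) {a : Ω}
    (ha : a ∈ M) (hah : a ∈ h) : trc M h ∈ walls m M o :=
  mem_walls.2 ⟨⟨a, mem_trc.2 ⟨ha, hah⟩⟩, h, hh, ho, rfl⟩

/-- A consistent choice of sides of the walls is realized by a point. -/
theorem exists_vertex (hm : IsMedianOp m) {M : Finset Ω}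
    (hM : ∀ x ∈ M, ∀ y ∈ M, ∀ z ∈ M, m x y z ∈ M) {o : Ω} (ho : o ∈ M) (Q : Finset (Finset Ω))
    (hQ : Q ⊆ walls m M o) (h1 : ∀ χ ∈ Q, ∀ χ' ∈ Q, ∃ a ∈ χ, a ∈ χ')
    (h2 : ∀ χ ∈ Q, ∀ χ' ∈ walls m M o, χ' ∉ Q → ∃ a ∈ χ, a ∉ χ') :
    ∃ a ∈ M, ∀ h, IsHalf m h → o ∉ h → (a ∈ h ↔ trc M h ∈ Q) := by
  classical
  have hW : ∀ χ ∈ walls m M o, ∃ h, IsHalf m h ∧ o ∉ h ∧ χ = trc M h := fun χ hχ =>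
    (mem_walls.1 hχ).2
  choose! H hH hoH hHχ using hW
  have hmem : ∀ χ ∈ walls m M o, ∀ a ∈ M, (a ∈ H χ ↔ a ∈ χ) := by
    intro χ hχ a ha
    conv_rhs => rw [hHχ χ hχ]
    simp [mem_trc, ha]
  have hsub : ∀ χ ∈ walls m M o, ∀ a ∈ χ, a ∈ M := by
    intro χ hχ a ha
    rw [hHχ χ hχ] at ha
    exact (mem_trc.1 ha).1
  obtain ⟨a, ha, h⟩ := hm.helly (M := (M : Set Ω)) (by simpa using hM) ⟨o, ho⟩ (walls m M o)
    (fun χ => if χ ∈ Q then H χ else (H χ)ᶜ) (by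
      intro χ hχ a _ b _ z _ ha hb
      by_cases h : χ ∈ Q
      · simp only [h, if_true] at ha hb ⊢
        exact (hH χ hχ _ _ _).2 (Or.inl ⟨ha, hb⟩)
      · simp only [h, if_false] at ha hb ⊢
        exact ((hH χ hχ).compl _ _ _).2 (Or.inl ⟨ha, hb⟩)) (by
      intro χ hχ χ' hχ'
      by_cases h : χ ∈ Q <;> by_cases h' : χ' ∈ Q
      · obtain ⟨a, ha, ha'⟩ := h1 χ h χ' h'
        have := hsub χ hχ a ha
        exact ⟨a, this, by simpa [h, hmem χ hχ a this], by simpa [h', hmem χ' hχ' a this]⟩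
      · obtain ⟨a, ha, ha'⟩ := h2 χ h χ' hχ' h'
        have := hsub χ hχ a ha
        exact ⟨a, this, by simpa [h, hmem χ hχ a this], by simpa [h', hmem χ' hχ' a this]⟩
      · obtain ⟨a, ha, ha'⟩ := h2 χ' h' χ hχ h
        have := hsub χ' hχ' a ha
        exact ⟨a, this, by simpa [h, hmem χ hχ a this], by simpa [h', hmem χ' hχ' a this]⟩
      · exact ⟨o, ho, by simpa [h] using hoH χ hχ, by simpa [h'] using hoH χ' hχ'⟩)
  refine ⟨a, ha, fun k hk hok => ?_⟩
  constructor
  · intro hak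
    have hw := trc_mem_walls hk hok ha hak
    have := h _ hw
    by_contra hq
    simp only [hq, if_false, mem_compl_iff] at this
    rw [hmem _ hw a ha, mem_trc] at this
    exact this ⟨ha, hak⟩
  · intro hq
    have hw := hQ hq
    have := h _ hw
    simp only [hq, if_true] at this
    rw [hmem _ hw a ha, mem_trc] at this
    exact this.2

/-- Pairwise transverse walls span a cube. -/
theorem exists_mcube (hm : IsMedianOp m) {M : Finset Ω}
    (hM : ∀ x ∈ M, ∀ y ∈ M, ∀ z ∈ M, m x y z ∈ M) {o : Ω} (ho : o ∈ M) (O R : Finset (Finset Ω))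
    (hO : O ⊆ walls m M o) (hR : R ⊆ walls m M o) (hOR : ∀ χ ∈ R, χ ∉ O)
    (h1 : ∀ χ ∈ walls m M o, ∀ χ' ∈ walls m M o, χ ∈ O ∨ χ ∈ R → χ' ∈ O ∨ χ' ∈ R →
      ∃ a ∈ χ, a ∈ χ')
    (h2 : ∀ χ ∈ walls m M o, ∀ χ' ∈ walls m M o, χ ∈ O ∨ χ ∈ R → χ' ∉ O → χ ≠ χ' →
      ∃ a ∈ χ, a ∉ χ')
    {ι : Type*} (c : ι → Finset Ω) (hcR : ∀ χ, χ ∈ R ↔ ∃ j, c j = χ) (hc : Function.Injective c) :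
    ∃ (x : Ω) (b : ι → Ω) (t : Ω), MCube m M o x b t ∧
      (∀ h, IsHalf m h → o ∉ h → (x ∈ h ↔ trc M h ∈ O)) ∧
      (∀ h, IsHalf m h → o ∉ h → (t ∈ h ↔ trc M h ∈ O ∨ trc M h ∈ R)) ∧
      (∀ h j, IsHalf m h → o ∉ h → (b j ∈ h ↔ trc M h ∈ O ∨ trc M h = c j)) := by
  classical
  have key : ∀ S ⊆ R, ∃ a ∈ M, ∀ h, IsHalf m h → o ∉ h → (a ∈ h ↔ trc M h ∈ O ∨ trc M h ∈ S) := by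
    intro S hS
    have hsub : ∀ χ, χ ∈ O ∪ S → χ ∈ O ∨ χ ∈ R := fun χ h => by
      rcases Finset.mem_union.1 h with h | h
      exacts [Or.inl h, Or.inr (hS h)]
    have hsubW : ∀ χ, χ ∈ O ∪ S → χ ∈ walls m M o := fun χ h => by
      rcases hsub χ h with h | h
      exacts [hO h, hR h]
    obtain ⟨a, ha, h⟩ := exists_vertex hm hM ho (O ∪ S) hsubW
      (fun χ h χ' h' => h1 χ (hsubW χ h) χ' (hsubW χ' h') (hsub χ h) (hsub χ' h'))
      (fun χ h χ' hw h' => h2 χ (hsubW χ h) χ' hw (hsub χ h)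
        (fun hh => h' (Finset.mem_union_left _ hh)) (fun e => h' (e ▸ h)))
    exact ⟨a, ha, fun k hk hok => by rw [h k hk hok, Finset.mem_union]⟩
  obtain ⟨x, hxM, hx⟩ := key ∅ (by simp)
  obtain ⟨t, htM, ht⟩ := key R subset_rfl
  have hcj : ∀ j, c j ∈ R := fun j => (hcR _).2 ⟨j, rfl⟩
  choose b hbM hb using fun j => key {c j} (by simpa using hcj j)
  simp only [Finset.notMem_empty, or_false, Finset.mem_singleton] at hx hb
  have hW : ∀ χ ∈ walls m M o, ∃ h, IsHalf m h ∧ o ∉ h ∧ χ = trc M h := fun χ hχ =>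
    (mem_walls.1 hχ).2
  refine ⟨x, b, t, ⟨hxM, hbM, htM, ⟨fun j e => ?_, fun h hh hxh => ?_⟩, fun j y hy => ?_,
    fun j => ?_⟩, hx, ht, fun h j => hb j h⟩
  · obtain ⟨h, hh, hoh, e'⟩ := hW _ (hR (hcj j))
    have a1 := hx h hh hoh
    have a2 := hb j h hh hoh
    rw [← e, a2, ← e'] at a1
    exact hOR _ (hcj j) (a1.1 (Or.inr rfl))
  · by_cases hoh : o ∈ h
    · have hoh' : o ∉ hᶜ := by simpa using hoh
      have a1 : trc M hᶜ ∈ O := (hx _ hh.compl hoh').1 hxh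
      have a2 : t ∉ h := (ht _ hh.compl hoh').2 (Or.inl a1)
      have a3 : ∀ j, b j ∉ h := fun j => (hb j _ hh.compl hoh').2 (Or.inl a1)
      simp [a2, a3]
    · rw [hx h hh hoh] at hxh
      simp only [ht h hh hoh, hb _ h hh hoh, hxh, false_or]
      exact ⟨(hcR _).trans ⟨fun ⟨j, hj⟩ => ⟨j, hj.symm⟩, fun ⟨j, hj⟩ => ⟨j, hj.symm⟩⟩,
        fun i j hi hj => hc (hi.symm.trans hj)⟩
  · have hsep : ∀ h, IsHalf m h → x ∉ h → b j ∈ h → (y ∈ h ↔ y ∈ c j) := by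
      intro h hh hxh hbh
      by_cases hoh : o ∈ h
      · have hoh' : o ∉ hᶜ := by simpa using hoh
        have a1 : trc M hᶜ ∈ O := (hx _ hh.compl hoh').1 hxh
        exact absurd hbh ((hb j _ hh.compl hoh').2 (Or.inl a1))
      · rw [hx h hh hoh] at hxh
        rw [hb j h hh hoh] at hbh
        rw [← hbh.resolve_left hxh, mem_trc]
        simp [hy]
    by_cases hyc : y ∈ c j
    · right
      refine hm.ext_half fun h hh hmem => ?_
      rw [hh] at hmem
      by_contra hbh
      have hxh : x ∈ h := by tauto
      have := (hsep _ hh.compl (by simpa using hxh) hbh).2 hyc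
      simp only [mem_compl_iff] at this
      tauto
    · left
      refine hm.ext_half fun h hh hmem => ?_
      rw [hh] at hmem
      by_contra hxh
      have hbh : b j ∈ h := by tauto
      have := (hsep _ hh hxh hbh).1
      tauto
  · rw [hm.mem_int_iff]
    intro h hh hoh hbh
    by_contra hxh
    have hoh' : o ∉ hᶜ := by simpa using hoh
    exact absurd hbh ((hb j _ hh.compl hoh').2 (Or.inl ((hx _ hh.compl hoh').1 hxh)))

end Walls

section Realization

variable {Ω : Type*} {m : Ω → Ω → Ω → Ω} {L : ℝ}

/-- A choice of Lipschitz paths. -/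
structure IsPathSystem [MetricSpace Ω] (E : Ω → Ω → ℝ → Ω) : Prop where
  zero : ∀ a b, E a b 0 = a
  one : ∀ a b, E a b 1 = b
  lip : ∀ a b, ∃ K : NNReal, LipschitzWith K (E a b)

theorem IsMedianOp.ext_half_off (hm : IsMedianOp m) (o : Ω) {x y : Ω}
    (h : ∀ k, IsHalf m k → o ∉ k → (x ∈ k ↔ y ∈ k)) : x = y := by
  refine hm.ext_half fun k hk hmem => ?_
  by_cases hok : o ∈ k
  · by_contra hyk
    exact ((h _ hk.compl (by simpa using hok)).2 hyk) hmem
  · exact (h k hk hok).1 hmem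

theorem mem_jn_iff_of_walls {M : Finset Ω} {o : Ω} (hm : IsMedianOp m)
    {O R : Finset (Finset Ω)} {ι : Type*} [Fintype ι] {c : ι → Finset Ω}
    (hOW : O ⊆ walls m M o) (hRW : R ⊆ walls m M o)
    (hcR : ∀ χ, χ ∈ R ↔ ∃ j, c j = χ)
    {x t : Ω} {b : ι → Ω} (hQ : Ortho m x b t)
    (hx : ∀ h, IsHalf m h → o ∉ h → (x ∈ h ↔ trc M h ∈ O))
    (hb : ∀ h j, IsHalf m h → o ∉ h → (b j ∈ h ↔ trc M h ∈ O ∨ trc M h = c j))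
    (e : Finset Ω → Ω)
    (heO : ∀ χ ∈ O, ∀ h, IsHalf m h → o ∉ h → χ = trc M h → e χ ∈ h)
    (heZ : ∀ χ ∈ walls m M o, χ ∉ O → χ ∉ R → ∀ h, IsHalf m h → o ∉ h → χ = trc M h → e χ ∉ h)
    {h : Set Ω} (hh : IsHalf m h) (hoh : o ∉ h) :
    jn m x t (fun j => m x (b j) (e (c j))) ∈ h ↔
      trc M h ∈ walls m M o ∧ e (trc M h) ∈ h := by
  have hcmem : ∀ j, m x (b j) (e (c j)) ∈ medInt m x (b j) := fun j => hm.med_mem _ _ _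
  by_cases hO' : trc M h ∈ O
  · rw [jn_mem_of_mem hQ hcmem hh ((hx h hh hoh).2 hO')]
    refine iff_of_true (fun j => ?_) ⟨hOW hO', heO _ hO' h hh hoh rfl⟩
    exact (hh _ _ _).2 (Or.inl ⟨(hx h hh hoh).2 hO', (hb h j hh hoh).2 (Or.inl hO')⟩)
  · have hxh : x ∉ h := fun hxh => hO' ((hx h hh hoh).1 hxh)
    rw [jn_mem hQ hcmem hh hxh]
    constructor
    · rintro ⟨j, hj⟩
      rw [hh] at hj
      have hbe : b j ∈ h ∧ e (c j) ∈ h := by tauto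
      have := ((hb h j hh hoh).1 hbe.1).resolve_left hO'
      rw [this]
      exact ⟨hRW ((hcR _).2 ⟨j, rfl⟩), hbe.2⟩
    · rintro ⟨hw, he⟩
      have hR' : trc M h ∈ R := by
        by_contra hR'
        exact heZ _ hw hO' hR' h hh hoh rfl he
      obtain ⟨j, hj⟩ := (hcR _).1 hR'
      refine ⟨j, (hh _ _ _).2 (Or.inr (Or.inl ⟨(hb h j hh hoh).2 (Or.inr hj.symm), ?_⟩))⟩
      rw [hj]
      exact he

/-- Realization of a continuous family of weights on a finite subalgebra by a continuous family of
points of the cubes of the subalgebra. -/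
theorem LipMed.exists_realization [MetricSpace Ω] (h : LipMed m L) {E : Ω → Ω → ℝ → Ω} (hE : IsPathSystem E)
    {X κ : Type*} [TopologicalSpace X] [Fintype κ] (v : κ → Ω) (lam : κ → X → ℝ)
    (hcont : ∀ k, Continuous (lam k)) (hnn : ∀ k s, 0 ≤ lam k s)
    (hsum : ∀ s, 1 / 2 ≤ ∑ k, lam k s) {M : Finset Ω}
    (hM : ∀ x ∈ M, ∀ y ∈ M, ∀ z ∈ M, m x y z ∈ M) (hv : ∀ k, v k ∈ M) {o : Ω} (ho : o ∈ M) :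
    ∃ g : X → Ω, Continuous g ∧
      (∀ s k, IsHalf m k → (∀ i, 0 < lam i s → v i ∈ k) → g s ∈ k) ∧
      ∀ s, ∃ (n : ℕ) (x : Ω) (b : Fin n → Ω) (t : Ω) (w : Fin n → Ω) (r : Fin n → unitInterval),
        MCube m M o x b t ∧ (∀ j, w j ∈ M) ∧
        g s = jn m x t (fun j => m x (b j) (E o (w j) (r j))) := by
  classical
  have hm := h.1
  set W := walls m M o with hWdef
  have hcard : (1 : ℝ) ≤ M.card := by
    exact_mod_cast Finset.card_pos.2 ⟨o, ho⟩
  set ε : ℝ := 1 / (4 * M.card) with hε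
  have hε0 : 0 < ε := by positivity
  have hεM : ε * M.card = 1 / 4 := by rw [hε]; field_simp
  let mass : Finset Ω → X → ℝ := fun χ s => ∑ k, (if v k ∈ χ then lam k s else 0) + ε * χ.card
  have hmassM : ∀ s, mass M s = ∑ k, lam k s + ε * M.card := fun s => by simp [mass, hv]
  have hmass_cont : ∀ χ, Continuous (mass χ) := by
    intro χ
    refine Continuous.add (continuous_finsetSum _ fun k _ => ?_) continuous_const
    split_ifs
    exacts [hcont k, continuous_const]
  have hmass_mono : ∀ χ χ' s, χ ⊂ χ' → mass χ s + ε ≤ mass χ' s := by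
    intro χ χ' s hlt
    have h1 : (χ.card : ℝ) + 1 ≤ χ'.card := by exact_mod_cast Finset.card_lt_card hlt
    have h2 : ∑ k, (if v k ∈ χ then lam k s else 0) ≤ ∑ k, (if v k ∈ χ' then lam k s else 0) := by
      refine Finset.sum_le_sum fun k _ => ?_
      by_cases hk : v k ∈ χ
      · simp [hk, hlt.1 hk]
      · simp only [hk, if_false]; split_ifs; exacts [hnn k s, le_rfl]
    have : ε * χ.card + ε ≤ ε * χ'.card := by nlinarith
    simp only [mass]; linarith
  have hmass_disj : ∀ χ χ' s, Disjoint χ χ' → mass χ s + mass χ' s = mass (χ ∪ χ') s := by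
    intro χ χ' s hd
    simp only [mass, Finset.card_union_of_disjoint hd]
    push_cast
    have : ∀ k, (if v k ∈ χ ∪ χ' then lam k s else 0) =
        (if v k ∈ χ then lam k s else 0) + (if v k ∈ χ' then lam k s else 0) := by
      intro k
      have : v k ∈ χ → v k ∉ χ' := fun h1 => Finset.disjoint_left.1 hd h1
      by_cases h1 : v k ∈ χ
      · simp [h1, this h1]
      · simp [h1]
    simp only [this, Finset.sum_add_distrib]
    ring
  have hWsub : ∀ χ ∈ W, χ ⊆ M ∧ o ∉ χ := by
    intro χ hχ
    obtain ⟨-, k, -, hok, rfl⟩ := mem_walls.1 hχ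
    exact ⟨fun a ha => (mem_trc.1 ha).1, fun ha => hok (mem_trc.1 ha).2⟩
  let raw : Finset Ω → X → ℝ := fun χ s => (mass χ s - mass M s / 2) / ε + 1 / 2
  let xx : Finset Ω → X → unitInterval := fun χ s => Set.projIcc 0 1 zero_le_one (raw χ s)
  have hxx_cont : ∀ χ, Continuous (xx χ) := fun χ => by
    refine continuous_projIcc.comp ?_
    exact (((hmass_cont χ).sub ((hmass_cont M).div_const 2)).div_const ε).add continuous_const
  have hxx0 : ∀ χ s, xx χ s = 0 ↔ mass χ s + ε / 2 ≤ mass M s / 2 := by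
    intro χ s
    have : xx χ s = 0 ↔ raw χ s ≤ 0 := Set.projIcc_eq_left zero_lt_one
    rw [this]
    have : raw χ s = (mass χ s + ε / 2 - mass M s / 2) / ε := by simp only [raw]; field_simp; ring
    rw [this, div_nonpos_iff]
    constructor
    · rintro (⟨-, h2⟩ | ⟨h1, -⟩) <;> linarith
    · intro h1; right; exact ⟨by linarith, hε0.le⟩
  have hxx1 : ∀ χ s, xx χ s = 1 ↔ mass M s / 2 + ε / 2 ≤ mass χ s := by
    intro χ s
    have : xx χ s = 1 ↔ 1 ≤ raw χ s := Set.projIcc_eq_right zero_lt_one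
    rw [this]
    have : raw χ s - 1 = (mass χ s - ε / 2 - mass M s / 2) / ε := by
      simp only [raw]; field_simp; ring
    rw [← sub_nonneg, this, le_div_iff₀ hε0]
    constructor <;> intro h1 <;> linarith
  -- the fractional and full walls of a point
  let RR : X → Finset (Finset Ω) := fun s => W.filter fun χ => xx χ s ≠ 0 ∧ xx χ s ≠ 1
  let OO : X → Finset (Finset Ω) := fun s => W.filter fun χ => xx χ s = 1
  have hw : ∀ χ ∈ W, ∃ a, a ∈ χ := fun χ hχ => (mem_walls.1 hχ).1
  have : Nonempty Ω := ⟨o⟩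
  choose! wt hwt using hw
  let e : X → Finset Ω → Ω := fun s χ => E o (wt χ) (xx χ s)
  have hcube : ∀ s0, ∃ (x : Ω) (b : Fin (RR s0).card → Ω) (t : Ω), MCube m M o x b t ∧
      ∀ s, (∀ χ ∈ OO s0, xx χ s = 1) → (∀ χ ∈ W, χ ∉ OO s0 → χ ∉ RR s0 → xx χ s = 0) →
        ∀ h, IsHalf m h → o ∉ h →
        (jn m x t (fun j => m x (b j) (e s ((RR s0).equivFin.symm j).1)) ∈ h ↔
          trc M h ∈ W ∧ e s (trc M h) ∈ h) := by
    intro s0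
    have hpos : ∀ χ, χ ∈ OO s0 ∨ χ ∈ RR s0 → mass M s0 / 2 - ε / 2 < mass χ s0 := by
      intro χ hχ
      have : xx χ s0 ≠ 0 := by
        rcases hχ with hχ | hχ
        · rw [(Finset.mem_filter.1 hχ).2]; exact one_ne_zero
        · exact (Finset.mem_filter.1 hχ).2.1
      rw [Ne, hxx0] at this
      linarith
    have hOR : ∀ χ ∈ RR s0, χ ∉ OO s0 := fun χ h1 h2 =>
      (Finset.mem_filter.1 h1).2.2 (Finset.mem_filter.1 h2).2
    have hcR : ∀ χ, χ ∈ RR s0 ↔ ∃ j, ((RR s0).equivFin.symm j).1 = χ := by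
      intro χ
      constructor
      · intro hχ
        exact ⟨(RR s0).equivFin ⟨χ, hχ⟩, by simp⟩
      · rintro ⟨j, rfl⟩
        exact ((RR s0).equivFin.symm j).2
    have hinj : Function.Injective fun j => ((RR s0).equivFin.symm j).1 :=
      Subtype.val_injective.comp (RR s0).equivFin.symm.injective
    obtain ⟨x, b, t, hQ, hx, ht, hb⟩ := exists_mcube hm hM ho (OO s0) (RR s0)
      (Finset.filter_subset _ _) (Finset.filter_subset _ _) hOR (by
        intro χ hχ χ' hχ' h1 h2
        by_contra hcon
        push Not at hcon
        have hd : Disjoint χ χ' := Finset.disjoint_left.2 hcon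
        have h3 := hmass_disj χ χ' s0 hd
        have h4 : χ ∪ χ' ⊂ M := by
          refine Finset.ssubset_iff_subset_ne.2
            ⟨Finset.union_subset (hWsub χ hχ).1 (hWsub χ' hχ').1, fun e => ?_⟩
          have : o ∈ χ ∪ χ' := e ▸ ho
          rcases Finset.mem_union.1 this with h5 | h5
          exacts [(hWsub χ hχ).2 h5, (hWsub χ' hχ').2 h5]
        have h5 := hmass_mono _ _ s0 h4
        have := hpos χ h1
        have := hpos χ' h2
        linarith) (by
        intro χ hχ χ' hχ' h1 h2 hne
        by_contra hcon
        push Not at hcon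
        have h3 := hmass_mono χ χ' s0 (Finset.ssubset_iff_subset_ne.2 ⟨hcon, hne⟩)
        refine h2 (Finset.mem_filter.2 ⟨hχ', (hxx1 _ _).2 ?_⟩)
        have := hpos χ h1
        linarith) _ hcR hinj
    refine ⟨x, b, t, hQ, fun s hs1 hs0 k hk hok => ?_⟩
    refine mem_jn_iff_of_walls hm (Finset.filter_subset _ _) (Finset.filter_subset _ _) hcR
        hQ.2.2.2.1 hx hb (e s) ?_ ?_ hk hok
    · intro χ hχ k _ _ hk
      have h1 := hwt χ (Finset.mem_filter.1 hχ).1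
      simp only [e, hs1 χ hχ]
      rw [Set.Icc.coe_one, hE.one]
      rw [hk] at h1
      rw [hk]
      exact (mem_trc.1 h1).2
    · intro χ hχ h1 h2 k _ hok _
      simp only [e, hs0 χ hχ h1 h2]
      rw [Set.Icc.coe_zero, hE.zero]
      exact hok
  have hO1 : ∀ s, ∀ χ ∈ OO s, xx χ s = 1 := fun s χ hχ => (Finset.mem_filter.1 hχ).2
  have hO0 : ∀ s, ∀ χ ∈ W, χ ∉ OO s → χ ∉ RR s → xx χ s = 0 := by
    intro s χ hχ h1 h2
    by_contra h3
    exact h2 (Finset.mem_filter.2 ⟨hχ, h3, fun h4 => h1 (Finset.mem_filter.2 ⟨hχ, h4⟩)⟩)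
  choose x b t hQ hjn using hcube
  let g : X → Ω := fun s =>
    jn m (x s) (t s) (fun j => m (x s) (b s j) (e s ((RR s).equivFin.symm j).1))
  have hg : ∀ s h, IsHalf m h → o ∉ h → (g s ∈ h ↔ trc M h ∈ W ∧ e s (trc M h) ∈ h) :=
    fun s => hjn s s (hO1 s) (hO0 s)
  refine ⟨g, ?_, ?_, fun s => ⟨_, x s, b s, t s, fun j => wt ((RR s).equivFin.symm j).1,
    fun j => xx ((RR s).equivFin.symm j).1 s, hQ s, fun j => ?_, rfl⟩⟩
  · -- continuity on each member of a finite closed cover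
    let S : Finset (Finset Ω) × Finset (Finset Ω) → Set X := fun q =>
      {s | (∃ s0, q = (OO s0, RR s0)) ∧ (∀ χ ∈ q.1, xx χ s = 1) ∧
        ∀ χ ∈ W, χ ∉ q.1 → χ ∉ q.2 → xx χ s = 0}
    let I := {q : Finset (Finset Ω) × Finset (Finset Ω) // q ∈ W.powerset ×ˢ W.powerset}
    have hfin : LocallyFinite fun i : I => S i.1 := locallyFinite_of_finite _
    refine hfin.continuous ?_ ?_ ?_
    · refine Set.eq_univ_of_forall fun s => Set.mem_iUnion.2 ⟨⟨(OO s, RR s), ?_⟩,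
        ⟨s, rfl⟩, hO1 s, hO0 s⟩
      rw [Finset.mem_product]
      exact ⟨Finset.mem_powerset.2 (Finset.filter_subset _ _),
        Finset.mem_powerset.2 (Finset.filter_subset _ _)⟩
    · rintro ⟨q, hq⟩
      by_cases hs : ∃ s0, q = (OO s0, RR s0)
      · have : S q = (⋂ χ ∈ q.1, {s | xx χ s = 1}) ∩
            ⋂ χ ∈ W, ⋂ (_ : χ ∉ q.1), ⋂ (_ : χ ∉ q.2), {s | xx χ s = 0} := by
          ext s
          simp only [S, hs, true_and, Set.mem_inter_iff, Set.mem_iInter, Set.mem_ofPred_eq]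
        change IsClosed (S q)
        rw [this]
        refine IsClosed.inter ?_ ?_
        · exact isClosed_biInter fun χ _ => isClosed_eq (hxx_cont χ) continuous_const
        · exact isClosed_biInter fun χ _ => isClosed_iInter fun _ => isClosed_iInter fun _ =>
            isClosed_eq (hxx_cont χ) continuous_const
      · have : S q = ∅ := by
          ext s
          simp only [S, hs, false_and, Set.mem_ofPred_eq, Set.mem_empty_iff_false]
        change IsClosed (S q)
        rw [this]
        exact isClosed_empty
    · rintro ⟨q, hq⟩
      by_cases hs : ∃ s0, q = (OO s0, RR s0)
      · obtain ⟨s0, rfl⟩ := hs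
        have hc : Continuous fun s =>
            jn m (x s0) (t s0) (fun j => m (x s0) (b s0 j) (e s ((RR s0).equivFin.symm j).1)) := by
          refine (h.continuous_jn _ _).comp (continuous_pi fun j => ?_)
          refine h.continuous continuous_const continuous_const ?_
          obtain ⟨K, hK⟩ := hE.lip o (wt ((RR s0).equivFin.symm j).1)
          exact hK.continuous.comp (continuous_subtype_val.comp (hxx_cont _))
        refine hc.continuousOn.congr fun s hs => ?_
        refine hm.ext_half_off o fun k hk hok => ?_
        rw [hg s k hk hok, hjn s0 s hs.2.1 hs.2.2 k hk hok]
      · intro s hs'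
        exact absurd hs'.1 hs
  · intro s k hk hkv
    have hε2 : mass M s / 2 ≥ 1 / 4 + 1 / 8 := by
      rw [hmassM, hεM]; linarith [hsum s]
    by_cases hok : o ∈ k
    · by_contra hgk
      have hk' : o ∉ kᶜ := by simpa using hok
      obtain ⟨hW1, he⟩ := (hg s _ hk.compl hk').1 hgk
      have : xx (trc M kᶜ) s = 0 := by
        rw [hxx0]
        have h1 : ∑ i, (if v i ∈ trc M kᶜ then lam i s else 0) = 0 := by
          refine Finset.sum_eq_zero fun i _ => ?_
          split_ifs with hi
          · by_contra hne
            exact (mem_trc.1 hi).2 (hkv i (lt_of_le_of_ne (hnn i s) (Ne.symm hne)))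
          · rfl
        have h2 : ((trc M kᶜ).card : ℝ) + 1 ≤ M.card := by
          exact_mod_cast Finset.card_lt_card
            (Finset.ssubset_iff_subset_ne.2 ⟨(hWsub _ hW1).1, fun e => (hWsub _ hW1).2 (e.symm.subset ho)⟩)
        have h3 : ε * (trc M kᶜ).card + ε ≤ 1 / 4 := by nlinarith
        simp only [mass, h1] at hε2 ⊢
        linarith
      rw [show e s (trc M kᶜ) = o by simp only [e, this]; rw [Set.Icc.coe_zero, hE.zero]] at he
      exact hk' he
    · have hmassk : mass (trc M k) s = ∑ i, lam i s + ε * (trc M k).card := by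
        simp only [mass]
        congr 1
        refine Finset.sum_congr rfl fun i _ => ?_
        split_ifs with hi
        · rfl
        · rcases (hnn i s).eq_or_lt with h0 | h0
          · exact h0
          · exact absurd (mem_trc.2 ⟨hv i, hkv i h0⟩) hi
      have hne : ∃ i, 0 < lam i s := by
        by_contra hcon
        push Not at hcon
        have := Finset.sum_nonpos (s := Finset.univ) fun i _ => hcon i
        linarith [hsum s]
      obtain ⟨i, hi⟩ := hne
      have hW1 : trc M k ∈ W := trc_mem_walls hk hok (hv i) (hkv i hi)
      refine (hg s k hk hok).2 ⟨hW1, ?_⟩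
      have hcd : (1 : ℝ) ≤ (trc M k).card := by
        exact_mod_cast Finset.card_pos.2 ⟨_, hwt _ hW1⟩
      have : xx (trc M k) s = 1 := by
        rw [hxx1, hmassk, hmassM, hεM]
        have : ε ≤ ε * (trc M k).card := by nlinarith
        linarith [hsum s]
      simp only [e, this]
      rw [Set.Icc.coe_one, hE.one]
      exact (mem_trc.1 (hwt _ hW1)).2
  · have := hwt _ (Finset.mem_filter.1 ((RR s).equivFin.symm j).2).1
    exact (hWsub _ (Finset.mem_filter.1 ((RR s).equivFin.symm j).2).1).1 this

end Realization

section Grid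

variable {Ω : Type*} [MetricSpace Ω] {m : Ω → Ω → Ω → Ω} {L : ℝ}

/-- The points of the cube with corner `x` and edges to `b j` whose coordinates run along the paths
from `o` to `w j`. -/
noncomputable def slabMap {n : ℕ} (m : Ω → Ω → Ω → Ω) (E : Ω → Ω → ℝ → Ω) (o x : Ω) (b : Fin n → Ω) (t : Ω)
    (w : Fin n → Ω) (r : Fin n → unitInterval) : Ω :=
  jn m x t (fun j => m x (b j) (E o (w j) (r j)))

/-- Continuous maps from a cube are approximated by maps into the cubes of large finite
subalgebras. -/
theorem LipMed.exists_approx (h : LipMed m L) {E : Ω → Ω → ℝ → Ω} (hE : IsPathSystem E) {n : ℕ}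
    (Ψ : (Fin n → unitInterval) → Ω) (hΨ : Continuous Ψ) {η : ℝ} (hη : 0 < η) :
    ∃ A : Finset Ω, ∀ M : Finset Ω, (∀ x ∈ M, ∀ y ∈ M, ∀ z ∈ M, m x y z ∈ M) → A ⊆ M →
      ∀ o ∈ M, ∃ g : (Fin n → unitInterval) → Ω, Continuous g ∧ (∀ s, dist (g s) (Ψ s) ≤ η) ∧
        ∀ s, ∃ (k : ℕ) (x : Ω) (b : Fin k → Ω) (t : Ω) (w : Fin k → Ω) (r : Fin k → unitInterval),
          MCube m M o x b t ∧ (∀ j, w j ∈ M) ∧ g s = slabMap m E o x b t w r := by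
  classical
  have huc := CompactSpace.uniformContinuous_of_continuous hΨ
  rw [Metric.uniformContinuous_iff] at huc
  set C : ℝ := (2 * L) ^ Fintype.card (Fin n → Bool) with hC
  have hC0 : 0 < C := pow_pos (by linarith [h.pos]) _
  obtain ⟨δ, hδ, hδ'⟩ := huc (η / C) (div_pos hη hC0)
  obtain ⟨N, hN⟩ := exists_nat_gt (1 / δ)
  have hN0 : (0 : ℝ) < N := lt_trans (by positivity) hN
  have hNδ : 1 / (N : ℝ) < δ := by
    rw [div_lt_iff₀ hN0]; rw [div_lt_iff₀ hδ] at hN; linarith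
  let pt : (Fin n → ℕ) → Fin n → unitInterval := fun k i =>
    Set.projIcc 0 1 zero_le_one ((k i : ℝ) / N)
  let v : (Fin n → Fin (N + 1)) → Ω := fun k => Ψ (pt fun i => k i)
  let lam : (Fin n → Fin (N + 1)) → (Fin n → unitInterval) → ℝ := fun k s =>
    max 0 (1 - dist (fun i => (N : ℝ) * (s i : ℝ)) (fun i => ((k i : ℕ) : ℝ)))
  refine ⟨Finset.univ.image v, fun M hM hAM o ho => ?_⟩
  have hsum : ∀ s, 1 / 2 ≤ ∑ k, lam k s := by
    intro s
    have hs0 : ∀ i, 0 ≤ (N : ℝ) * (s i : ℝ) := fun i => mul_nonneg hN0.le (s i).2.1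
    have hs1 : ∀ i, (N : ℝ) * (s i : ℝ) ≤ N := fun i =>
      mul_le_of_le_one_right hN0.le (s i).2.2
    let k : Fin n → Fin (N + 1) := fun i => ⟨⌊(N : ℝ) * (s i : ℝ) + 1 / 2⌋₊, by
      rw [Nat.floor_lt (by linarith [hs0 i])]
      push_cast
      linarith [hs1 i]⟩
    refine le_trans ?_ (Finset.single_le_sum (f := fun k => lam k s)
      (fun k _ => le_max_left _ _) (Finset.mem_univ k))
    refine le_trans ?_ (le_max_right _ _)
    have : dist (fun i => (N : ℝ) * (s i : ℝ)) (fun i => ((k i : ℕ) : ℝ)) ≤ 1 / 2 := by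
      refine (dist_pi_le_iff (by norm_num)).2 fun i => ?_
      rw [Real.dist_eq, abs_le]
      have h1 := Nat.floor_le (show 0 ≤ (N : ℝ) * (s i : ℝ) + 1 / 2 by linarith [hs0 i])
      have h2 := Nat.lt_floor_add_one ((N : ℝ) * (s i : ℝ) + 1 / 2)
      simp only [k]
      constructor <;> linarith
    linarith
  obtain ⟨g, hg, hhull, hslab⟩ := h.exists_realization hE v lam (fun k => by
      refine continuous_const.max (continuous_const.sub (Continuous.dist ?_ continuous_const))
      fun_prop) (fun k s => le_max_left _ _) hsum hM
    (fun k => hAM (Finset.mem_image_of_mem _ (Finset.mem_univ k))) ho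
  refine ⟨g, hg, fun s => ?_, hslab⟩
  have hs0 : ∀ i, 0 ≤ (N : ℝ) * (s i : ℝ) := fun i => mul_nonneg hN0.le (s i).2.1
  let near : (Fin n → Bool) → Fin n → unitInterval := fun β =>
    pt fun i => ⌊(N : ℝ) * (s i : ℝ)⌋₊ + (β i).toNat
  have hnear : ∀ β, dist (near β) s < δ := by
    intro β
    refine lt_of_le_of_lt ((dist_pi_le_iff (by positivity)).2 fun i => ?_) hNδ
    have h0 : s i = Set.projIcc 0 1 zero_le_one (s i : ℝ) := (Set.projIcc_val _ _).symm
    rw [h0]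
    refine (((LipschitzWith.projIcc zero_le_one).dist_le_mul _ _)).trans ?_
    have h1 := Nat.floor_le (hs0 i)
    have h2 := Nat.lt_floor_add_one ((N : ℝ) * (s i : ℝ))
    rw [NNReal.coe_one, one_mul, Real.dist_eq]
    have h3 : ((⌊(N : ℝ) * (s i : ℝ)⌋₊ + (β i).toNat : ℕ) : ℝ) / N - s i =
        (((⌊(N : ℝ) * (s i : ℝ)⌋₊ + (β i).toNat : ℕ) : ℝ) - N * s i) / N := by field_simp
    rw [h3, abs_div, abs_of_pos hN0]
    refine div_le_div_of_nonneg_right ?_ hN0.le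
    rw [abs_le]
    cases β i <;> push_cast <;> simp only [Bool.toNat_false, Bool.toNat_true] <;> push_cast <;>
      constructor <;> linarith
  have hd := h.dist_hull_le (fun β => Ψ (near β)) (Ψ s) (g s) (η / C)
    (fun β => (hδ' (hnear β)).le) (fun k hk hall => hhull s k hk fun j hj => ?_)
  · rwa [← hC, mul_div_cancel₀ _ hC0.ne'] at hd
  · have h1 : dist (fun i => (N : ℝ) * (s i : ℝ)) (fun i => ((j i : ℕ) : ℝ)) < 1 := by
      by_contra hcon
      push Not at hcon
      simp only [lam] at hj
      rw [max_eq_left (by linarith)] at hj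
      exact lt_irrefl _ hj
    have h2 : ∀ i, ∃ β : Bool, (j i : ℕ) = ⌊(N : ℝ) * (s i : ℝ)⌋₊ + β.toNat := by
      intro i
      have h3 := lt_of_le_of_lt (dist_le_pi_dist _ _ i) h1
      rw [Real.dist_eq, abs_lt] at h3
      have h4 := Nat.floor_le (hs0 i)
      have h5 := Nat.lt_floor_add_one ((N : ℝ) * (s i : ℝ))
      have h6 : ⌊(N : ℝ) * (s i : ℝ)⌋₊ < (j i : ℕ) + 1 := by
        have : ((⌊(N : ℝ) * (s i : ℝ)⌋₊ : ℕ) : ℝ) < ((j i : ℕ) : ℝ) + 1 := by linarith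
        exact_mod_cast this
      have h7 : (j i : ℕ) < ⌊(N : ℝ) * (s i : ℝ)⌋₊ + 2 := by
        have : ((j i : ℕ) : ℝ) < ((⌊(N : ℝ) * (s i : ℝ)⌋₊ : ℕ) : ℝ) + 2 := by linarith
        exact_mod_cast this
      rcases Nat.lt_or_ge (⌊(N : ℝ) * (s i : ℝ)⌋₊) (j i : ℕ) with h8 | h8
      · exact ⟨true, by simp only [Bool.toNat_true]; omega⟩
      · exact ⟨false, by simp only [Bool.toNat_false]; omega⟩
    choose β hβ using h2
    have h3 : v j = Ψ (near β) := by
      simp only [v, near]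
      congr 1
      simp only [pt, hβ]
    rw [h3]
    exact hall β

/-- Lipschitz parametrization of slabs. -/
theorem LipMed.exists_slabMap_lipschitz (h : LipMed m L) {E : Ω → Ω → ℝ → Ω}
    (hE : IsPathSystem E) {n : ℕ} (o x : Ω) (b : Fin n → Ω) (t : Ω) (w : Fin n → Ω) :
    ∃ K : NNReal, LipschitzWith K (slabMap m E o x b t w) := by
  obtain ⟨K, hK⟩ := h.exists_jn_lipschitz (ι := Fin n) x t
  have h1 : ∀ j, ∃ K' : NNReal, LipschitzWith K'
      fun r : Fin n → unitInterval => m x (b j) (E o (w j) (r j)) := by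
    intro j
    obtain ⟨K', hK'⟩ := hE.lip o (w j)
    have h2 : LipschitzWith (Real.toNNReal L) fun y => m x (b j) y := by
      refine LipschitzWith.of_dist_le_mul fun y y' => ?_
      rw [Real.coe_toNNReal _ h.pos.le]
      have := h.dist_le x (b j) y x (b j) y'
      simpa using this
    exact ⟨_, h2.comp (hK'.comp (LipschitzWith.subtype_val _ |>.comp (LipschitzWith.eval j)))⟩
  choose K' hK' using h1
  refine ⟨K * (∑ j, K' j), hK.comp ?_⟩
  refine LipschitzWith.of_dist_le_mul fun r r' => (dist_pi_le_iff (by positivity)).2 fun j => ?_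
  refine ((hK' j).dist_le_mul r r').trans ?_
  gcongr
  exact_mod_cast Finset.single_le_sum (f := K') (fun _ _ => zero_le) (Finset.mem_univ j)

/-- Points of the slabs of dimension less than `d`. -/
def thinSlabs (m : Ω → Ω → Ω → Ω) (E : Ω → Ω → ℝ → Ω) (M : Finset Ω) (o : Ω) (d : ℕ) : Set Ω :=
  ⋃ q : (Σ k : Fin d, M × (Fin k → M) × M × (Fin k → M)),
    range (slabMap m E o q.2.1 (fun j => q.2.2.1 j) q.2.2.2.1 (fun j => q.2.2.2.2 j))

theorem dimH_range_unitCube_le {k : ℕ} {Y : Type*} [MetricSpace Y]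
    {f : (Fin k → unitInterval) → Y} {K : NNReal} (hf : LipschitzWith K f) :
    dimH (range f) ≤ k := by
  refine hf.dimH_range_le.trans ?_
  have hiso : Isometry fun (r : Fin k → unitInterval) (j : Fin k) => (r j : ℝ) :=
    Isometry.of_dist_eq fun r r' => by simp [dist_pi_def, Subtype.dist_eq, nndist]
  rw [← hiso.dimH_image]
  refine (dimH_mono (subset_univ _)).trans ?_
  rw [Real.dimH_univ_pi_fin]

/-- Lipschitz images in `ℝ ^ d` of countably many cubes of dimension less than `d` have dense
complement. -/
theorem dense_compl_image_iUnion_range {d : ℕ} (hd : 1 ≤ d) {ι : Type*} [Countable ι] {k : ι → ℕ}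
    (hk : ∀ q, k q < d) {f : ∀ q, (Fin (k q) → unitInterval) → Ω}
    (hf : ∀ q, ∃ K : NNReal, LipschitzWith K (f q)) {F : Ω → Fin d → ℝ} {K : NNReal}
    (hF : LipschitzWith K F) : Dense (F '' ⋃ q, range (f q))ᶜ := by
  refine dense_compl_of_dimH_lt_finrank ?_
  refine lt_of_le_of_lt (hF.dimH_image_le _) ?_
  rw [dimH_iUnion, Module.finrank_fin_fun]
  have : (⨆ q, dimH (range (f q))) ≤ ((d - 1 : ℕ) : ENNReal) := by
    refine iSup_le fun q => ?_
    obtain ⟨K', hK'⟩ := hf q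
    refine (dimH_range_unitCube_le hK').trans ?_
    have := hk q
    exact_mod_cast (by omega : k q ≤ d - 1)
  refine lt_of_le_of_lt this ?_
  exact_mod_cast (by omega : d - 1 < d)

theorem LipMed.dense_compl_image_thinSlabs (h : LipMed m L) {E : Ω → Ω → ℝ → Ω}
    (hE : IsPathSystem E) (M : Finset Ω) (o : Ω) {d : ℕ} (hd : 1 ≤ d) {F : Ω → Fin d → ℝ}
    {K : NNReal} (hF : LipschitzWith K F) : Dense (F '' thinSlabs m E M o d)ᶜ :=
  dense_compl_image_iUnion_range hd (fun q => q.1.2)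
    (fun _ => h.exists_slabMap_lipschitz hE _ _ _ _ _) hF

end Grid

section Tree

variable {T : Type*} [MetricSpace T]

/-- The metric segment between two points. -/
def Seg (x y : T) : Set T := {z | dist x z + dist z y = dist x y}

theorem mem_Seg {x y z : T} : z ∈ Seg x y ↔ dist x z + dist z y = dist x y := Iff.rfl

theorem Seg_symm {x y z : T} (h : z ∈ Seg x y) : z ∈ Seg y x := by
  rw [mem_Seg] at *
  rw [dist_comm y z, dist_comm z x, dist_comm y x]
  linarith

theorem left_mem_Seg (x y : T) : x ∈ Seg x y := by simp [mem_Seg]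

theorem right_mem_Seg (x y : T) : y ∈ Seg x y := by simp [mem_Seg]

theorem Seg_self {x y : T} (h : y ∈ Seg x x) : y = x := by
  rw [mem_Seg, dist_self, dist_comm y x] at h
  exact (dist_eq_zero.1 (by linarith [dist_nonneg (x := x) (y := y)])).symm

theorem Seg_trans {x y z w : T} (h1 : z ∈ Seg x y) (h2 : w ∈ Seg x z) : w ∈ Seg x y := by
  rw [mem_Seg] at *
  have := dist_triangle w z y
  have := dist_triangle x w y
  linarith

theorem Seg_shift {x y z w : T} (h1 : z ∈ Seg x y) (h2 : w ∈ Seg x z) : z ∈ Seg w y := by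
  rw [mem_Seg] at *
  have := dist_triangle w z y
  have := dist_triangle x w y
  linarith

theorem isClosed_Seg (x y : T) : IsClosed (Seg x y) :=
  isClosed_eq ((continuous_const.dist continuous_id).add (continuous_id.dist continuous_const))
    continuous_const

namespace IsRTree

variable (hT : IsRTree T)

include hT

theorem four_point (x y z w : T) :
    dist x z + dist y w ≤ max (dist x y + dist z w) (dist y z + dist x w) := by
  have h := hT.2 w x y z
  simp only [gromovProd, add_zero] at h
  rw [dist_comm w x, dist_comm w y, dist_comm w z] at h
  rcases min_le_iff.1 h with h | h
  · exact le_max_of_le_left (by linarith)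
  · exact le_max_of_le_right (by linarith)

/-- Two points on a segment are at the distance given by their parameters. -/
theorem dist_of_mem_Seg {x y c c' : T} (h : c ∈ Seg x y) (h' : c' ∈ Seg x y) :
    dist c c' = |dist x c - dist x c'| := by
  rw [mem_Seg] at h h'
  refine le_antisymm ?_ (by rw [dist_comm x c, dist_comm x c']; exact abs_dist_sub_le c c' x)
  have := hT.four_point c x c' y
  rw [dist_comm c x] at this
  rcases le_max_iff.1 this with h1 | h1
  · refine le_trans ?_ (le_abs_self _); linarith
  · refine le_trans ?_ (neg_le_abs _); linarith

theorem eq_of_mem_Seg {x y c c' : T} (h : c ∈ Seg x y) (h' : c' ∈ Seg x y)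
    (hd : dist x c = dist x c') : c = c' := by
  rw [← dist_eq_zero, hT.dist_of_mem_Seg h h', hd, sub_self, abs_zero]

theorem mem_Seg_of_le {x y c c' : T} (h : c ∈ Seg x y) (h' : c' ∈ Seg x y)
    (hd : dist x c ≤ dist x c') : c ∈ Seg x c' := by
  rw [mem_Seg, hT.dist_of_mem_Seg h h', abs_of_nonpos (by linarith)]
  ring

theorem exists_mem_Seg (x y : T) {r : ℝ} (h0 : 0 ≤ r) (h1 : r ≤ dist x y) :
    ∃ c ∈ Seg x y, dist x c = r := by
  obtain ⟨γ, g0, g1, hγ⟩ := hT.1 x y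
  have hd := dist_nonneg (x := x) (y := y)
  refine ⟨γ r, ?_, ?_⟩
  · rw [mem_Seg]
    have h2 := hγ 0 ⟨le_rfl, hd⟩ r ⟨h0, h1⟩
    have h3 := hγ r ⟨h0, h1⟩ (dist x y) ⟨hd, le_rfl⟩
    rw [g0, abs_of_nonpos (by linarith)] at h2
    rw [g1, abs_of_nonpos (by linarith)] at h3
    linarith
  · have h2 := hγ 0 ⟨le_rfl, hd⟩ r ⟨h0, h1⟩
    rw [g0, abs_of_nonpos (by linarith)] at h2
    linarith

theorem exists_median (x y z : T) : ∃ c, c ∈ Seg x y ∧ c ∈ Seg y z ∧ c ∈ Seg x z := by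
  have a1 := dist_triangle x y z
  have a2 := dist_triangle y x z
  have a3 := dist_triangle x z y
  rw [dist_comm y x] at a2
  rw [dist_comm z y] at a3
  obtain ⟨c, hc, hd⟩ := hT.exists_mem_Seg x y (r := (dist x y + dist x z - dist y z) / 2)
    (by linarith) (by linarith)
  have h4 := hT.four_point c x z y
  have b1 := dist_triangle x c z
  have b2 := dist_triangle y c z
  rw [mem_Seg] at hc
  rw [dist_comm c x, dist_comm z y] at h4
  rw [dist_comm y c] at b2
  have hcz : dist c z = (dist x z + dist y z - dist x y) / 2 := by
    refine le_antisymm ?_ (by linarith)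
    rcases le_max_iff.1 h4 with h | h <;> linarith
  refine ⟨c, hc, ?_, ?_⟩ <;> rw [mem_Seg]
  · rw [dist_comm y c]; linarith
  · linarith

end IsRTree

open Classical in
/-- The median of three points of an `ℝ`-tree. -/
noncomputable def tmed (x y z : T) : T :=
  if h : ∃ c, c ∈ Seg x y ∧ c ∈ Seg y z ∧ c ∈ Seg x z then h.choose else x

namespace IsRTree

variable (hT : IsRTree T)

include hT

theorem tmed_spec (x y z : T) :
    tmed x y z ∈ Seg x y ∧ tmed x y z ∈ Seg y z ∧ tmed x y z ∈ Seg x z := by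
  rw [tmed, dif_pos (hT.exists_median x y z)]
  exact (hT.exists_median x y z).choose_spec

theorem dist_tmed (x y z : T) : dist y (tmed x y z) = (dist x y + dist y z - dist x z) / 2 := by
  obtain ⟨h1, h2, h3⟩ := hT.tmed_spec x y z
  rw [mem_Seg] at *
  rw [dist_comm _ y] at h1
  linarith

theorem eq_tmed {x y z c : T} (h1 : c ∈ Seg x y) (h2 : c ∈ Seg y z) (h3 : c ∈ Seg x z) :
    c = tmed x y z := by
  refine hT.eq_of_mem_Seg h2 (hT.tmed_spec x y z).2.1 ?_
  rw [hT.dist_tmed]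
  rw [mem_Seg] at *
  rw [dist_comm c y] at h1
  linarith

theorem dist_tmed_le (x x' y z : T) : dist (tmed x y z) (tmed x' y z) ≤ dist x x' := by
  rw [hT.dist_of_mem_Seg (hT.tmed_spec x y z).2.1 (hT.tmed_spec x' y z).2.1, hT.dist_tmed,
    hT.dist_tmed]
  have h1 := abs_le.1 (abs_dist_sub_le x x' y)
  have h2 := abs_le.1 (abs_dist_sub_le x x' z)
  rw [abs_le]
  constructor <;> linarith

/-- The median is the meet of the order based at `p`. -/
theorem le_tmed {p x y c : T} (h1 : c ∈ Seg p x) (h2 : c ∈ Seg p y) :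
    c ∈ Seg p (tmed x p y) := by
  refine hT.mem_Seg_of_le h1 (Seg_symm (hT.tmed_spec x p y).1) ?_
  rw [hT.dist_tmed]
  rw [mem_Seg] at h1 h2
  have := dist_triangle x c y
  rw [dist_comm x c] at this
  rw [dist_comm x p]
  linarith

theorem tmed_isMedianOp : IsMedianOp (tmed : T → T → T → T) := by
  refine ⟨fun x y z => ?_, fun x y z => ?_, fun x y => ?_, fun x y z p => ?_⟩
  · obtain ⟨h1, h2, h3⟩ := hT.tmed_spec x y z
    exact hT.eq_tmed (Seg_symm h1) h3 h2
  · obtain ⟨h1, h2, h3⟩ := hT.tmed_spec x y z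
    exact hT.eq_tmed h3 (Seg_symm h2) h1
  · exact Seg_self (hT.tmed_spec x x y).1
  · have hl : ∀ a b, tmed a p b ∈ Seg p a := fun a b => Seg_symm (hT.tmed_spec a p b).1
    have hr : ∀ a b, tmed a p b ∈ Seg p b := fun a b => (hT.tmed_spec a p b).2.1
    have anti : ∀ a b, a ∈ Seg p b → b ∈ Seg p a → a = b := by
      intro a b h1 h2
      refine hT.eq_of_mem_Seg h1 (right_mem_Seg p b) ?_
      rw [mem_Seg] at h1 h2
      rw [dist_comm b a] at h2
      linarith [dist_nonneg (x := a) (y := b)]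
    refine anti _ _ ?_ ?_
    · refine hT.le_tmed (Seg_trans (hl x y) (hl _ z)) (hT.le_tmed ?_ (hr _ z))
      exact Seg_trans (hr x y) (hl _ z)
    · refine hT.le_tmed (hT.le_tmed (hl _ _) ?_) ?_
      · exact Seg_trans (hl y z) (hr x _)
      · exact Seg_trans (hr y z) (hr x _)

theorem tmed_eq_self_iff {x y z : T} : tmed x y z = z ↔ z ∈ Seg x y :=
  ⟨fun h => h ▸ (hT.tmed_spec x y z).1,
    fun h => (hT.eq_tmed h (right_mem_Seg y z) (right_mem_Seg x z)).symm⟩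

/-- Seen from `q`, being on the same side is transitive. -/
theorem mem_Seg_of_not {q x y z : T} (h : q ∈ Seg x z) (h' : q ∉ Seg x y) : q ∈ Seg y z := by
  rw [mem_Seg] at *
  have h4 := hT.four_point x y z q
  have := dist_triangle x q y
  have := dist_triangle y q z
  rw [dist_comm q z] at *
  rw [dist_comm q y] at *
  rcases le_max_iff.1 h4 with h1 | h1
  · exact absurd (by linarith) h'
  · linarith

/-- The point of the segment from `x` to `y` with relative parameter `s`. -/
theorem exists_path (x y : T) : ∃ γ : ℝ → T, (∀ s, γ s ∈ Seg x y) ∧ γ 0 = x ∧ γ 1 = y ∧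
    (∀ s ∈ Icc (0 : ℝ) 1, dist x (γ s) = s * dist x y) ∧
    LipschitzWith (nndist x y) γ := by
  have hd := dist_nonneg (x := x) (y := y)
  have hcl : ∀ s : ℝ, 0 ≤ max 0 (min 1 s) ∧ max 0 (min 1 s) ≤ 1 := fun s =>
    ⟨le_max_left _ _, max_le zero_le_one (min_le_left _ _)⟩
  have h1 : ∀ s : ℝ, ∃ c ∈ Seg x y, dist x c = max 0 (min 1 s) * dist x y := fun s =>
    hT.exists_mem_Seg x y (mul_nonneg (hcl s).1 hd) (mul_le_of_le_one_left hd (hcl s).2)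
  choose γ hγ hγd using h1
  refine ⟨γ, hγ, ?_, ?_, ?_, ?_⟩
  · have := hγd 0
    simp at this
    exact this.symm
  · refine hT.eq_of_mem_Seg (hγ 1) (right_mem_Seg x y) ?_
    rw [hγd]; simp
  · rintro s ⟨h0, h1⟩
    rw [hγd, min_eq_right h1, max_eq_right h0]
  · refine LipschitzWith.of_dist_le_mul fun s s' => ?_
    rw [hT.dist_of_mem_Seg (hγ s) (hγ s'), hγd, hγd, ← sub_mul, abs_mul, abs_of_nonneg hd,
      coe_nndist, mul_comm, Real.dist_eq]
    refine mul_le_mul_of_nonneg_left ?_ hd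
    have a1 := abs_max_sub_max_le_abs (min 1 s) (min 1 s') 0
    have a2 := abs_min_sub_min_le_max 1 s 1 s'
    rw [max_comm 0, max_comm 0]
    refine a1.trans (a2.trans ?_)
    simp

open Classical in
/-- A signed distance to `q`, negative on the side of `a`. -/
theorem exists_signed_dist (q a : T) : ∃ σ : T → ℝ, LipschitzWith 1 σ ∧ (∀ z, σ z = 0 → z = q) ∧
    (∀ z, q ∉ Seg z a → σ z ≤ 0) ∧ ∀ z, q ∈ Seg z a → 0 ≤ σ z := by
  refine ⟨fun z => if q ∈ Seg z a then dist z q else -dist z q, ?_, ?_, ?_, ?_⟩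
  · refine LipschitzWith.of_dist_le_mul fun z z' => ?_
    rw [NNReal.coe_one, one_mul, Real.dist_eq]
    have key : ∀ z z', q ∈ Seg z a → q ∉ Seg z' a → |dist z q - -dist z' q| ≤ dist z z' := by
      intro z z' h h'
      have := hT.mem_Seg_of_not (Seg_symm h) (fun h => h' (Seg_symm h))
      rw [mem_Seg, dist_comm q z, dist_comm z' z] at this
      rw [sub_neg_eq_add, abs_of_nonneg (by positivity)]
      linarith
    split_ifs with h h' h'
    · exact abs_dist_sub_le z z' q
    · exact key z z' h h'
    · have := key z' z h' h
      rw [dist_comm z' z, abs_sub_comm] at this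
      exact this
    · rw [neg_sub_neg, abs_sub_comm]
      exact abs_dist_sub_le z z' q
  · intro z hz
    dsimp only at hz
    split_ifs at hz
    · exact dist_eq_zero.1 hz
    · exact dist_eq_zero.1 (neg_eq_zero.1 hz)
  · intro z hz
    simp [hz]
  · intro z hz
    simp [hz]

/-- Beyond any point `w`, seen from `z`, there are two different directions. -/
theorem exists_branches (hF : Furry T) (w z : T) :
    ∃ b c : T, b ≠ w ∧ c ≠ w ∧ w ∈ Seg z b ∧ w ∈ Seg z c ∧ w ∈ Seg b c := by
  have sep : ∀ a b : T, a ∈ ({w}ᶜ : Set T) →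
      connectedComponentIn ({w}ᶜ : Set T) a ≠ connectedComponentIn ({w}ᶜ : Set T) b →
      w ∈ Seg a b := by
    intro a b ha hne
    by_contra hw
    obtain ⟨γ, hγ, h0, h1, -, hl⟩ := hT.exists_path a b
    have hconn : IsPreconnected (range γ) := isPreconnected_range hl.continuous
    have hsub : range γ ⊆ ({w}ᶜ : Set T) := by
      rintro _ ⟨s, rfl⟩ hs
      rw [mem_singleton_iff] at hs
      exact hw (hs ▸ hγ s)
    have := hconn.subset_connectedComponentIn ⟨0, h0⟩ hsub ⟨1, h1⟩
    exact hne (connectedComponentIn_eq this)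
  obtain ⟨a, b, c, ha, hb, hc, hab, hbc, hac⟩ := hF w
  have s1 := sep a b ha hab
  have s2 := sep b c hb hbc
  have s3 := sep a c ha hac
  simp only [mem_compl_iff, mem_singleton_iff] at ha hb hc
  by_cases h1 : w ∈ Seg z a
  · by_cases h2 : w ∈ Seg z b
    · exact ⟨a, b, ha, hb, h1, h2, s1⟩
    · exact ⟨a, c, ha, hc, h1, hT.mem_Seg_of_not s2 fun h => h2 (Seg_symm h), s3⟩
  · exact ⟨b, c, hb, hc, hT.mem_Seg_of_not s1 fun h => h1 (Seg_symm h),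
      hT.mem_Seg_of_not s3 fun h => h1 (Seg_symm h), s2⟩

end IsRTree

end Tree

section OrthoMore

variable {Ω ι κ : Type*} {m : Ω → Ω → Ω → Ω} {x t : Ω} {b : ι → Ω}

theorem Ortho.corner_mem (hm : IsMedianOp m) (ho : Ortho m x b t) {i j : ι} (hij : i ≠ j) :
    x ∈ medInt m (b i) (b j) := by
  rw [hm.mem_int_iff]
  intro h hh hi hj
  by_contra hx
  exact hij (ho.unique hh hx hi hj)

theorem Ortho.exists_comp [Fintype κ] (hm : IsMedianOp m) (ho : Ortho m x b t) {f : κ → ι}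
    (hf : Function.Injective f) : ∃ t', Ortho m x (b ∘ f) t' :=
  exists_ortho_of_flag (fun _ => ho.1 _) (fun _ _ hij => ho.corner_mem hm fun h => hij (hf h))
    (fun _ _ _ => ⟨t, ho.mem_int hm _, ho.mem_int hm _⟩)

end OrthoMore

section Product

variable {p : ℕ} {T : Fin p → Type*} [∀ i, MetricSpace (T i)]

theorem PiLp.dist_L1 (x y : PiLp 1 T) : dist x y = ∑ i, dist (x i) (y i) := by
  rw [PiLp.dist_eq_sum (by simp)]
  simp

theorem PiLp.dist_apply_le_L1 (x y : PiLp 1 T) (i : Fin p) : dist (x i) (y i) ≤ dist x y := by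
  rw [PiLp.dist_L1]
  exact Finset.single_le_sum (f := fun i => dist (x i) (y i)) (fun _ _ => dist_nonneg)
    (Finset.mem_univ i)

theorem PiLp.continuous_eval_L1 (i : Fin p) : Continuous fun x : PiLp 1 T => x i :=
  (LipschitzWith.of_dist_le_mul (K := 1) fun x y => by
    rw [NNReal.coe_one, one_mul]; exact PiLp.dist_apply_le_L1 x y i).continuous

/-- The product of the segments between the coordinates of two points. -/
def Box (a b : PiLp 1 T) : Set (PiLp 1 T) := {y | ∀ i, y i ∈ Seg (a i) (b i)}

theorem isClosed_Box (a b : PiLp 1 T) : IsClosed (Box a b) := by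
  have : Box a b = ⋂ i, (fun x : PiLp 1 T => x i) ⁻¹' Seg (a i) (b i) := by
    ext; simp [Box]
  rw [this]
  exact isClosed_iInter fun i => (isClosed_Seg _ _).preimage (PiLp.continuous_eval_L1 i)

/-- The coordinatewise median. -/
noncomputable def pmed (x y z : PiLp 1 T) : PiLp 1 T :=
  WithLp.toLp 1 fun i => tmed (x i) (y i) (z i)

theorem pmed_apply (x y z : PiLp 1 T) (i : Fin p) : pmed x y z i = tmed (x i) (y i) (z i) := rfl

variable (hT : ∀ i, IsRTree (T i))

include hT

theorem pmed_lipMed : LipMed (pmed : PiLp 1 T → PiLp 1 T → PiLp 1 T → PiLp 1 T) 1 := by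
  refine ⟨⟨fun x y z => ?_, fun x y z => ?_, fun x y => ?_, fun x y z w => ?_⟩, le_rfl,
    fun x x' y z => ?_⟩
  · exact PiLp.ext fun i => (hT i).tmed_isMedianOp.1 _ _ _
  · exact PiLp.ext fun i => (hT i).tmed_isMedianOp.2.1 _ _ _
  · exact PiLp.ext fun i => (hT i).tmed_isMedianOp.2.2.1 _ _
  · exact PiLp.ext fun i => (hT i).tmed_isMedianOp.2.2.2 _ _ _ _
  · rw [one_mul, PiLp.dist_L1, PiLp.dist_L1]
    exact Finset.sum_le_sum fun i _ => (hT i).dist_tmed_le _ _ _ _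

theorem mem_medInt_pmed {x y z : PiLp 1 T} : z ∈ medInt pmed x y ↔ z ∈ Box x y := by
  constructor
  · intro h i
    have h' : pmed x y z = z := h
    rw [← (hT i).tmed_eq_self_iff, ← pmed_apply, h']
  · intro h
    exact PiLp.ext fun i => (hT i).tmed_eq_self_iff.2 (h i)

/-- Parametrization of a box by the unit cube. -/
theorem exists_flat (a b : PiLp 1 T) : ∃ κ : (Fin p → ℝ) → PiLp 1 T,
    (∀ s, κ s ∈ Box a b) ∧ (∀ s i, s i = 0 → κ s i = a i) ∧ (∀ s i, s i = 1 → κ s i = b i) ∧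
    (∀ s i, s i ∈ Icc (0 : ℝ) 1 → dist (a i) (κ s i) = s i * dist (a i) (b i)) ∧
    ∃ K : NNReal, LipschitzWith K κ := by
  choose γ hγ h0 h1 hd hl using fun i => (hT i).exists_path (a i) (b i)
  refine ⟨fun s => WithLp.toLp 1 fun i => γ i (s i), fun s i => hγ i _, fun s i hi => ?_,
    fun s i hi => ?_, fun s i hi => hd i _ hi, ∑ i, nndist (a i) (b i), ?_⟩
  · change γ i (s i) = _
    rw [hi, h0]
  · change γ i (s i) = _
    rw [hi, h1]
  · refine LipschitzWith.of_dist_le_mul fun s s' => ?_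
    rw [PiLp.dist_L1, NNReal.coe_sum, Finset.sum_mul]
    refine Finset.sum_le_sum fun i _ => ((hl i).dist_le_mul _ _).trans ?_
    gcongr
    exact dist_le_pi_dist s s' i

theorem exists_pathSystem : ∃ E : PiLp 1 T → PiLp 1 T → ℝ → PiLp 1 T, IsPathSystem E := by
  choose κ hκ h0 h1 hd K hK using fun a b : PiLp 1 T => exists_flat hT a b
  refine ⟨fun a b s => κ a b fun _ => s, fun a b => ?_, fun a b => ?_, fun a b => ?_⟩
  · exact PiLp.ext fun i => h0 a b _ i rfl
  · exact PiLp.ext fun i => h1 a b _ i rfl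
  · refine ⟨K a b * 1, (hK a b).comp (LipschitzWith.of_dist_le_mul fun s s' => ?_)⟩
    rw [NNReal.coe_one, one_mul]
    exact (dist_pi_le_iff dist_nonneg).2 fun _ => le_rfl

theorem Ortho.card_le_pmed {k : ℕ} {x t : PiLp 1 T} {b : Fin k → PiLp 1 T}
    (ho : Ortho pmed x b t) : k ≤ p := by
  have hm := (pmed_lipMed hT).1
  have h1 : ∀ j, ∃ i, b j i ≠ x i := by
    intro j
    by_contra hcon
    push Not at hcon
    exact ho.1 j (PiLp.ext hcon)
  choose f hf using h1
  have hinj : Function.Injective f := by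
    intro j j' hjj
    by_contra hne
    have h2 := (mem_medInt_pmed hT).1 (ho.corner_mem hm hne) (f j)
    have h3 := (mem_medInt_pmed hT).1 (ho.mem_int hm j) (f j)
    have h4 := (mem_medInt_pmed hT).1 (ho.mem_int hm j') (f j)
    have h5 := (hT (f j)).dist_of_mem_Seg h3 h4
    have h6 := dist_pos.2 (hf j)
    have h7 := dist_pos.2 (hf j')
    rw [← hjj] at h7
    rw [mem_Seg, h5, dist_comm (b j (f j)), dist_comm (x (f j)) (b j' (f j))] at h2
    rw [dist_comm] at h6
    rcases abs_cases (dist (x (f j)) (b j (f j)) - dist (x (f j)) (b j' (f j))) with h | h <;>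
      rw [dist_comm (x (f j)) (b j' (f j))] at h <;> linarith
  simpa using Fintype.card_le_of_injective f hinj

end Product

section Rank

variable {p : ℕ} {T : Fin p → Type*} [∀ i, MetricSpace (T i)] (hT : ∀ i, IsRTree (T i))

include hT

/-- A map of the unit cube which is close to the parametrization of a box along the boundary hits
every point well inside the box. -/
theorem exists_eq_of_boundary {a b q : PiLp 1 T} (hq : q ∈ Box a b)
    {g : (Fin p → unitInterval) → PiLp 1 T} (hg : Continuous g) {η : ℝ}
    (h0 : ∀ s i, s i = 0 → dist (g s i) (a i) ≤ η) (h1 : ∀ s i, s i = 1 → dist (g s i) (b i) ≤ η)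
    (hqa : ∀ i, η < dist (a i) (q i)) (hqb : ∀ i, η < dist (b i) (q i)) : ∃ s, g s = q := by
  choose σ hσ hσ0 hσn hσp using fun i => (hT i).exists_signed_dist (q i) (a i)
  have hside : ∀ i z c, dist z c ≤ η → η < dist c (q i) → q i ∉ Seg z c := by
    intro i z c h h' hs
    rw [mem_Seg, dist_comm (q i) c] at hs
    linarith [dist_nonneg (x := z) (y := q i)]
  obtain ⟨s, hs⟩ := poincare_miranda (fun i s => σ i (g s i))
    (fun i => (hσ i).continuous.comp ((PiLp.continuous_eval_L1 i).comp hg))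
    (fun i s hs => hσn i _ (hside i _ _ (h0 s i hs) (hqa i)))
    (fun i s hs => hσp i _ ((hT i).mem_Seg_of_not (Seg_symm (hq i)) fun h =>
      hside i _ _ (h1 s i hs) (hqb i) (Seg_symm h)))
  exact ⟨s, PiLp.ext fun i => hσ0 i _ (hs i)⟩

variable {m : PiLp 1 T → PiLp 1 T → PiLp 1 T → PiLp 1 T} {L : ℝ}

omit hT in
theorem LipMed.lipschitz_third {Ω : Type*} [MetricSpace Ω] {m : Ω → Ω → Ω → Ω} {L : ℝ}
    (h : LipMed m L) (x y : Ω) : LipschitzWith (Real.toNNReal L) fun z => m x y z := by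
  refine LipschitzWith.of_dist_le_mul fun z w => ?_
  rw [Real.coe_toNNReal _ h.pos.le]
  simpa using h.dist_le x y z x y w

/-- A Lipschitz median operator has rank at most the number of tree factors. -/
theorem LipMed.card_le (h : LipMed m L) {k : ℕ} {x t : PiLp 1 T} {b : Fin k → PiLp 1 T}
    (ho : Ortho m x b t) : k ≤ p := by
  by_contra hk
  push Not at hk
  have hm := h.1
  obtain ⟨t, ho⟩ := ho.exists_comp hm (Fin.castLE_injective (show p + 1 ≤ k by omega))
  generalize b ∘ Fin.castLE (show p + 1 ≤ k by omega) = b at ho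
  obtain ⟨E, hE⟩ := exists_pathSystem hT
  let c : (Fin (p + 1) → unitInterval) → Fin (p + 1) → PiLp 1 T := fun s j =>
    m x (b j) (E x (b j) (s j))
  have hc : ∀ s j, c s j ∈ medInt m x (b j) := fun s j => hm.med_mem _ _ _
  let Ψ : (Fin (p + 1) → unitInterval) → PiLp 1 T := fun s => jn m x t (c s)
  have hΨ : Continuous Ψ := by
    refine (h.continuous_jn _ _).comp (continuous_pi fun j => ?_)
    refine h.continuous continuous_const continuous_const ?_
    obtain ⟨K, hK⟩ := hE.lip x (b j)
    exact hK.continuous.comp (continuous_subtype_val.comp (continuous_apply j))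
  let F : PiLp 1 T → Fin (p + 1) → ℝ := fun y j => dist x (m x (b j) y)
  have hF : LipschitzWith (Real.toNNReal L) F := by
    refine LipschitzWith.of_dist_le_mul fun y y' => (dist_pi_le_iff (by positivity)).2 fun j => ?_
    refine le_trans ?_ ((h.lipschitz_third x (b j)).dist_le_mul y y')
    change |dist x (m x (b j) y) - dist x (m x (b j) y')| ≤ _
    rw [dist_comm x, dist_comm x]
    exact abs_dist_sub_le _ _ _
  obtain ⟨r, hr, hrb⟩ : ∃ r > 0, ∀ j, r < dist x (b j) := by
    obtain ⟨j0, hj0⟩ := Finite.exists_min fun j => dist x (b j)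
    have := dist_pos.2 (ho.1 j0).symm
    exact ⟨dist x (b j0) / 2, by linarith, fun j => by linarith [hj0 j]⟩
  have hL := h.pos
  obtain ⟨A, hA⟩ := (pmed_lipMed hT).exists_approx hE Ψ hΨ (η := r / (4 * L)) (by positivity)
  obtain ⟨M, hAM, hM⟩ := (pmed_lipMed hT).1.exists_finite_subalgebra
    (A := insert x (A : Set (PiLp 1 T))) (A.finite_toSet.insert x)
  obtain ⟨g, hg, hgΨ, hslab⟩ := hA M hM (fun a ha => hAM (mem_insert_of_mem _ ha)) x
    (hAM (mem_insert _ _))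
  have hthin : ∀ s, g s ∈ thinSlabs pmed E M x (p + 1) := by
    intro s
    obtain ⟨k, x', b', t', w, r', hQ, hw, hgs⟩ := hslab s
    have hk := hQ.2.2.2.1.card_le_pmed hT
    refine mem_iUnion.2 ⟨⟨⟨k, by omega⟩, ⟨x', hQ.1⟩, fun j => ⟨b' j, hQ.2.1 j⟩, ⟨t', hQ.2.2.1⟩,
      fun j => ⟨w j, hw j⟩⟩, r', hgs.symm⟩
  have hdense := (pmed_lipMed hT).dense_compl_image_thinSlabs hE M x (Nat.le_add_left 1 p) hF
  obtain ⟨y, hy, hyr⟩ := hdense.exists_dist_lt (fun _ => r / 2) (show 0 < r / 8 by positivity)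
  have hyj : ∀ j, |r / 2 - y j| < r / 8 := fun j =>
    lt_of_le_of_lt (dist_le_pi_dist (fun _ => r / 2) y j) hyr
  have hclose : ∀ s j, |F (g s) j - dist x (c s j)| ≤ r / 4 := by
    intro s j
    have h1 : F (Ψ s) j = dist x (c s j) := by
      simp only [F, Ψ]
      rw [proj_jn hm ho (hc s) j]
    rw [← h1]
    have h2 := (dist_le_pi_dist (F (g s)) (F (Ψ s)) j).trans (hF.dist_le_mul (g s) (Ψ s))
    rw [Real.coe_toNNReal _ hL.le] at h2
    rw [← Real.dist_eq]
    refine h2.trans ((mul_le_mul_of_nonneg_left (hgΨ s) hL.le).trans ?_)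
    apply le_of_eq
    field_simp
  have hlow : ∀ j s, s j = 0 → F (g s) j - y j ≤ 0 := by
    intro j s hs
    have h1 := abs_le.1 (hclose s j)
    have h2 := abs_lt.1 (hyj j)
    have h3 : c s j = x := by
      simp only [c, hs]
      rw [Set.Icc.coe_zero, hE.zero, hm.self_outer]
    rw [h3, dist_self] at h1
    linarith
  have hhigh : ∀ j s, s j = 1 → 0 ≤ F (g s) j - y j := by
    intro j s hs
    have h1 := abs_le.1 (hclose s j)
    have h2 := abs_lt.1 (hyj j)
    have h3 : c s j = b j := by
      simp only [c, hs]
      rw [Set.Icc.coe_one, hE.one, hm.self_right]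
    rw [h3] at h1
    linarith [hrb j]
  obtain ⟨s, hs⟩ := poincare_miranda (fun j s => F (g s) j - y j)
    (fun j => ((continuous_apply j).comp (hF.continuous.comp hg)).sub continuous_const) hlow hhigh
  exact hy ⟨g s, hthin s, funext fun j => by linarith [hs j]⟩

omit hT in
theorem LipMed.isClosed_medInt {Ω : Type*} [MetricSpace Ω] {m : Ω → Ω → Ω → Ω} {L : ℝ}
    (h : LipMed m L) (x y : Ω) : IsClosed (medInt m x y) :=
  isClosed_eq (h.continuous continuous_const continuous_const continuous_id) continuous_id

/-- The inner part of a box is covered by the top dimensional cubes of large finite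
subalgebras. -/
theorem LipMed.exists_cover (h : LipMed m L) (hp : 1 ≤ p) (a b o : PiLp 1 T)
    (hab : ∀ i, a i ≠ b i) {η : ℝ} (hη : 0 < η) :
    ∃ A : Finset (PiLp 1 T), ∀ M : Finset (PiLp 1 T),
      (∀ x ∈ M, ∀ y ∈ M, ∀ z ∈ M, m x y z ∈ M) → A ⊆ M → o ∈ M →
      ∀ q ∈ Box a b, (∀ i, η < dist (a i) (q i)) → (∀ i, η < dist (b i) (q i)) →
      ∃ (x : PiLp 1 T) (c : Fin p → PiLp 1 T) (t : PiLp 1 T),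
        MCube m M o x c t ∧ q ∈ medInt m x t := by
  have hm := h.1
  obtain ⟨E, hE⟩ := exists_pathSystem hT
  obtain ⟨κ, hκ, hκ0, hκ1, hκd, K, hK⟩ := exists_flat hT a b
  let Ψ : (Fin p → unitInterval) → PiLp 1 T := fun s => κ fun i => s i
  have hΨ : Continuous Ψ := hK.continuous.comp (by fun_prop)
  obtain ⟨A, hA⟩ := h.exists_approx hE Ψ hΨ hη
  refine ⟨A, fun M hM hAM hoM q hq hqa hqb => ?_⟩
  obtain ⟨g, hg, hgΨ, hslab⟩ := hA M hM hAM o hoM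
  let F : PiLp 1 T → Fin p → ℝ := fun y i => dist (a i) (y i)
  have hF : LipschitzWith 1 F := by
    refine LipschitzWith.of_dist_le_mul fun y y' => (dist_pi_le_iff (by positivity)).2 fun i => ?_
    change |dist (a i) (y i) - dist (a i) (y' i)| ≤ _
    rw [dist_comm (a i), dist_comm (a i), NNReal.coe_one, one_mul]
    exact (abs_dist_sub_le _ _ _).trans (PiLp.dist_apply_le_L1 y y' i)
  have hdense := h.dense_compl_image_thinSlabs hE M o hp hF
  let Good : Set (PiLp 1 T) := ⋃ q : {q : M × M // ∃ c : Fin p → PiLp 1 T, MCube m M o q.1 c q.2},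
    medInt m q.1.1 q.1.2
  have hGood : IsClosed Good := isClosed_iUnion_of_finite fun q => h.isClosed_medInt _ _
  have key : ∀ q' ∈ Box a b, (∀ i, η < dist (a i) (q' i)) → (∀ i, η < dist (b i) (q' i)) →
      F q' ∉ F '' thinSlabs m E M o p → q' ∈ Good := by
    intro q' hq' hqa' hqb' hav
    have hΨ0 : ∀ s i, s i = 0 → Ψ s i = a i := fun s i hs => hκ0 _ i (by simp [hs])
    have hΨ1 : ∀ s i, s i = 1 → Ψ s i = b i := fun s i hs => hκ1 _ i (by simp [hs])
    obtain ⟨s, rfl⟩ := exists_eq_of_boundary hT hq' hg (η := η)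
      (fun s i hs => by
        rw [← hΨ0 s i hs]; exact (PiLp.dist_apply_le_L1 _ _ i).trans (hgΨ s))
      (fun s i hs => by
        rw [← hΨ1 s i hs]; exact (PiLp.dist_apply_le_L1 _ _ i).trans (hgΨ s)) hqa' hqb'
    obtain ⟨k, x', b', t', w, r', hQ, hw, hgs⟩ := hslab s
    rcases (h.card_le hT hQ.2.2.2.1).lt_or_eq with hlt | rfl
    · refine absurd ⟨g s, mem_iUnion.2 ⟨⟨⟨k, hlt⟩, ⟨x', hQ.1⟩, fun j => ⟨b' j, hQ.2.1 j⟩,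
        ⟨t', hQ.2.2.1⟩, fun j => ⟨w j, hw j⟩⟩, r', hgs.symm⟩, rfl⟩ hav
    · refine mem_iUnion.2 ⟨⟨(⟨x', hQ.1⟩, ⟨t', hQ.2.2.1⟩), b', hQ⟩, ?_⟩
      rw [hgs]
      exact jn_mem_int hm hQ.2.2.2.1 fun j => hm.med_mem _ _ _
  have hqG : q ∈ Good := by
    rw [← hGood.closure_eq, Metric.mem_closure_iff]
    intro ε hε
    have hp0 : (0 : ℝ) < p := by exact_mod_cast hp
    have hab' : ∀ i, 0 < dist (a i) (b i) := fun i => dist_pos.2 (hab i)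
    -- a small perturbation of the coordinates of `q`
    obtain ⟨r, hr, hrε, hra, hrb⟩ : ∃ r > 0, p * r ≤ ε ∧ (∀ i, η + r ≤ dist (a i) (q i)) ∧
        ∀ i, η + r ≤ dist (b i) (q i) := by
      have hne : Nonempty (Fin p) := ⟨⟨0, hp⟩⟩
      obtain ⟨i0, hi0⟩ := Finite.exists_min fun i => dist (a i) (q i)
      obtain ⟨i1, hi1⟩ := Finite.exists_min fun i => dist (b i) (q i)
      refine ⟨min (ε / p) (min (dist (a i0) (q i0) - η) (dist (b i1) (q i1) - η)), ?_, ?_, ?_, ?_⟩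
      · have := hqa i0
        have := hqb i1
        refine lt_min (by positivity) (lt_min ?_ ?_) <;> linarith
      · have := min_le_left (ε / p) (min (dist (a i0) (q i0) - η) (dist (b i1) (q i1) - η))
        calc _ ≤ p * (ε / p) := mul_le_mul_of_nonneg_left this hp0.le
          _ = ε := by field_simp
      · intro i
        have := (min_le_right (ε / p) (min (dist (a i0) (q i0) - η) (dist (b i1) (q i1) - η))).trans
          (min_le_left _ _)
        linarith [hi0 i]
      · intro i
        have := (min_le_right (ε / p) (min (dist (a i0) (q i0) - η) (dist (b i1) (q i1) - η))).trans
          (min_le_right _ _)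
        linarith [hi1 i]
    obtain ⟨y, hy, hyr⟩ := hdense.exists_dist_lt (F q) hr
    have hyi : ∀ i, |dist (a i) (q i) - y i| < r := fun i =>
      lt_of_le_of_lt (dist_le_pi_dist (F q) y i) hyr
    have hqs : ∀ i, dist (a i) (q i) + dist (b i) (q i) = dist (a i) (b i) := fun i => by
      have := hq i
      rw [mem_Seg, dist_comm (q i)] at this
      exact this
    have hyb : ∀ i, ∃ c ∈ Seg (a i) (b i), dist (a i) c = y i := fun i => by
      have h1 := abs_lt.1 (hyi i)
      exact (hT i).exists_mem_Seg _ _ (by linarith [hra i]) (by linarith [hrb i, hqs i])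
    choose c hc hcd using hyb
    have hcb : ∀ i, dist (a i) (c i) + dist (b i) (c i) = dist (a i) (b i) := fun i => by
      have := hc i
      rw [mem_Seg, dist_comm (c i)] at this
      exact this
    refine ⟨WithLp.toLp 1 c, key _ hc ?_ ?_ ?_, ?_⟩
    · intro i
      have h1 := abs_lt.1 (hyi i)
      change η < dist (a i) (c i)
      rw [hcd]
      linarith [hra i]
    · intro i
      have h1 := abs_lt.1 (hyi i)
      have h2 := hcb i
      rw [hcd] at h2
      change η < dist (b i) (c i)
      linarith [hrb i, hqs i]
    · have : F (WithLp.toLp 1 c) = y := funext fun i => hcd i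
      rw [this]
      exact hy
    · rw [PiLp.dist_L1]
      refine lt_of_lt_of_le (Finset.sum_lt_sum_of_nonempty (g := fun _ => r) ?_ fun i _ => ?_) ?_
      · exact ⟨⟨0, hp⟩, Finset.mem_univ _⟩
      · change dist (q i) (c i) < r
        rw [(hT i).dist_of_mem_Seg (hq i) (hc i), hcd]
        exact hyi i
      · simpa using hrε
  obtain ⟨⟨⟨x, t⟩, c, hQ⟩, hmem⟩ := mem_iUnion.1 hqG
  exact ⟨x, c, t, hQ, hmem⟩

end Rank

section Chain

variable {Ω : Type*} {m : Ω → Ω → Ω → Ω}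

/-- The edges of a cube of maximal dimension are totally ordered. -/
theorem Ortho.chain {n : ℕ} (hm : IsMedianOp m)
    (hr : ∀ (x t : Ω) (b : Fin (n + 1) → Ω), ¬ Ortho m x b t) {x t : Ω} {b : Fin n → Ω}
    (ho : Ortho m x b t) (j : Fin n) {c c' : Ω} (hc : c ∈ medInt m x (b j))
    (hc' : c' ∈ medInt m x (b j)) : c ∈ medInt m x c' ∨ c' ∈ medInt m x c := by
  by_contra hcon
  push Not at hcon
  set u := m x c c' with hu
  have hux : u ∈ medInt m x c := hm.med_mem _ _ _
  have hux' : u ∈ medInt m x c' := hm.med_mem'' _ _ _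
  have hcu : c ≠ u := fun e => hcon.1 (e ▸ hux')
  have hcu' : c' ≠ u := fun e => hcon.2 (e ▸ hux)
  have hub : u ∈ medInt m x (b j) := hm.int_trans hux hc
  have hjt := ho.mem_int hm j
  let e : Fin n → Fin n → Ω := fun k l => if l = j then u else if l = k then b k else x
  have he : ∀ k l, e k l ∈ medInt m x (b l) := by
    intro k l
    simp only [e]
    split_ifs with h1 h2
    · exact h1 ▸ hub
    · exact h2 ▸ hm.right_mem _ _
    · exact hm.left_mem _ _
  have hd : ∀ k h, IsHalf m h → x ∉ h → k ≠ j →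
      (jn m x t (e k) ∈ h ↔ u ∈ h ∨ b k ∈ h) := by
    intro k h hh hx hk
    rw [jn_mem ho (he k) hh hx]
    constructor
    · rintro ⟨l, hl⟩
      simp only [e] at hl
      split_ifs at hl with h1 h2
      · exact Or.inl hl
      · exact Or.inr hl
      · exact absurd hl hx
    · rintro (hl | hl)
      · exact ⟨j, by simpa [e] using hl⟩
      · exact ⟨k, by simpa [e, hk] using hl⟩
  have hud : ∀ k, u ∈ medInt m x (jn m x t (e k)) := by
    intro k
    rw [hm.mem_int_iff]
    intro h hh hx hj
    rw [jn_mem_of_mem ho (he k) hh hx] at hj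
    simpa [e] using hj j
  have hjb : ∀ h, IsHalf m h → x ∉ h → u ∈ h → b j ∈ h := fun h hh hx hu' =>
    hh.mem_of_int hub hx hu'
  have hne : ∀ k, k ≠ j → jn m x t (e k) ≠ u := by
    intro k hk heq
    obtain ⟨h, hh, hbk, hx⟩ := hm.exists_half (ho.1 k)
    have h1 : jn m x t (e k) ∈ h := (hd k h hh hx hk).2 (Or.inr hbk)
    rw [heq] at h1
    exact hk (ho.unique hh hx hbk (hjb h hh hx h1))
  have hcd : ∀ k, k ≠ j → ∀ c ∈ medInt m x (b j), u ∈ medInt m x c →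
      u ∈ medInt m c (jn m x t (e k)) := by
    intro k hk c hc huc
    rw [hm.mem_int_iff]
    intro h hh h1 h2
    by_cases hx : x ∈ h
    · exact hh.int huc hx h1
    · rcases (hd k h hh hx hk).1 h2 with h3 | h3
      · exact h3
      · exact absurd (ho.unique hh hx h3 (hh.mem_of_int hc hx h1)) hk
  have hdd : ∀ k l, k ≠ j → l ≠ j → k ≠ l →
      u ∈ medInt m (jn m x t (e k)) (jn m x t (e l)) := by
    intro k l hk hl hkl
    rw [hm.mem_int_iff]
    intro h hh h1 h2
    by_cases hx : x ∈ h
    · exact hh.int (hud k) hx h1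
    · rcases (hd k h hh hx hk).1 h1 with h3 | h3
      · exact h3
      · rcases (hd l h hh hx hl).1 h2 with h4 | h4
        · exact h4
        · exact absurd (ho.unique hh hx h3 h4) hkl
  let b' : Fin (n + 1) → Ω := Fin.cons c' fun k => if k = j then c else jn m x t (e k)
  have hcc : u ∈ medInt m c c' := hm.med_mem' _ _ _
  obtain ⟨t', ht'⟩ := exists_ortho_of_flag (m := m) (x := u) (b := b')
    (by
      refine Fin.cases hcu' fun k => ?_
      simp only [b', Fin.cons_succ]
      split_ifs with hk
      · exact hcu
      · exact hne k hk)
    (by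
      refine Fin.cases (Fin.cases (fun h => absurd rfl h) fun k _ => ?_) fun k =>
        Fin.cases (fun _ => ?_) fun l hkl => ?_ <;>
        simp only [b', Fin.cons_succ, Fin.cons_zero]
      · split_ifs with hk
        · exact hm.int_symm hcc
        · exact hcd k hk c' hc' hux'
      · split_ifs with hk
        · exact hcc
        · exact hm.int_symm (hcd k hk c' hc' hux')
      · have hkl : k ≠ l := fun e => hkl (by rw [e])
        split_ifs with hk hl hl
        · exact absurd (hk.trans hl.symm) hkl
        · exact hcd l hl c hc hux
        · exact hm.int_symm (hcd k hk c hc hux)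
        · exact hdd k l hk hl hkl)
    (by
      have key : ∀ k, b' k ∈ medInt m u t := by
        refine Fin.cases (hm.int_shift hux' (hm.int_trans hc' hjt)) fun k => ?_
        simp only [b', Fin.cons_succ]
        split_ifs with hk
        · exact hm.int_shift hux (hm.int_trans hc hjt)
        · exact hm.int_shift (hud k) (jn_mem_int hm ho (he k))
      exact fun k l _ => ⟨t, key k, key l⟩)
  exact hr _ _ _ ht'

end Chain

section Arc

variable {Ω : Type*} [MetricSpace Ω] {m : Ω → Ω → Ω → Ω} {L : ℝ}

/-- The radius of the median interval from `a` to `y`, measured from `a`. -/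
noncomputable def medRad (m : Ω → Ω → Ω → Ω) (a y : Ω) : ℝ := sSup (dist a '' medInt m a y)

theorem LipMed.dist_le_of_mem (h : LipMed m L) {a y z : Ω} (hz : z ∈ medInt m a y) :
    dist a z ≤ L * dist a y := by
  have hz' : m a y z = z := hz
  have := h.dist_le a a z a y z
  rw [h.1.self_left, hz'] at this
  simpa using this

theorem LipMed.bddAbove_dist (h : LipMed m L) (a y : Ω) : BddAbove (dist a '' medInt m a y) :=
  ⟨L * dist a y, by rintro _ ⟨z, hz, rfl⟩; exact h.dist_le_of_mem hz⟩

theorem LipMed.dist_le_medRad (h : LipMed m L) {a y z : Ω} (hz : z ∈ medInt m a y) :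
    dist a z ≤ medRad m a y := le_csSup (h.bddAbove_dist a y) ⟨z, hz, rfl⟩

theorem LipMed.medRad_nonneg (h : LipMed m L) (a y : Ω) : 0 ≤ medRad m a y :=
  dist_nonneg.trans (h.dist_le_medRad (h.1.right_mem a y))

theorem LipMed.medRad_le (h : LipMed m L) {a y : Ω} {r : ℝ}
    (hr : ∀ z ∈ medInt m a y, dist a z ≤ r) : medRad m a y ≤ r :=
  csSup_le ⟨_, a, h.1.left_mem a y, rfl⟩ (by rintro _ ⟨z, hz, rfl⟩; exact hr z hz)

theorem LipMed.medRad_self (h : LipMed m L) (a : Ω) : medRad m a a = 0 :=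
  le_antisymm (h.medRad_le fun z hz => by simpa using h.dist_le_of_mem hz) (h.medRad_nonneg a a)

theorem LipMed.medRad_mono (h : LipMed m L) {a y z : Ω} (hy : y ∈ medInt m a z) :
    medRad m a y ≤ medRad m a z :=
  h.medRad_le fun _ hw => h.dist_le_medRad (h.1.int_trans hw hy)

theorem LipMed.continuous_medRad (h : LipMed m L) (a : Ω) : Continuous (medRad m a) := by
  refine (LipschitzWith.of_le_add_mul' L fun y w => h.medRad_le fun z hz => ?_).continuous
  have hz' : m a y z = z := hz
  have h1 := h.dist_le a y z a w z
  rw [hz', dist_self, dist_self, zero_add, add_zero] at h1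
  have h2 := h.dist_le_medRad (h.1.med_mem a w z)
  have h3 := dist_triangle a (m a w z) z
  rw [dist_comm] at h1
  linarith

/-- A totally ordered interval of a Lipschitz median algebra is an arc. -/
theorem LipMed.exists_arc (h : LipMed m L) {x b : Ω} (hxb : b ≠ x) {γ : unitInterval → Ω}
    (hγ : Continuous γ) (hγ0 : γ 0 = x) (hγ1 : γ 1 = b)
    (hch : ∀ c ∈ medInt m x b, ∀ c' ∈ medInt m x b, c ∈ medInt m x c' ∨ c' ∈ medInt m x c) :
    ∃ (φ : Ω → ℝ) (ψ : ℝ → Ω), Continuous φ ∧ Continuous ψ ∧ (∀ y, φ y ∈ Icc (0 : ℝ) 1) ∧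
      (∀ r, ψ r ∈ medInt m x b) ∧ (∀ y, ψ (φ y) = m x b y) ∧ (∀ r ∈ Icc (0 : ℝ) 1, φ (ψ r) = r) ∧
      φ x = 0 ∧ φ b = 1 ∧ (∀ y, φ (m x b y) = φ y) ∧
      ∀ c c', c ∈ medInt m x c' → c' ∈ medInt m x b → φ c ≤ φ c' := by
  have hm := h.1
  set δ : unitInterval → Ω := fun s => m x b (γ s) with hδ
  have hδc : Continuous δ := h.continuous continuous_const continuous_const hγ
  have hδ0 : δ 0 = x := by simp only [hδ, hγ0, hm.self_outer]
  have hδ1 : δ 1 = b := by simp only [hδ, hγ1, hm.self_right]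
  have hδJ : ∀ s, δ s ∈ medInt m x b := fun s => hm.med_mem _ _ _
  -- closedness of the order relation along the path
  have hcl1 : ∀ y, IsClosed {s | δ s ∈ medInt m x y} := fun y =>
    (h.isClosed_medInt x y).preimage hδc
  have hcl2 : ∀ y, IsClosed {s | y ∈ medInt m x (δ s)} := fun y =>
    isClosed_eq (h.continuous continuous_const hδc continuous_const) continuous_const
  have hsurj : ∀ y ∈ medInt m x b, ∃ s, δ s = y := by
    intro y hy
    obtain ⟨s, -, hs1, hs2⟩ := isPreconnected_closed_iff.1 (isPreconnected_univ (α := unitInterval))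
      _ _ (hcl1 y) (hcl2 y) (fun s _ => hch _ (hδJ s) _ hy)
      ⟨0, mem_univ _, by rw [Set.mem_ofPred_eq, hδ0]; exact hm.left_mem _ _⟩
      ⟨1, mem_univ _, by rw [Set.mem_ofPred_eq, hδ1]; exact hy⟩
    exact ⟨s, hm.int_antisymm hs1 hs2⟩
  have hbetween : ∀ y ∈ medInt m x b, ∀ z ∈ medInt m x b, y ∈ medInt m x z → y ≠ z →
      ∃ n, y ∈ medInt m x (δ (TopologicalSpace.denseSeq unitInterval n)) ∧
        δ (TopologicalSpace.denseSeq unitInterval n) ∈ medInt m x z ∧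
        δ (TopologicalSpace.denseSeq unitInterval n) ≠ z := by
    intro y hy z hz hyz hne
    have hne' : ({s | δ s ∈ medInt m x y}ᶜ ∩ {s | z ∈ medInt m x (δ s)}ᶜ).Nonempty := by
      by_contra hemp
      rw [Set.not_nonempty_iff_eq_empty] at hemp
      obtain ⟨s, -, hs1, hs2⟩ := isPreconnected_closed_iff.1
        (isPreconnected_univ (α := unitInterval)) _ _ (hcl1 y) (hcl2 z)
        (fun s _ => by
          by_contra hs
          rw [mem_union, not_or] at hs
          have : s ∈ (∅ : Set unitInterval) := hemp ▸ ⟨hs.1, hs.2⟩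
          exact this)
        ⟨0, mem_univ _, by rw [Set.mem_ofPred_eq, hδ0]; exact hm.left_mem _ _⟩
        ⟨1, mem_univ _, by rw [Set.mem_ofPred_eq, hδ1]; exact hz⟩
      exact hne (hm.int_antisymm hyz (hm.int_trans hs2 hs1))
    obtain ⟨n, h1, h2⟩ := (TopologicalSpace.denseRange_denseSeq
      unitInterval).exists_mem_open ((hcl1 y).isOpen_compl.inter (hcl2 z).isOpen_compl) hne'
    refine ⟨n, (hch _ (hδJ _) _ hy).resolve_left h1, (hch _ (hδJ _) _ hz).resolve_right h2, ?_⟩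
    intro e
    exact h2 (by rw [Set.mem_ofPred_eq, e]; exact hm.right_mem _ _)
  set a : ℕ → Ω := fun n => δ (TopologicalSpace.denseSeq unitInterval n) with ha
  have haJ : ∀ n, a n ∈ medInt m x b := fun n => hδJ _
  let f : ℕ → Ω → ℝ := fun n y => (1 / 2 : ℝ) ^ n * medRad m (a n) (m (a n) b (m x b y))
  have hfc : ∀ n, Continuous (f n) := fun n => continuous_const.mul
    ((h.continuous_medRad (a n)).comp (h.continuous continuous_const continuous_const
      (h.continuous continuous_const continuous_const continuous_id)))
  have hL := h.pos
  have hf0 : ∀ n y, 0 ≤ f n y := fun n y => mul_nonneg (by positivity) (h.medRad_nonneg _ _)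
  let B : ℝ := L * (L * (L * dist x b + L * dist x b))
  have hfB : ∀ n y, f n y ≤ (1 / 2 : ℝ) ^ n * B := by
    intro n y
    refine mul_le_mul_of_nonneg_left (h.medRad_le fun z hz => ?_) (by positivity)
    refine (h.dist_le_of_mem hz).trans (mul_le_mul_of_nonneg_left ?_ hL.le)
    refine (h.dist_le_of_mem (hm.med_mem'' (a n) b (m x b y))).trans
      (mul_le_mul_of_nonneg_left ?_ hL.le)
    refine (dist_triangle_left _ _ x).trans (add_le_add (h.dist_le_of_mem (haJ n)) ?_)
    exact h.dist_le_of_mem (hm.med_mem _ _ _)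
  have hBs : Summable fun n : ℕ => (1 / 2 : ℝ) ^ n * B := summable_geometric_two.mul_right B
  have hfs : ∀ y, Summable fun n => f n y := fun y =>
    hBs.of_nonneg_of_le (fun n => hf0 n y) fun n => hfB n y
  let F : Ω → ℝ := fun y => ∑' n, f n y
  have hFc : Continuous F := continuous_tsum hfc hBs fun n y => by
    rw [Real.norm_of_nonneg (hf0 n y)]; exact hfB n y
  have hFproj : ∀ y, F (m x b y) = F y := fun y => by
    have : m x b (m x b y) = m x b y := hm.med_mem x b y
    simp only [F, f, this]
  have hfmono : ∀ n y z, y ∈ medInt m x z → z ∈ medInt m x b → f n y ≤ f n z := by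
    intro n y z hyz hz
    refine mul_le_mul_of_nonneg_left (h.medRad_mono ?_) (by positivity)
    have h1 : m x b y = y := hm.int_trans hyz hz
    have h2 : m x b z = z := hz
    have h3 := hm.map_int (a n) b hyz
    have h4 : m (a n) b x = a n := by
      rw [hm.swap13]
      exact haJ n
    rwa [h4, ← h1, ← h2] at h3
  have hFmono : ∀ y z, y ∈ medInt m x z → z ∈ medInt m x b → F y ≤ F z := fun y z hyz hz =>
    (hfs y).tsum_le_tsum (fun n => hfmono n y z hyz hz) (hfs z)
  have hFstrict : ∀ y z, y ∈ medInt m x z → z ∈ medInt m x b → y ≠ z → F y < F z := by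
    intro y z hyz hz hne
    have hy : y ∈ medInt m x b := hm.int_trans hyz hz
    obtain ⟨n, h1, h2, h3⟩ := hbetween y hy z hz hyz hne
    refine (hfs y).tsum_lt_tsum (i := n) (fun n => hfmono n y z hyz hz) ?_ (hfs z)
    have hy' : m x b y = y := hy
    have hz' : m x b z = z := hz
    have h4 : m (a n) b y = a n := by
      have : a n ∈ medInt m y b := hm.int_shift h1 (haJ n)
      have this : m y b (a n) = a n := this
      rw [hm.swap13]
      exact this
    have h5 : m (a n) b z = z := hm.int_shift h2 hz
    have : 0 < medRad m (a n) z :=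
      (dist_pos.2 h3).trans_le (h.dist_le_medRad (hm.right_mem _ _))
    simp only [f, hy', hz', h4, h5, h.medRad_self, mul_zero]
    positivity
  have hpos : F x < F b := hFstrict x b (hm.left_mem _ _) (hm.right_mem _ _) hxb.symm
  have hxy : ∀ y, F x ≤ F y := fun y => by
    rw [← hFproj y]; exact hFmono _ _ (hm.left_mem _ _) (hm.med_mem _ _ _)
  have hyb : ∀ y, F y ≤ F b := fun y => by
    rw [← hFproj y]; exact hFmono _ _ (hm.med_mem _ _ _) (hm.right_mem _ _)
  let φ : Ω → ℝ := fun y => (F y - F x) / (F b - F x)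
  have hφc : Continuous φ := (hFc.sub continuous_const).div_const _
  have hφI : ∀ y, φ y ∈ Icc (0 : ℝ) 1 := fun y =>
    ⟨div_nonneg (by linarith [hxy y]) (by linarith),
      (div_le_one (by linarith)).2 (by linarith [hyb y])⟩
  have hφx : φ x = 0 := by simp [φ]
  have hφb : φ b = 1 := div_self (by linarith)
  have hφinj : ∀ y ∈ medInt m x b, ∀ z ∈ medInt m x b, φ y = φ z → y = z := by
    intro y hy z hz e
    have e' : F y = F z := by
      have := (div_left_inj' (show F b - F x ≠ 0 by linarith)).1 e
      linarith
    by_contra hne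
    rcases hch y hy z hz with h1 | h1
    · exact (hFstrict y z h1 hz hne).ne e'
    · exact (hFstrict z y h1 hy (Ne.symm hne)).ne e'.symm
  have hJ : IsCompact (medInt m x b) := by
    have : medInt m x b = range δ := by
      ext y
      exact ⟨fun hy => hsurj y hy, by rintro ⟨s, rfl⟩; exact hδJ s⟩
    rw [this]
    exact isCompact_range hδc
  have : CompactSpace (medInt m x b) := isCompact_iff_compactSpace.1 hJ
  let e0 : medInt m x b → Icc (0 : ℝ) 1 := fun y => ⟨φ y, hφI y⟩
  have he0 : Function.Bijective e0 := by
    refine ⟨fun y z e => Subtype.ext (hφinj _ y.2 _ z.2 (congrArg Subtype.val e)), fun r => ?_⟩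
    have hr : r.1 ∈ Icc ((φ ∘ δ) 0) ((φ ∘ δ) 1) := by
      simpa only [Function.comp, hδ0, hδ1, hφx, hφb] using r.2
    obtain ⟨s, -, hs⟩ := (isPreconnected_univ (α := unitInterval)).intermediate_value
      (mem_univ 0) (mem_univ 1) (hφc.comp hδc).continuousOn hr
    exact ⟨⟨δ s, hδJ s⟩, Subtype.ext hs⟩
  let e := Equiv.ofBijective e0 he0
  have hec : Continuous e := (hφc.comp continuous_subtype_val).subtype_mk _
  let H : medInt m x b ≃ₜ Icc (0 : ℝ) 1 := hec.homeoOfEquivCompactToT2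
  have hHφ : ∀ y, (H y : ℝ) = φ y := fun y => rfl
  have hφproj : ∀ y, φ (m x b y) = φ y := fun y => by simp only [φ, hFproj]
  refine ⟨φ, fun r => H.symm (projIcc 0 1 zero_le_one r), hφc,
    continuous_subtype_val.comp (H.symm.continuous.comp continuous_projIcc), hφI,
    fun r => (H.symm _).2, fun y => ?_, fun r hr => ?_, hφx, hφb, hφproj, fun c c' hc hc' => ?_⟩
  · have h1 : projIcc 0 1 zero_le_one (φ y) = H ⟨m x b y, hm.med_mem _ _ _⟩ := by
      rw [projIcc_of_mem _ (hφI y)]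
      exact Subtype.ext (hφproj y).symm
    beta_reduce
    rw [h1, H.symm_apply_apply]
  · beta_reduce
    rw [← hHφ, H.apply_symm_apply, projIcc_of_mem _ hr]
  · exact div_le_div_of_nonneg_right (by linarith [hFmono c c' hc hc']) (by linarith)

end Arc

section Chart

variable {Ω : Type*} [MetricSpace Ω] {m : Ω → Ω → Ω → Ω} {L : ℝ} {n : ℕ}

/-- Coordinates `G` on the cube with corner `x`, edges to `b j` and top `t`, with inverse `Φ`. -/
structure IsChart (m : Ω → Ω → Ω → Ω) (x : Ω) (b : Fin n → Ω) (t : Ω) (G : Ω → Fin n → ℝ)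
    (Φ : (Fin n → ℝ) → Ω) : Prop where
  contG : Continuous G
  contΦ : Continuous Φ
  memG : ∀ y j, G y j ∈ Icc (0 : ℝ) 1
  memΦ : ∀ r, Φ r ∈ medInt m x t
  ΦG : ∀ y ∈ medInt m x t, Φ (G y) = y
  GΦ : ∀ r : Fin n → ℝ, (∀ j, r j ∈ Icc (0 : ℝ) 1) → G (Φ r) = r
  G_proj : ∀ y, G (m x t y) = G y
  G_int : ∀ a c y, y ∈ medInt m a c → ∀ j, G y j ∈ uIcc (G a j) (G c j)
  zero_iff : ∀ y j, G y j = 0 ↔ m x (b j) y = x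
  one_iff : ∀ y j, G y j = 1 ↔ m x (b j) y = b j
  eq_iff : ∀ y z j, G y j = G z j ↔ m x (b j) y = m x (b j) z

theorem LipMed.exists_chart (h : LipMed m L)
    (hr : ∀ (x t : Ω) (b : Fin (n + 1) → Ω), ¬ Ortho m x b t) {E : Ω → Ω → ℝ → Ω}
    (hE : IsPathSystem E) {x t : Ω} {b : Fin n → Ω} (ho : Ortho m x b t) :
    ∃ G Φ, IsChart m x b t G Φ := by
  have hm := h.1
  have harc := fun j => h.exists_arc (ho.1 j) (γ := fun s => E x (b j) s)
    (by
      obtain ⟨K, hK⟩ := hE.lip x (b j)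
      exact hK.continuous.comp continuous_subtype_val)
    (by rw [Set.Icc.coe_zero, hE.zero]) (by rw [Set.Icc.coe_one, hE.one])
    fun c hc c' hc' => ho.chain hm hr j hc hc'
  choose φ ψ hφ hψ hφI hψJ hψφ hφψ hφx hφb hφp hmono using harc
  have hbt : ∀ j y, m x (b j) (m x t y) = m x (b j) y := by
    intro j y
    have h1 : m x t (b j) = b j := ho.mem_int hm j
    rw [hm.swap12 x, hm.swap12 x t, ← hm.assoc, hm.swap12 (b j), hm.swap23 x, h1, hm.swap12]
  refine ⟨fun y j => φ j y, fun r => jn m x t fun j => ψ j (r j), ?_, ?_, ?_, ?_, ?_, ?_, ?_, ?_,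
    ?_, ?_, ?_⟩
  · exact continuous_pi hφ
  · exact (h.continuous_jn x t).comp (continuous_pi fun j => (hψ j).comp (continuous_apply j))
  · exact fun y j => hφI j y
  · exact fun r => jn_mem_int hm ho fun j => hψJ j _
  · intro y hy
    simp only [hψφ]
    exact jn_proj hm ho hy
  · intro r hr
    funext j
    rw [← hφp, proj_jn hm ho (fun j => hψJ j _), hφψ j _ (hr j)]
  · intro y
    funext j
    rw [← hφp, hbt, hφp]
  · intro a c y hy j
    have key : ∀ a c : Ω, m x (b j) a ∈ medInt m x (m x (b j) c) → y ∈ medInt m a c →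
        φ j y ∈ Icc (φ j a) (φ j c) := by
      intro a c hac hy
      have h1 := hm.int_symm (hm.map_int x (b j) hy)
      have h2 := hm.int_trans h1 (hm.int_symm hac)
      have h3 := hm.int_shift h1 (hm.int_symm hac)
      rw [← hφp j a, ← hφp j c, ← hφp j y]
      exact ⟨hmono j _ _ (hm.int_symm h3) (hm.med_mem _ _ _),
        hmono j _ _ (hm.int_symm h2) (hm.med_mem _ _ _)⟩
    rcases ho.chain hm hr j (hm.med_mem x (b j) a) (hm.med_mem x (b j) c) with hac | hac
    · exact Icc_subset_uIcc (key a c hac hy)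
    · exact Icc_subset_uIcc' (key c a hac (hm.int_symm hy))
  · intro y j
    constructor
    · intro hy
      have := hψφ j y
      beta_reduce at hy
      rw [hy, ← hφx j, hψφ, hm.self_outer] at this
      exact this.symm
    · intro hy
      rw [← hφp, hy, hφx]
  · intro y j
    constructor
    · intro hy
      have := hψφ j y
      beta_reduce at hy
      rw [hy, ← hφb j, hψφ, hm.self_right] at this
      exact this.symm
    · intro hy
      rw [← hφp, hy, hφb]
  · intro y z j
    constructor
    · intro hy
      beta_reduce at hy
      rw [← hψφ, hy, hψφ]
    · intro hy
      rw [← hφp j y, hy, hφp]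

variable {x t : Ω} {b : Fin n → Ω} {G : Ω → Fin n → ℝ} {Φ : (Fin n → ℝ) → Ω}

namespace IsChart

theorem G_left (hc : IsChart m x b t G Φ) (hm : IsMedianOp m) : G x = 0 := by
  funext j
  exact (hc.zero_iff x j).2 (hm.self_outer _ _)

theorem Φ_zero (hc : IsChart m x b t G Φ) (hm : IsMedianOp m) : Φ 0 = x := by
  rw [← hc.G_left hm]
  exact hc.ΦG x (hm.left_mem _ _)

theorem G_top (hc : IsChart m x b t G Φ) (hm : IsMedianOp m) (ho : Ortho m x b t) : G t = 1 := by
  funext j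
  exact (hc.one_iff t j).2 ((hm.swap23 _ _ _).trans (ho.mem_int hm j))

theorem Φ_inj (hc : IsChart m x b t G Φ) {r s : Fin n → ℝ} (hr : ∀ j, r j ∈ Icc (0 : ℝ) 1)
    (hs : ∀ j, s j ∈ Icc (0 : ℝ) 1) (h : Φ r = Φ s) : r = s := by
  rw [← hc.GΦ r hr, h, hc.GΦ s hs]

theorem G_inj (hc : IsChart m x b t G Φ) {y z : Ω} (hy : y ∈ medInt m x t) (hz : z ∈ medInt m x t)
    (h : G y = G z) : y = z := by
  rw [← hc.ΦG y hy, h, hc.ΦG z hz]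

/-- Between two points of the cube lie the points with coordinates in between. -/
theorem mem_int (hc : IsChart m x b t G Φ) (hm : IsMedianOp m) {a c y : Ω}
    (ha : a ∈ medInt m x t) (hc' : c ∈ medInt m x t) (hy : y ∈ medInt m x t)
    (h : ∀ j, G y j ∈ uIcc (G a j) (G c j)) : y ∈ medInt m a c := by
  refine hc.G_inj (hm.int_convex ha hc' (hm.med_mem _ _ _)) hy (funext fun j => ?_)
  have h1 := hc.G_int _ _ _ (hm.med_mem a c y) j
  have h2 := hc.G_int _ _ _ (hm.med_mem' a c y) j
  have h3 := hc.G_int _ _ _ (hm.med_mem'' a c y) j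
  have h4 := h j
  simp only [mem_uIcc] at h1 h2 h3 h4
  rcases h1 with h1 | h1 <;> rcases h2 with h2 | h2 <;> rcases h3 with h3 | h3 <;>
    rcases h4 with h4 | h4 <;> linarith [h1.1, h1.2, h2.1, h2.2, h3.1, h3.2, h4.1, h4.2]

end IsChart

end Chart

section Domain

variable {p : ℕ} {T : Fin p → Type*} [∀ i, MetricSpace (T i)]

/-- Replace one coordinate of a point. -/
noncomputable def upd (x : PiLp 1 T) (i : Fin p) (c : T i) : PiLp 1 T :=
  WithLp.toLp 1 (Function.update x i c)

omit [∀ i, MetricSpace (T i)] in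
@[simp] theorem upd_same (x : PiLp 1 T) (i : Fin p) (c : T i) : upd x i c i = c :=
  Function.update_self _ _ _

omit [∀ i, MetricSpace (T i)] in
theorem upd_ne (x : PiLp 1 T) {i j : Fin p} (c : T i) (h : j ≠ i) : upd x i c j = x j :=
  Function.update_of_ne h _ _

theorem dist_upd (x : PiLp 1 T) (i : Fin p) (c c' : T i) :
    dist (upd x i c) (upd x i c') = dist c c' := by
  rw [PiLp.dist_L1, Finset.sum_eq_single i]
  · simp
  · intro j _ hj
    rw [upd_ne _ _ hj, upd_ne _ _ hj, dist_self]
  · simp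

omit [∀ i, MetricSpace (T i)] in
@[simp] theorem upd_eq_self (x : PiLp 1 T) (i : Fin p) : upd x i (x i) = x :=
  PiLp.ext fun j => by
    by_cases h : j = i
    · subst h; simp
    · rw [upd_ne _ _ h]

theorem PiLp.dist_lt_of_forall_le {x y : PiLp 1 T} {r ρ : ℝ} (h : ∀ i, dist (x i) (y i) ≤ r)
    (hr : p * r < ρ) : dist x y < ρ := by
  rw [PiLp.dist_L1]
  refine lt_of_le_of_lt ((Finset.sum_le_card_nsmul _ _ r fun i _ => h i).trans ?_) hr
  simp

variable (hT : ∀ i, IsRTree (T i))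

include hT

theorem exists_near (w z : PiLp 1 T) {r : ℝ} (hr : 0 < r) : ∃ y : PiLp 1 T, y ∈ Box w z ∧
    (∀ i, dist (w i) (y i) ≤ r) ∧ ∀ i, w i ≠ z i → y i ≠ w i ∧ y i ≠ z i := by
  have h1 : ∀ i, ∃ c ∈ Seg (w i) (z i), dist (w i) c = min r (dist (w i) (z i) / 2) := fun i =>
    (hT i).exists_mem_Seg _ _ (le_min hr.le (by positivity))
      ((min_le_right _ _).trans (half_le_self dist_nonneg))
  choose c hc hcd using h1
  refine ⟨WithLp.toLp 1 c, hc, fun i => (hcd i).le.trans (min_le_left _ _), fun i hi => ?_⟩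
  have hpos := dist_pos.2 hi
  have h2 := hcd i
  constructor
  · rintro (e : c i = w i)
    rw [e, dist_self] at h2
    have : 0 < min r (dist (w i) (z i) / 2) := lt_min hr (by linarith)
    linarith
  · rintro (e : c i = z i)
    rw [e] at h2
    linarith [min_le_right r (dist (w i) (z i) / 2)]

theorem Box_subset {a b c d : PiLp 1 T} (hc : c ∈ Box a b) (hd : d ∈ Box a b) :
    Box c d ⊆ Box a b := by
  intro y hy
  rw [← mem_medInt_pmed hT] at *
  exact (pmed_lipMed hT).1.int_convex hc hd hy

variable {m : PiLp 1 T → PiLp 1 T → PiLp 1 T → PiLp 1 T}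

/-- If a box around an interior point `u` of a cube is locally contained in the cube, then the cube
is locally contained in the box. -/
theorem IsChart.exists_ball_subset_Box {x t : PiLp 1 T} {b : Fin p → PiLp 1 T}
    {G : PiLp 1 T → Fin p → ℝ} {Φ : (Fin p → ℝ) → PiLp 1 T} (hC : IsChart m x b t G Φ)
    {u a c : PiLp 1 T} (hu : u ∈ medInt m x t) (hG : ∀ j, G u j ∈ Ioo (0 : ℝ) 1)
    (hua : u ∈ Box a c) (ha : ∀ i, u i ≠ a i) (hc : ∀ i, u i ≠ c i) {ρ : ℝ} (hρ : 0 < ρ)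
    (hsub : ∀ y ∈ Box a c, dist y u < ρ → y ∈ medInt m x t) :
    ∃ ε > 0, ∀ y ∈ medInt m x t, dist y u < ε → y ∈ Box a c := by
  -- a small box around `u` inside the cube
  obtain ⟨r, hr, hrρ⟩ : ∃ r > 0, p * (2 * r) < ρ := by
    refine ⟨ρ / (2 * (p + 1)), by positivity, ?_⟩
    have : p * (2 * (ρ / (2 * ((p : ℝ) + 1)))) = ρ * (p / (p + 1)) := by field_simp
    rw [this]
    refine mul_lt_of_lt_one_right hρ ((div_lt_one (by positivity)).2 (by linarith))
  obtain ⟨a', ha', had, han⟩ := exists_near hT u a hr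
  obtain ⟨c', hc', hcd, hcn⟩ := exists_near hT u c hr
  have hua' : u ∈ Box a' c' := fun i => Seg_symm (Seg_shift
    (Seg_symm (Seg_shift (hua i) (Seg_symm (ha' i)))) (Seg_symm (hc' i)))
  have hsub' : Box a' c' ⊆ Box a c := by
    refine Box_subset hT (fun i => ?_) fun i => ?_
    · exact Seg_trans (hua i) (Seg_symm (ha' i))
    · exact Seg_symm (Seg_trans (Seg_symm (hua i)) (Seg_symm (hc' i)))
  have hmem : ∀ y ∈ Box a' c', y ∈ medInt m x t := by
    refine fun y hy => hsub y (hsub' hy) (PiLp.dist_lt_of_forall_le (fun i => ?_) hrρ)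
    have h1 := hua' i
    have h2 := hy i
    rw [mem_Seg] at h1 h2
    rw [(hT i).dist_of_mem_Seg (hy i) (hua' i), abs_le]
    have h3 := had i
    have h4 := hcd i
    rw [dist_comm] at h3
    have h5 := dist_nonneg (x := a' i) (y := y i)
    have h6 := dist_nonneg (x := y i) (y := c' i)
    constructor <;> linarith
  obtain ⟨κ, hκ, hκ0, hκ1, -, K, hK⟩ := exists_flat hT a' c'
  set ζ : (Fin p → unitInterval) → PiLp 1 T := fun s => κ fun i => s i with hζ
  have hζc : Continuous ζ := hK.continuous.comp (by fun_prop)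
  have hζ0 : ∀ s i, s i = 0 → ζ s i = a' i := fun s i hs => hκ0 _ i (by simp [hs])
  have hζ1 : ∀ s i, s i = 1 → ζ s i = c' i := fun s i hs => hκ1 _ i (by simp [hs])
  -- the boundary of the box stays away from `u`
  set g0 := G u with hg0
  have hbd : IsCompact {s : Fin p → unitInterval | ∃ i, s i = 0 ∨ s i = 1} := by
    have : {s : Fin p → unitInterval | ∃ i, s i = 0 ∨ s i = 1} =
        ⋃ i, ({s | s i = 0} ∪ {s | s i = 1}) := by ext; simp
    rw [this]
    exact (isClosed_iUnion_of_finite fun i =>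
      (isClosed_eq (continuous_apply i) continuous_const).union
        (isClosed_eq (continuous_apply i) continuous_const)).isCompact
  obtain ⟨R', hR', hR'b⟩ := hbd.exists_forall_le' (a := 0)
    (f := fun s => dist (G (ζ s)) g0) ((hC.contG.comp hζc).dist continuous_const).continuousOn
    (by
      rintro s ⟨i, hi⟩
      refine dist_pos.2 fun e => ?_
      have hs : ζ s = u := hC.G_inj (hmem _ (hκ _)) hu e
      rcases hi with hi | hi
      · exact (han i (ha i)).1 (by rw [← hζ0 s i hi, hs])
      · exact (hcn i (hc i)).1 (by rw [← hζ1 s i hi, hs]))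
  obtain ⟨R'', hR'', hR''b⟩ : ∃ R > 0, ∀ j, R ≤ g0 j ∧ R ≤ 1 - g0 j := by
    have : ∀ j, ∃ R > 0, R ≤ g0 j ∧ R ≤ 1 - g0 j := fun j =>
      ⟨min (g0 j) (1 - g0 j), lt_min (hG j).1 (by linarith [(hG j).2]), min_le_left _ _,
        min_le_right _ _⟩
    choose f hf hf1 using this
    rcases isEmpty_or_nonempty (Fin p) with he | he
    · exact ⟨1, one_pos, fun j => he.elim j⟩
    · obtain ⟨j0, hj0⟩ := Finite.exists_min f
      exact ⟨f j0, hf j0, fun j => ⟨(hj0 j).trans (hf1 j).1, (hj0 j).trans (hf1 j).2⟩⟩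
  set R := min R' R'' / 2 with hRdef
  have hR : 0 < R := by have := lt_min hR' hR''; positivity
  have hRR' : 2 * R ≤ R' := by have := min_le_left R' R''; linarith
  have hRR'' : 2 * R ≤ R'' := by have := min_le_right R' R''; linarith
  obtain ⟨ε, hε, hεR⟩ := Metric.continuous_iff.1 hC.contG u R hR
  refine ⟨ε, hε, fun y hy hyu => hsub' ?_⟩
  have hg1 := hεR y hyu
  set g1 := G y with hg1d
  -- push the cube along the vector from `g1` to `g0`
  let μ : (Fin p → ℝ) → ℝ := fun g => max 0 (1 - dist g g1 / R)
  let Θ : (Fin p → ℝ) → Fin p → ℝ := fun g => g + μ g • (g0 - g1)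
  have hμ : Continuous μ := by fun_prop
  have hΘ : Continuous Θ := by fun_prop
  have hμ0 : ∀ g, R ≤ dist g g1 → Θ g = g := by
    intro g hg
    have : μ g = 0 := max_eq_left (by rw [sub_nonpos, one_le_div hR]; exact hg)
    simp [Θ, this]
  have hμ1 : ∀ g, dist g g1 < R → μ g = 1 - dist g g1 / R := fun g hg =>
    max_eq_right (by rw [sub_nonneg, div_le_one hR]; exact hg.le)
  have hΘI : ∀ z j, Θ (G z) j ∈ Icc (0 : ℝ) 1 := by
    intro z j
    rcases le_or_gt R (dist (G z) g1) with hle | hlt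
    · rw [hμ0 _ hle]; exact hC.memG z j
    · have h1 : |G z j - g1 j| < R := lt_of_le_of_lt (dist_le_pi_dist (G z) g1 j) hlt
      have h2 : |g1 j - g0 j| < R := lt_of_le_of_lt (dist_le_pi_dist g1 g0 j) hg1
      have hmu : 0 ≤ μ (G z) ∧ μ (G z) ≤ 1 := by
        refine ⟨le_max_left _ _, max_le zero_le_one ?_⟩
        have : 0 ≤ dist (G z) g1 / R := by positivity
        linarith
      have h3 : |Θ (G z) j - g0 j| ≤ 2 * R := by
        have e : Θ (G z) j - g0 j = (G z j - g1 j) + (1 - μ (G z)) * (g1 j - g0 j) := by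
          simp only [Θ, Pi.add_apply, Pi.smul_apply, Pi.sub_apply, smul_eq_mul]; ring
        rw [e]
        refine (abs_add_le _ _).trans ?_
        rw [abs_mul, abs_of_nonneg (by linarith [hmu.2] : 0 ≤ 1 - μ (G z))]
        nlinarith [abs_nonneg (g1 j - g0 j), hmu.1, hmu.2]
      have h4 := abs_le.1 h3
      have h5 := hR''b j
      constructor <;> linarith
  have hΘinj : ∀ g, Θ g = g0 → g = g1 := by
    intro g hg
    rcases le_or_gt R (dist g g1) with hle | hlt
    · rw [hμ0 _ hle] at hg
      rw [hg, dist_comm] at hle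
      linarith
    · have e : g - g1 = (1 - μ g) • (g0 - g1) := by
        funext j
        have hg' : g j + μ g * (g0 j - g1 j) = g0 j := congrFun hg j
        simp only [Pi.sub_apply, Pi.smul_apply, smul_eq_mul]
        linarith
      have h1 : dist g g1 = dist g g1 / R * dist g0 g1 := by
        rw [hμ1 g hlt, sub_sub_cancel] at e
        conv_lhs => rw [dist_eq_norm, e, norm_smul, Real.norm_of_nonneg (by positivity),
          ← dist_eq_norm]
      by_contra hne
      have h2 := dist_pos.2 hne
      rw [dist_comm g0] at h1
      rw [div_mul_eq_mul_div, eq_div_iff hR.ne'] at h1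
      have := mul_left_cancel₀ h2.ne' h1
      linarith
  have hbdry : ∀ s, (∃ i, s i = 0 ∨ s i = 1) → Φ (Θ (G (ζ s))) = ζ s := by
    intro s hs
    have h1 := hR'b s hs
    have h2 := dist_triangle (G (ζ s)) g1 g0
    rw [hμ0 _ (by linarith), hC.ΦG _ (hmem _ (hκ _))]
  obtain ⟨s, hs⟩ := exists_eq_of_boundary hT hua' (g := fun s => Φ (Θ (G (ζ s))))
    (hC.contΦ.comp (hΘ.comp (hC.contG.comp hζc))) (η := 0)
    (fun s i hi => by rw [hbdry s ⟨i, Or.inl hi⟩, hζ0 s i hi, dist_self])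
    (fun s i hi => by rw [hbdry s ⟨i, Or.inr hi⟩, hζ1 s i hi, dist_self])
    (fun i => dist_pos.2 (han i (ha i)).1) (fun i => dist_pos.2 (hcn i (hc i)).1)
  have h1 : Θ (G (ζ s)) = g0 := by
    rw [← hC.GΦ _ (hΘI (ζ s)), hs]
  have h2 := hΘinj _ h1
  have h3 : ζ s = y := hC.G_inj (hmem _ (hκ _)) hy h2
  rw [← h3]
  exact hκ _

end Domain

section Facet

variable {Ω : Type*} [MetricSpace Ω] {m : Ω → Ω → Ω → Ω} {L : ℝ} {q : ℕ}

/-- Facets through the corner of a cube are Lipschitz images of lower-dimensional cubes. -/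
theorem IsChart.exists_facet (h : LipMed m L) {E : Ω → Ω → ℝ → Ω} (hE : IsPathSystem E)
    {x t : Ω} {b : Fin (q + 1) → Ω} {G : Ω → Fin (q + 1) → ℝ} {Φ : (Fin (q + 1) → ℝ) → Ω}
    (ho : Ortho m x b t) (hC : IsChart m x b t G Φ) (j : Fin (q + 1)) :
    ∃ f : (Fin q → unitInterval) → Ω, (∃ K : NNReal, LipschitzWith K f) ∧
      ∀ y ∈ medInt m x t, G y j = 0 → y ∈ range f := by
  have hm := h.1
  obtain ⟨K, hK⟩ := h.exists_slabMap_lipschitz hE x x b t b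
  refine ⟨fun r => slabMap m E x x b t b (Fin.insertNth (α := fun _ => unitInterval) j 0 r),
    ⟨K * 1, hK.comp (LipschitzWith.of_dist_le_mul fun r r' => ?_)⟩, fun y hy hyj => ?_⟩
  · rw [Fin.dist_insertNth_insertNth]
    simp
  have h1 : ∀ k, ∃ s : unitInterval, m x (b k) (E x (b k) s) = m x (b k) y := by
    intro k
    obtain ⟨K', hK'⟩ := hE.lip x (b k)
    have hc : Continuous fun s : unitInterval => G (E x (b k) s) k :=
      (continuous_apply k).comp (hC.contG.comp (hK'.continuous.comp continuous_subtype_val))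
    have := mem_range_of_exists_le_of_exists_ge hc (c := G y k) ⟨0, by
      rw [Set.Icc.coe_zero, hE.zero, hC.G_left hm]; exact (hC.memG y k).1⟩ ⟨1, by
      rw [Set.Icc.coe_one, hE.one, (hC.one_iff (b k) k).2 (hm.self_right _ _)]
      exact (hC.memG y k).2⟩
    obtain ⟨s, hs⟩ := this
    exact ⟨s, (hC.eq_iff _ _ _).1 hs⟩
  choose s hs using h1
  refine ⟨fun k => s (j.succAbove k), ?_⟩
  have h2 : (fun k => m x (b k) (E x (b k)
      ((Fin.insertNth (α := fun _ => unitInterval) j 0 fun k => s (j.succAbove k)) k))) =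
      fun k => m x (b k) y := by
    funext k
    rcases Fin.eq_self_or_eq_succAbove j k with rfl | ⟨k, rfl⟩
    · rw [Fin.insertNth_apply_same, Set.Icc.coe_zero, hE.zero, (hC.zero_iff y k).1 hyj,
        hm.self_outer]
    · rw [Fin.insertNth_apply_succAbove, hs]
  simp only [slabMap]
  rw [h2, jn_proj hm ho hy]

end Facet

section Avoid

variable {p : ℕ} {T : Fin p → Type*} [∀ i, MetricSpace (T i)] (hT : ∀ i, IsRTree (T i))
  {m : PiLp 1 T → PiLp 1 T → PiLp 1 T → PiLp 1 T} {L : ℝ}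

include hT

theorem LipMed.not_ortho (h : LipMed m L) (x t : PiLp 1 T) (b : Fin (p + 1) → PiLp 1 T) :
    ¬ Ortho m x b t := fun ho => by
  have := h.card_le hT ho
  omega

theorem LipMed.exists_chart_pi (h : LipMed m L) {x t : PiLp 1 T} {b : Fin p → PiLp 1 T}
    (ho : Ortho m x b t) : ∃ G Φ, IsChart m x b t G Φ := by
  obtain ⟨E, hE⟩ := exists_pathSystem hT
  exact h.exists_chart (h.not_ortho hT) hE ho

/-- A point of a box close to a corner avoids the facets of countably many cubes. -/
theorem LipMed.exists_avoid (h : LipMed m L) (hp : 1 ≤ p) {ι : Type*} [Countable ι]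
    {w z : PiLp 1 T} {b : ι → Fin p → PiLp 1 T} {t : ι → PiLp 1 T}
    (ho : ∀ q, Ortho m w (b q) (t q)) (hz : ∀ i, z i ≠ w i) {ρ : ℝ} (hρ : 0 < ρ) :
    ∃ y ∈ Box w z, dist y w < ρ ∧ (∀ i, y i ≠ w i) ∧
      ∀ q j, y ∈ medInt m w (t q) → m w (b q j) y ≠ w := by
  obtain ⟨d, rfl⟩ : ∃ d, p = d + 1 := ⟨p - 1, by omega⟩
  obtain ⟨E, hE⟩ := exists_pathSystem hT
  choose G Φ hC using fun q => h.exists_chart_pi hT (ho q)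
  choose f hf hfr using fun qj : ι × Fin (d + 1) => (hC qj.1).exists_facet h hE (ho qj.1) qj.2
  let F : PiLp 1 T → Fin (d + 1) → ℝ := fun y i => dist (w i) (y i)
  have hF : LipschitzWith 1 F := by
    refine LipschitzWith.of_dist_le_mul fun y y' => ?_
    rw [NNReal.coe_one, one_mul]
    refine (dist_pi_le_iff dist_nonneg).2 fun i => ?_
    refine le_trans ?_ (PiLp.dist_apply_le_L1 y y' i)
    change |dist (w i) (y i) - dist (w i) (y' i)| ≤ _
    rw [dist_comm (w i), dist_comm (w i)]
    exact abs_dist_sub_le _ _ _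
  have hD := dense_compl_image_iUnion_range hp (k := fun _ : ι × Fin (d + 1) => d)
    (fun _ => Nat.lt_succ_self d) hf hF
  let U : Set (Fin (d + 1) → ℝ) := Set.pi univ fun i =>
    Ioo 0 (min (ρ / ((d + 1 : ℕ) + 1)) (dist (w i) (z i)))
  have hU : IsOpen U := isOpen_set_pi finite_univ fun i _ => isOpen_Ioo
  have hpos : ∀ i, 0 < min (ρ / ((d + 1 : ℕ) + 1)) (dist (w i) (z i)) := fun i =>
    lt_min (by positivity) (dist_pos.2 (hz i).symm)
  have hUn : U.Nonempty := ⟨fun i => min (ρ / ((d + 1 : ℕ) + 1)) (dist (w i) (z i)) / 2,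
    fun i _ => ⟨half_pos (hpos i), half_lt_self (hpos i)⟩⟩
  obtain ⟨v, hvU, hvD⟩ := hD.inter_open_nonempty U hU hUn
  have h1 : ∀ i, ∃ c ∈ Seg (w i) (z i), dist (w i) c = v i := fun i =>
    (hT i).exists_mem_Seg _ _ (hvU i trivial).1.le ((hvU i trivial).2.le.trans (min_le_right _ _))
  choose c hc hcd using h1
  refine ⟨WithLp.toLp 1 c, hc, ?_, fun i e => ?_, fun q j hy e => hvD ?_⟩
  · refine PiLp.dist_lt_of_forall_le (r := ρ / ((d + 1 : ℕ) + 1)) (fun i => ?_) ?_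
    · rw [dist_comm]
      change dist (w i) (c i) ≤ _
      rw [hcd i]
      exact (hvU i trivial).2.le.trans (min_le_left _ _)
    · rw [mul_div_assoc', div_lt_iff₀ (by positivity)]
      linarith
  · have := (hvU i trivial).1
    change c i = w i at e
    rw [← hcd i, e, dist_self] at this
    exact lt_irrefl _ this
  · refine ⟨WithLp.toLp 1 c, ?_, funext hcd⟩
    exact mem_iUnion.2 ⟨(q, j), hfr (q, j) _ hy (((hC q).zero_iff _ _).2 e)⟩

end Avoid

section Corner

variable {Ω : Type*} {m : Ω → Ω → Ω → Ω} {n : ℕ} {x t : Ω} {b : Fin n → Ω}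

/-- A cube with the same corner and a smaller top. -/
theorem Ortho.sub (hm : IsMedianOp m) (ho : Ortho m x b t) {y : Ω} (hy : y ∈ medInt m x t)
    (hne : ∀ j, m x (b j) y ≠ x) : Ortho m x (fun j => m x (b j) y) y := by
  refine ⟨hne, fun h hh hx => ⟨?_, fun i j hi hj => ?_⟩⟩
  · conv_lhs => rw [← jn_proj hm ho hy]
    exact jn_mem ho (fun j => hm.med_mem _ _ _) hh hx
  · exact (ho.2 h hh hx).2 i j (hh.mem_of_int (hm.med_mem _ _ _) hx hi)
      (hh.mem_of_int (hm.med_mem _ _ _) hx hj)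

theorem IsMedianOp.med_med_of_mem (hm : IsMedianOp m) {x y u : Ω} (c : Ω)
    (hu : u ∈ medInt m x y) : m x (m x c y) u = m x c u := by
  have h1 : m x y u = u := hu
  have h2 := hm.assoc c y u x
  rw [hm.swap12 x (m x c y) u, hm.swap12 x c y, h2, hm.swap12 y x u, h1, hm.swap12]

theorem MCube.corner_eq (hm : IsMedianOp m) {M : Finset Ω} {o : Ω} (hM : MCube m M o x b t)
    (ho : o ∈ medInt m x t) : x = o := by
  refine hm.ext_half fun k hk hx => ?_
  by_contra hok
  have hk' := hk.compl
  have hx' : x ∉ kᶜ := fun h => h hx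
  have ht := hk'.mem_of_int ho hx' hok
  obtain ⟨j, hj⟩ := (hM.2.2.2.1.2 _ hk' hx').1.1 ht
  exact hx' (hk'.int (hM.2.2.2.2.2 j) hok hj)

theorem MCube.top_eq (hm : IsMedianOp m) {M : Finset Ω} {o : Ω} (hM : MCube m M o x b t)
    {b' : Fin n → Ω} {t' : Ω} (hM' : MCube m M o x b' t') {u : Ω} (hu' : u ∈ medInt m x t')
    (hne : ∀ j, m x (b j) u ≠ x) : t = t' := by
  have ho := hM.2.2.2.1
  have ho' := hM'.2.2.2.1
  have h1 : ∀ j, ∃ k, b j = b' k := by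
    intro j
    obtain ⟨h, hh, hc, hx⟩ := hm.exists_half (hne j)
    have hb := hh.mem_of_int (hm.med_mem x (b j) u) hx hc
    have hu := hh.mem_of_int (hm.med_mem'' x (b j) u) hx hc
    obtain ⟨k, hk⟩ := (ho'.2 h hh hx).1.1 (hh.mem_of_int hu' hx hu)
    have hmem : m x (b j) (b' k) ∈ h := by
      rw [hh]; tauto
    refine ⟨k, ?_⟩
    have e1 : m x (b j) (b' k) = b j :=
      (hM.2.2.2.2.1 j _ (hM'.2.1 k)).resolve_left fun e => hx (e ▸ hmem)
    have e2 : m x (b' k) (b j) = b' k := by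
      refine (hM'.2.2.2.2.1 k _ (hM.2.1 j)).resolve_left fun e => hx ?_
      rw [hm.swap23] at e
      exact e ▸ hmem
    rw [← e1, hm.swap23, e2]
  choose f hf using h1
  have hinj : Function.Injective f := by
    intro i j hij
    have e : b i = b j := by rw [hf, hf, hij]
    obtain ⟨h, hh, hc, hx⟩ := hm.exists_half (ho.1 i)
    exact (ho.2 h hh hx).2 i j hc (e ▸ hc)
  have hsurj := Finite.injective_iff_surjective.1 hinj
  refine hm.ext_half_off x fun k hk hx => ?_
  rw [(ho.2 k hk hx).1, (ho'.2 k hk hx).1]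
  constructor
  · rintro ⟨j, hj⟩
    exact ⟨f j, hf j ▸ hj⟩
  · rintro ⟨j, hj⟩
    obtain ⟨i, rfl⟩ := hsurj j
    exact ⟨i, (hf i).symm ▸ hj⟩

end Corner

theorem exists_pos_le_forall {ι : Type*} [Finite ι] (f : ι → ℝ) (hf : ∀ i, 0 < f i) :
    ∃ ε > 0, ∀ i, ε ≤ f i := by
  cases isEmpty_or_nonempty ι
  · exact ⟨1, one_pos, fun i => isEmptyElim i⟩
  · obtain ⟨i, hi⟩ := Finite.exists_min f
    exact ⟨f i, hf i, hi⟩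

section Local

variable {p : ℕ} {T : Fin p → Type*} [∀ i, MetricSpace (T i)] (hT : ∀ i, IsRTree (T i))
  {m : PiLp 1 T → PiLp 1 T → PiLp 1 T → PiLp 1 T} {L : ℝ}

include hT

/-- Near an interior point of finitely many boxes, the boxes are covered by the cubes with
corner at that point of a finite subalgebra. -/
theorem LipMed.exists_local_cover (h : LipMed m L) (hp : 1 ≤ p) {κ : Type*} [Finite κ]
    (a c : κ → PiLp 1 T) {w : PiLp 1 T} (hw : ∀ k, w ∈ Box (a k) (c k))
    (ha : ∀ k i, w i ≠ a k i) (hc : ∀ k i, w i ≠ c k i) :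
    ∃ M : Finset (PiLp 1 T), ∃ ρ > 0, ∀ k, ∀ q ∈ Box (a k) (c k), dist q w < ρ →
      (∀ i, q i ≠ a k i ∧ q i ≠ c k i) ∧ ∃ (b : Fin p → PiLp 1 T) (t : PiLp 1 T),
        MCube m M w w b t ∧ q ∈ medInt m w t := by
  classical
  have hm := h.1
  obtain ⟨η, hη, hηle⟩ := exists_pos_le_forall
    (fun ki : κ × Fin p => min (dist (a ki.1 ki.2) (w ki.2)) (dist (c ki.1 ki.2) (w ki.2)) / 2)
    fun ki => half_pos (lt_min (dist_pos.2 (ha _ _).symm) (dist_pos.2 (hc _ _).symm))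
  have hac : ∀ k i, a k i ≠ c k i := by
    intro k i e
    refine ha k i (Seg_self ?_)
    have := hw k i
    rwa [← e] at this
  choose A hA using fun k => h.exists_cover hT hp (a k) (c k) w (hac k) hη
  obtain ⟨M, hAM, hM⟩ := hm.exists_finite_subalgebra
    (A := (⋃ k, (A k : Set (PiLp 1 T))) ∪ {w})
    ((Set.finite_iUnion fun k => (A k).finite_toSet).union (finite_singleton w))
  have hwM : w ∈ M := hAM (Or.inr rfl)
  have h1 : ∀ xt : M × M, ∃ r > 0, w ∉ medInt m xt.1 (xt.2 : PiLp 1 T) →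
      ∀ q ∈ medInt m xt.1 (xt.2 : PiLp 1 T), r ≤ dist q w := by
    intro xt
    by_cases hx : w ∈ medInt m xt.1 (xt.2 : PiLp 1 T)
    · exact ⟨1, one_pos, fun h => absurd hx h⟩
    · obtain ⟨r, hr, hrs⟩ := Metric.isOpen_iff.1 (h.isClosed_medInt xt.1 xt.2).isOpen_compl w hx
      refine ⟨r, hr, fun _ q hq => ?_⟩
      by_contra hlt
      exact hrs (mem_ball.2 (not_le.1 hlt)) hq
  choose r hr hrs using h1
  obtain ⟨r₀, hr₀, hr₀le⟩ := exists_pos_le_forall r hr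
  refine ⟨M, min η r₀, lt_min hη hr₀, fun k q hq hqw => ?_⟩
  have hfar : ∀ i, η < dist (a k i) (q i) ∧ η < dist (c k i) (q i) := by
    intro i
    have h2 := hηle (k, i)
    have h3 : dist (q i) (w i) < η :=
      (PiLp.dist_apply_le_L1 q w i).trans_lt (hqw.trans_le (min_le_left _ _))
    have h4 := dist_triangle (a k i) (q i) (w i)
    have h5 := dist_triangle (c k i) (q i) (w i)
    have h6 := min_le_left (dist (a k i) (w i)) (dist (c k i) (w i))
    have h7 := min_le_right (dist (a k i) (w i)) (dist (c k i) (w i))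
    dsimp only at h2
    constructor <;> linarith
  obtain ⟨x, b, t, hMC, hqt⟩ := hA k M hM
    (fun y hy => hAM (Or.inl (mem_iUnion.2 ⟨k, hy⟩))) hwM q hq (fun i => (hfar i).1)
    fun i => (hfar i).2
  refine ⟨fun i => ⟨fun e => ?_, fun e => ?_⟩, ?_⟩
  · have := (hfar i).1
    rw [e, dist_self] at this
    linarith
  · have := (hfar i).2
    rw [e, dist_self] at this
    linarith
  have hwx : w ∈ medInt m x t := by
    by_contra hn
    have h2 := hrs (⟨x, hMC.1⟩, ⟨t, hMC.2.2.1⟩) hn q hqt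
    have h3 := hr₀le (⟨x, hMC.1⟩, ⟨t, hMC.2.2.1⟩)
    have := min_le_right η r₀
    linarith
  obtain rfl := hMC.corner_eq hm hwx
  exact ⟨b, t, hMC, hqt⟩

end Local

theorem eq_of_mem_Seg_of_mem_Seg {T : Type*} [MetricSpace T] {a b w y : T} (h : w ∈ Seg a b)
    (ha : y ∈ Seg w a) (hb : y ∈ Seg w b) : y = w := by
  rw [mem_Seg] at *
  have h1 := dist_triangle a y b
  rw [dist_comm a w] at h
  rw [dist_comm a y] at h1
  rw [eq_comm, ← dist_eq_zero]
  linarith [dist_nonneg (x := w) (y := y)]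

theorem IsRTree.mem_Seg_of_branches {T : Type*} [MetricSpace T] (hT : IsRTree T) {w z b c y : T}
    (hb : w ∈ Seg z b) (hbc : w ∈ Seg b c) (hyb : y ∈ Seg z b)
    (hyc : y ∈ Seg z c) : y ∈ Seg w z := by
  rcases le_total (dist z y) (dist z w) with hle | hle
  · exact Seg_symm (hT.mem_Seg_of_le hyb hb hle)
  · have hw := hT.mem_Seg_of_le hb hyb hle
    have : y = w := eq_of_mem_Seg_of_mem_Seg hbc (Seg_shift hyb hw) (Seg_shift hyc hw)
    rw [this]
    exact left_mem_Seg _ _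

theorem LipMed.exists_pos_mem_of_near {Ω : Type*} [MetricSpace Ω] {m : Ω → Ω → Ω → Ω} {L : ℝ}
    (h : LipMed m L) (M : Finset Ω) (w u : Ω) : ∃ δ > 0, ∀ t ∈ M, ∀ y ∈ medInt m w t,
      dist y u < δ → u ∈ medInt m w t := by
  have h1 : ∀ t : M, ∃ r > 0, ∀ y ∈ medInt m w t, dist y u < r → u ∈ medInt m w t := by
    intro t
    by_cases hx : u ∈ medInt m w t
    · exact ⟨1, one_pos, fun _ _ _ => hx⟩
    · obtain ⟨r, hr, hrs⟩ := Metric.isOpen_iff.1 (h.isClosed_medInt w t).isOpen_compl u hx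
      exact ⟨r, hr, fun q hq hlt => absurd hq (hrs (mem_ball.2 hlt))⟩
  choose r hr hrs using h1
  obtain ⟨δ, hδ, hle⟩ := exists_pos_le_forall r hr
  exact ⟨δ, hδ, fun t ht y hy hd => hrs ⟨t, ht⟩ y hy (hd.trans_le (hle _))⟩

section Corner

variable {p : ℕ} {T : Fin p → Type*} [∀ i, MetricSpace (T i)] (hT : ∀ i, IsRTree (T i))
  {m : PiLp 1 T → PiLp 1 T → PiLp 1 T → PiLp 1 T} {L : ℝ}

include hT in
/-- A box containing one point of the open corner of a cube contains the whole corner. -/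
theorem IsChart.corner_subset_Box {x t : PiLp 1 T} {b : Fin p → PiLp 1 T}
    {G : PiLp 1 T → Fin p → ℝ} {Φ : (Fin p → ℝ) → PiLp 1 T} (hC : IsChart m x b t G Φ)
    {a c : PiLp 1 T} {ε : ℝ} (hε : 0 < ε) (hε1 : ε ≤ 1)
    (hloc : ∀ r : Fin p → ℝ, (∀ j, r j ∈ Ioo 0 ε) → Φ r ∈ Box a c →
      (∀ i, Φ r i ≠ a i ∧ Φ r i ≠ c i) ∧ ∃ δ > 0, ∀ y ∈ Box a c, dist y (Φ r) < δ → y ∈ medInt m x t)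
    {r₀ : Fin p → ℝ} (hr₀ : ∀ j, r₀ j ∈ Ioo 0 ε) (h₀ : Φ r₀ ∈ Box a c) :
    ∀ r : Fin p → ℝ, (∀ j, r j ∈ Icc 0 ε) → Φ r ∈ Box a c := by
  let O : Set (Fin p → ℝ) := Set.pi univ fun _ => Ioo 0 ε
  have hO : IsPreconnected O := (convex_pi fun _ _ => convex_Ioo _ _).isPreconnected
  have hcl : IsClosed (Φ ⁻¹' Box a c) := (isClosed_Box a c).preimage hC.contΦ
  have hinterior : ∀ r ∈ O, Φ r ∈ Box a c → r ∈ interior (Φ ⁻¹' Box a c) := by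
    intro r hr hrB
    obtain ⟨hne, δ, hδ, hsub⟩ := hloc r (fun j => hr j trivial) hrB
    have hGr : G (Φ r) = r := hC.GΦ r fun j =>
      ⟨(hr j trivial).1.le, (hr j trivial).2.le.trans hε1⟩
    obtain ⟨η, hη, hηs⟩ := hC.exists_ball_subset_Box hT (hC.memΦ r)
      (fun j => by rw [hGr]; exact ⟨(hr j trivial).1, (hr j trivial).2.trans_le hε1⟩)
      hrB (fun i => (hne i).1) (fun i => (hne i).2) hδ hsub
    rw [mem_interior_iff_mem_nhds]
    filter_upwards [hC.contΦ.continuousAt.preimage_mem_nhds (ball_mem_nhds (Φ r) hη)] with r' hr'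
    exact hηs _ (hC.memΦ r') hr'
  have hsub : O ⊆ interior (Φ ⁻¹' Box a c) := by
    refine hO.subset_of_closure_inter_subset isOpen_interior
      ⟨r₀, fun j _ => hr₀ j, hinterior r₀ (fun j _ => hr₀ j) h₀⟩ ?_
    rintro r ⟨hr, hrO⟩
    exact hinterior r hrO (closure_minimal interior_subset hcl hr)
  intro r hr
  have : r ∈ closure O := by
    rw [closure_pi_set]
    intro j _
    rw [closure_Ioo hε.ne]
    exact hr j
  exact closure_minimal (hsub.trans interior_subset) hcl this

include hT in
/-- In a product of furry trees, every direction at a point contains a cube of the median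
operator which is open in the corresponding box. -/
theorem LipMed.exists_corner (hF : ∀ i, Furry (T i)) (h : LipMed m L) (hp : 1 ≤ p)
    (w z : PiLp 1 T) (hz : ∀ i, z i ≠ w i) :
    ∃ (b : Fin p → PiLp 1 T) (t : PiLp 1 T), Ortho m w b t ∧ medInt m w t ⊆ Box w z ∧
      ∀ u ∈ medInt m w t, (∀ j, m w (b j) u ≠ w) → (∀ j, m w (b j) u ≠ b j) →
        (∀ i, u i ≠ w i ∧ u i ≠ z i) ∧ ∃ δ > 0, ∀ y ∈ Box w z, dist y u < δ → y ∈ medInt m w t := by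
  classical
  have hm := h.1
  choose β δ hβw hδw hβ hδ hβδ using fun i => (hT i).exists_branches (hF i) (w i) (z i)
  let c : Option (Fin p) → PiLp 1 T := fun k =>
    k.elim (WithLp.toLp 1 β) fun i => upd (WithLp.toLp 1 β) i (δ i)
  have hcw : ∀ k i, w i ≠ c k i ∧ w i ∈ Seg (z i) (c k i) := by
    rintro (_ | k) i
    · exact ⟨(hβw i).symm, hβ i⟩
    · by_cases hik : i = k
      · subst hik
        simp only [c, Option.elim_some, upd_same]
        exact ⟨(hδw i).symm, hδ i⟩
      · simp only [c, Option.elim_some, upd_ne _ _ hik]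
        exact ⟨(hβw i).symm, hβ i⟩
  have hwz : ∀ k, Box w z ⊆ Box z (c k) := fun k =>
    Box_subset hT (fun i => (hcw k i).2) fun i => left_mem_Seg _ _
  have hinter : ∀ y, (∀ k, y ∈ Box z (c k)) → y ∈ Box w z := by
    intro y hy i
    have h2 := hy (some i) i
    simp only [c, Option.elim_some, upd_same] at h2
    exact (hT i).mem_Seg_of_branches (hβ i) (hβδ i) (hy none i) h2
  obtain ⟨M, ρ, hρ, hM⟩ := h.exists_local_cover hT hp (fun _ => z) c
    (fun k i => (hcw k i).2) (fun _ i => (hz i).symm) fun k i => (hcw k i).1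
  let ι := {q : (Fin p → M) × M // MCube m M w w (fun j => (q.1 j : PiLp 1 T)) (q.2 : PiLp 1 T)}
  let b : ι → Fin p → PiLp 1 T := fun q j => q.1.1 j
  let t : ι → PiLp 1 T := fun q => q.1.2
  have hcube : ∀ q : ι, MCube m M w w (b q) (t q) := fun q => q.2
  have ho : ∀ q, Ortho m w (b q) (t q) := fun q => (hcube q).2.2.2.1
  choose G Φ hC using fun q => h.exists_chart_pi hT (ho q)
  -- cubes through an interior point of a cube
  have hnear : ∀ (q : ι) (u : PiLp 1 T), dist u w < ρ → (∀ j, 0 < G q u j) →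
      u ∈ medInt m w (t q) → ∀ k, ∃ δ > 0, ∀ y ∈ Box z (c k), dist y u < δ →
        y ∈ medInt m w (t q) := by
    intro q u huw hG hu k
    obtain ⟨r, hr, hrs⟩ := h.exists_pos_mem_of_near M w u
    refine ⟨min r (ρ - dist u w), lt_min hr (by linarith), fun y hy hyu => ?_⟩
    have h1 := hyu.trans_le (min_le_left _ _)
    have h2 := hyu.trans_le (min_le_right _ _)
    have h3 := dist_triangle y u w
    obtain ⟨-, b', t', hMC, hyt⟩ := hM k y hy (by linarith)
    have hu' := hrs t' hMC.2.2.1 y hyt h1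
    have := (hcube q).top_eq hm hMC hu' fun j e => by
      have := hG j
      rw [((hC q).zero_iff u j).2 e] at this
      exact lt_irrefl _ this
    rw [this]
    exact hyt
  have hεex : ∀ q, ∃ ε > 0, ε ≤ 1 ∧ ∀ r : Fin p → ℝ, (∀ j, r j ∈ Icc 0 ε) → dist (Φ q r) w < ρ := by
    intro q
    obtain ⟨ε, hε, hs⟩ := Metric.continuous_iff.1 (hC q).contΦ 0 ρ hρ
    rw [(hC q).Φ_zero hm] at hs
    refine ⟨min (ε / 2) 1, lt_min (half_pos hε) one_pos, min_le_right _ _, fun r hr => hs r ?_⟩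
    refine lt_of_le_of_lt ((dist_pi_le_iff (half_pos hε).le).2 fun j => ?_) (half_lt_self hε)
    rw [Pi.zero_apply, Real.dist_eq, sub_zero, abs_of_nonneg (hr j).1]
    exact (hr j).2.trans (min_le_left _ _)
  choose ε hε hε1 hερ using hεex
  have hρex : ∀ q, ∃ r > 0, ∀ y, dist y w < r → ∀ j, G q y j < ε q := by
    intro q
    obtain ⟨r, hr, hs⟩ := Metric.continuous_iff.1 (hC q).contG w (ε q) (hε q)
    rw [(hC q).G_left hm] at hs
    refine ⟨r, hr, fun y hy j => ?_⟩
    have h1 := (dist_le_pi_dist _ _ j).trans_lt (hs y hy)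
    rw [Pi.zero_apply, Real.dist_eq, sub_zero] at h1
    exact (le_abs_self _).trans_lt h1
  choose r hr hrs using hρex
  obtain ⟨r₀, hr₀, hr₀le⟩ := exists_pos_le_forall r hr
  obtain ⟨y, hyB, hyw, -, hyav⟩ := h.exists_avoid hT hp ho hz (lt_min hr₀ hρ)
  obtain ⟨q, hyq⟩ : ∃ q : ι, y ∈ medInt m w (t q) := by
    obtain ⟨-, b', t', hMC, hyt⟩ := hM none y (hwz none hyB) (hyw.trans_le (min_le_right _ _))
    exact ⟨⟨(fun j => ⟨b' j, hMC.2.1 j⟩, ⟨t', hMC.2.2.1⟩), hMC⟩, hyt⟩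
  have hC' := hC q
  have hGy : ∀ j, G q y j ∈ Ioo 0 (ε q) := fun j =>
    ⟨lt_of_le_of_ne (hC'.memG y j).1 fun e => hyav q j hyq ((hC'.zero_iff y j).1 e.symm),
      hrs q y (hyw.trans_le ((min_le_left _ _).trans (hr₀le q))) j⟩
  have hcor : ∀ s : Fin p → ℝ, (∀ j, s j ∈ Icc 0 (ε q)) → Φ q s ∈ Box w z := by
    intro s hs
    refine hinter _ fun k => hC'.corner_subset_Box hT (hε q) (hε1 q) (fun s hs hsB => ?_) hGy
      (by rw [hC'.ΦG y hyq]; exact hwz k hyB) s hs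
    have h1 := hερ q s fun j => Ioo_subset_Icc_self (hs j)
    refine ⟨(hM k _ hsB h1).1, hnear q _ h1 (fun j => ?_) (hC'.memΦ s) k⟩
    rw [hC'.GΦ s fun j => ⟨(hs j).1.le, (hs j).2.le.trans (hε1 q)⟩]
    exact (hs j).1
  have hcor' : ∀ u ∈ medInt m w (t q), (∀ j, G q u j ≤ ε q) → u ∈ Box w z := fun u hu hG => by
    rw [← hC'.ΦG u hu]
    exact hcor _ fun j => ⟨(hC'.memG u j).1, hG j⟩
  set t' := Φ q fun _ => ε q / 2 with ht'
  have hεq := hε q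
  have hGt' : ∀ j, G q t' j = ε q / 2 := fun j => by
    rw [ht', hC'.GΦ _ fun j => ⟨by linarith, by linarith [hε1 q]⟩]
  have ht'C : t' ∈ medInt m w (t q) := hC'.memΦ _
  have hGle : ∀ u ∈ medInt m w t', ∀ j, G q u j ≤ ε q / 2 := by
    intro u hu j
    have := hC'.G_int w t' u hu j
    rw [hC'.G_left hm, Pi.zero_apply, hGt', uIcc_of_le (by linarith)] at this
    exact this.2
  refine ⟨fun j => m w (b q j) t', t', (ho q).sub hm ht'C fun j e => ?_, fun u hu => ?_,
    fun u hu hu0 hu1 => ?_⟩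
  · have := (hC'.zero_iff t' j).2 e
    rw [hGt'] at this
    linarith
  · exact hcor' u (hm.int_trans hu ht'C) fun j => (hGle u hu j).trans (by linarith)
  have huC : u ∈ medInt m w (t q) := hm.int_trans hu ht'C
  have hGu : ∀ j, G q u j ∈ Ioo 0 (ε q / 2) := by
    intro j
    have e1 := hm.med_med_of_mem (b q j) hu
    refine ⟨lt_of_le_of_ne (hC'.memG u j).1 fun e => hu0 j ?_, lt_of_le_of_ne (hGle u hu j) fun e =>
      hu1 j ?_⟩
    · rw [e1]
      exact (hC'.zero_iff u j).1 e.symm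
    · rw [e1]
      exact (hC'.eq_iff u t' j).1 (by rw [e, hGt'])
  have huw : dist u w < ρ := by
    rw [← hC'.ΦG u huC]
    exact hερ q _ fun j => ⟨(hGu j).1.le, by linarith [(hGu j).2]⟩
  have huB : u ∈ Box w z := hcor' u huC fun j => by linarith [(hGu j).2]
  obtain ⟨δ₁, hδ₁, hs₁⟩ := hnear q u huw (fun j => (hGu j).1) huC none
  obtain ⟨δ₂, hδ₂, hs₂⟩ : ∃ δ > 0, ∀ y, dist y u < δ → ∀ j, G q y j < ε q / 2 := by
    have hopen : IsOpen (G q ⁻¹' Set.pi univ fun _ => Iio (ε q / 2)) :=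
      (isOpen_set_pi finite_univ fun _ _ => isOpen_Iio).preimage hC'.contG
    obtain ⟨δ, hδ, hs⟩ := Metric.isOpen_iff.1 hopen u fun j _ => (hGu j).2
    exact ⟨δ, hδ, fun y hy j => hs hy j trivial⟩
  refine ⟨fun i => ⟨fun e => ?_, ((hM none u (hwz none huB) huw).1 i).1⟩, min δ₁ δ₂,
    lt_min hδ₁ hδ₂, fun v hv hvu => ?_⟩
  · have hpos : 0 < dist (w i) (β i) := dist_pos.2 (hβw i).symm
    obtain ⟨v, hv, hvd⟩ := (hT i).exists_mem_Seg (w i) (β i)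
      (r := min (min (δ₁ / 2) (δ₂ / 2)) (dist (w i) (β i)))
      (le_min (le_min (by linarith) (by linarith)) dist_nonneg) (min_le_right _ _)
    have hdu : dist (upd u i v) u = dist (w i) v := by
      have := dist_upd u i v (u i)
      rwa [upd_eq_self, e, dist_comm v] at this
    have h1 : dist (upd u i v) u < δ₁ := by
      rw [hdu, hvd]
      exact ((min_le_left _ _).trans (min_le_left _ _)).trans_lt (half_lt_self hδ₁)
    have h2 : dist (upd u i v) u < δ₂ := by
      rw [hdu, hvd]
      exact ((min_le_left _ _).trans (min_le_right _ _)).trans_lt (half_lt_self hδ₂)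
    have hvB : upd u i v ∈ Box z (c none) := by
      intro k
      by_cases hk : k = i
      · subst hk
        rw [upd_same]
        exact Seg_symm (Seg_trans (Seg_symm (hβ k)) (Seg_symm hv))
      · rw [upd_ne _ _ hk]
        exact hwz none huB k
    have h3 := hcor' _ (hs₁ _ hvB h1) (fun j => by linarith [hs₂ _ h2 j]) i
    rw [upd_same] at h3
    have h4 : v = w i := eq_of_mem_Seg_of_mem_Seg (hβ i) h3 hv
    rw [h4, dist_self] at hvd
    have : 0 < min (min (δ₁ / 2) (δ₂ / 2)) (dist (w i) (β i)) :=
      lt_min (lt_min (by linarith) (by linarith)) hpos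
    linarith
  · have h1 := hs₁ v (hwz none hv) (hvu.trans_le (min_le_left _ _))
    have h2 := hs₂ v (hvu.trans_le (min_le_right _ _))
    refine hC'.mem_int hm (hm.left_mem _ _) ht'C h1 fun j => ?_
    rw [hC'.G_left hm, Pi.zero_apply, hGt', uIcc_of_le (by linarith)]
    exact ⟨(hC'.memG v j).1, (h2 j).le⟩

end Corner

theorem IsChart.coord_ne {Ω : Type*} [MetricSpace Ω] {m : Ω → Ω → Ω → Ω} (hm : IsMedianOp m)
    {n : ℕ} {x t : Ω} {b : Fin n → Ω} {G : Ω → Fin n → ℝ} {Φ : (Fin n → ℝ) → Ω}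
    (hC : IsChart m x b t G Φ) {u t' : Ω} {b' : Fin n → Ω} (ho : Ortho m u b' t')
    (hsub : medInt m u t' ⊆ medInt m x t) (k : Fin n) : G t' k ≠ G u k := by
  have h1 : ∀ j, ∃ k, G (b' j) k ≠ G u k := by
    intro j
    by_contra hn
    push Not at hn
    exact ho.1 j (hC.G_inj (hsub (ho.mem_int hm j)) (hsub (hm.left_mem _ _)) (funext hn))
  choose f hf using h1
  have hinj : Function.Injective f := by
    intro i j hij
    by_contra hne
    have h2 := hf i
    have h3 := hf j
    rw [← hij] at h3
    have h4 := hC.G_int _ _ _ (ho.corner_mem hm hne) (f i)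
    have h5 := hC.G_int _ _ _ (ho.mem_int hm i) (f i)
    have h6 := hC.G_int _ _ _ (ho.mem_int hm j) (f i)
    rw [mem_uIcc] at h4 h5 h6
    rcases lt_or_gt_of_ne h2 with h2 | h2 <;> rcases lt_or_gt_of_ne h3 with h3 | h3 <;>
      rcases h4 with h4 | h4 <;> rcases h5 with h5 | h5 <;> rcases h6 with h6 | h6 <;>
      linarith [h4.1, h4.2, h5.1, h5.2, h6.1, h6.2]
  obtain ⟨j, rfl⟩ := Finite.injective_iff_surjective.1 hinj k
  intro e
  have h5 := hC.G_int _ _ _ (ho.mem_int hm j) (f j)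
  rw [e, uIcc_self] at h5
  exact hf j h5

section Line

variable {p : ℕ} {T : Fin p → Type*} [∀ i, MetricSpace (T i)] (hT : ∀ i, IsRTree (T i))
  {m : PiLp 1 T → PiLp 1 T → PiLp 1 T → PiLp 1 T} {L : ℝ}

/-- A chart of a cube inside a box, every interior point of which is interior in the box. -/
structure IsOpenChart (m : PiLp 1 T → PiLp 1 T → PiLp 1 T → PiLp 1 T) (w z : PiLp 1 T)
    (b : Fin p → PiLp 1 T) (t : PiLp 1 T) (G : PiLp 1 T → Fin p → ℝ)
    (Φ : (Fin p → ℝ) → PiLp 1 T) : Prop extends IsChart m w b t G Φ where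
  sub : medInt m w t ⊆ Box w z
  ne : ∀ u ∈ medInt m w t, (∀ j, G u j ∈ Ioo (0 : ℝ) 1) → ∀ i, u i ≠ w i ∧ u i ≠ z i
  nbhd : ∀ u ∈ medInt m w t, (∀ j, G u j ∈ Ioo (0 : ℝ) 1) →
    ∃ δ > 0, ∀ y ∈ Box w z, dist y u < δ → y ∈ medInt m w t

include hT

theorem LipMed.exists_openChart (hF : ∀ i, Furry (T i)) (h : LipMed m L) (hp : 1 ≤ p)
    (w z : PiLp 1 T) (hz : ∀ i, z i ≠ w i) :
    ∃ b t G Φ, Ortho m w b t ∧ IsOpenChart m w z b t G Φ := by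
  obtain ⟨b, t, ho, hB, hu⟩ := h.exists_corner hT hF hp w z hz
  obtain ⟨G, Φ, hC⟩ := h.exists_chart_pi hT ho
  have hGu : ∀ u, (∀ j, G u j ∈ Ioo (0 : ℝ) 1) → (∀ j, m w (b j) u ≠ w) ∧ ∀ j, m w (b j) u ≠ b j := by
    refine fun u hG => ⟨fun j e => ?_, fun j e => ?_⟩
    · exact (hG j).1.ne' ((hC.zero_iff u j).2 e)
    · exact (hG j).2.ne ((hC.one_iff u j).2 e)
  exact ⟨b, t, G, Φ, ho, ⟨hC, hB, fun u hu' hG => (hu u hu' (hGu u hG).1 (hGu u hG).2).1,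
    fun u hu' hG => (hu u hu' (hGu u hG).1 (hGu u hG).2).2⟩⟩

/-- Near an interior point, only one coordinate of the product changes along a coordinate line
of the chart. -/
theorem IsOpenChart.exists_coord (hF : ∀ i, Furry (T i)) (h : LipMed m L) (hp : 1 ≤ p)
    {w z t : PiLp 1 T} {b : Fin p → PiLp 1 T} {G : PiLp 1 T → Fin p → ℝ}
    {Φ : (Fin p → ℝ) → PiLp 1 T} (hC : IsOpenChart m w z b t G Φ)
    {r : Fin p → ℝ} (hr : ∀ j, r j ∈ Ioo (0 : ℝ) 1) (k : Fin p) :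
    ∃ i, ∃ η > 0, ∀ s, |s - r k| < η → ∀ i', i' ≠ i →
      Φ (Function.update r k s) i' = Φ r i' := by
  classical
  have hm := h.1
  have hr' : ∀ j, r j ∈ Icc (0 : ℝ) 1 := fun j => Ioo_subset_Icc_self (hr j)
  set u := Φ r with hu
  have hGu : G u = r := hC.GΦ r hr'
  have huC : u ∈ medInt m w t := hC.memΦ r
  have hGu' : ∀ j, G u j ∈ Ioo (0 : ℝ) 1 := by rw [hGu]; exact hr
  obtain ⟨δ, hδ, hδs⟩ := hC.nbhd u huC hGu'
  have hune := hC.ne u huC hGu'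
  have huB := hC.sub huC
  let e : ∀ i, Bool → T i := fun i s => if s then z i else w i
  have heB : ∀ i s, e i s ∈ Seg (w i) (z i) := by
    intro i s
    cases s
    · exact left_mem_Seg _ _
    · exact right_mem_Seg _ _
  have hue : ∀ i s, u i ≠ e i s := by
    intro i s
    cases s
    · exact (hune i).1
    · exact (hune i).2
  let zσ : (Fin p → Bool) → PiLp 1 T := fun σ => WithLp.toLp 1 fun i => e i (σ i)
  obtain ⟨r₀, hr₀, hr₀δ⟩ : ∃ r₀ > 0, p * r₀ < δ := by
    refine ⟨δ / (p + 1), by positivity, ?_⟩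
    rw [mul_div_assoc', div_lt_iff₀ (by positivity)]
    linarith
  have hcor : ∀ σ, ∃ t', (∀ k, G t' k ≠ G u k) ∧ medInt m u t' ⊆ medInt m w t ∧
      medInt m u t' ⊆ Box u (zσ σ) := by
    intro σ
    obtain ⟨z', hz'B, hz'd, hz'n⟩ := exists_near hT u (zσ σ) hr₀
    obtain ⟨b', t', ho', hB', -⟩ := h.exists_corner hT hF hp u z'
      fun i => (hz'n i (hue i (σ i))).1
    have hB2 : medInt m u t' ⊆ Box u (zσ σ) := fun y hy =>
      Box_subset hT (fun i => left_mem_Seg _ _) hz'B (hB' hy)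
    have hsub : medInt m u t' ⊆ medInt m w t := by
      intro y hy
      refine hδs y (Box_subset hT huB (fun i => heB i (σ i)) (hB2 hy)) ?_
      refine PiLp.dist_lt_of_forall_le (fun i => ?_) hr₀δ
      have h1 := mem_Seg.1 (hB' hy i)
      have h2 := hz'd i
      rw [dist_comm]
      linarith [dist_nonneg (x := y i) (y := z' i)]
    exact ⟨t', hC.coord_ne hm ho' hsub, hsub, hB2⟩
  choose t' ht'ne ht'sub ht'B using hcor
  obtain ⟨η, hη, hηle⟩ := exists_pos_le_forall (fun σ => |G (t' σ) k - r k|)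
    fun σ => abs_pos.2 (sub_ne_zero.2 (hGu ▸ ht'ne σ k))
  let y : ℝ → PiLp 1 T := fun s => Φ (Function.update r k s)
  have hs01 : ∀ s, |s - r k| < min η (min (r k) (1 - r k)) →
      ∀ j, Function.update r k s j ∈ Icc (0 : ℝ) 1 := by
    intro s hs j
    by_cases hj : j = k
    · subst hj
      rw [Function.update_self]
      have h1 := hs.trans_le ((min_le_right _ _).trans (min_le_left _ _))
      have h2 := hs.trans_le ((min_le_right _ _).trans (min_le_right _ _))
      rw [abs_lt] at h1 h2
      exact ⟨by linarith, by linarith⟩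
    · rw [Function.update_of_ne hj]
      exact hr' j
  have hray : ∀ s, |s - r k| < min η (min (r k) (1 - r k)) → ∀ σ,
      0 < (s - r k) * (G (t' σ) k - r k) → y s ∈ Box u (zσ σ) := by
    intro s hs σ hpos
    refine ht'B σ (hC.mem_int hm huC (ht'sub σ (hm.right_mem _ _)) (hC.memΦ _) fun j => ?_)
    change G (Φ (Function.update r k s)) j ∈ _
    rw [hC.GΦ _ (hs01 s hs), hGu]
    by_cases hj : j = k
    · subst hj
      rw [Function.update_self, mem_uIcc]
      have h1 := hs.trans_le (min_le_left _ _)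
      have h2 := hηle σ
      rcases mul_pos_iff.1 hpos with ⟨h3, h4⟩ | ⟨h3, h4⟩
      · rw [abs_of_pos h3] at h1
        rw [abs_of_pos h4] at h2
        left; constructor <;> linarith
      · rw [abs_of_neg h3] at h1
        rw [abs_of_neg h4] at h2
        right; constructor <;> linarith
    · rw [Function.update_of_ne hj]
      exact left_mem_uIcc
  have hbit : ∀ s i, y s i ≠ u i → ∃ c, y s i ∉ Seg (u i) (e i c) := by
    intro s i hne
    by_contra hn
    push Not at hn
    exact hne (eq_of_mem_Seg_of_mem_Seg (huB i) (hn false) (hn true))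
  have key : ∀ s s', |s - r k| < min η (min (r k) (1 - r k)) →
      |s' - r k| < min η (min (r k) (1 - r k)) → r k < s → s' < r k → ∀ i i',
      y s i ≠ u i → y s' i' ≠ u i' → i = i' := by
    intro s s' hs hs' hlt hlt' i i' hi hi'
    by_contra hne
    obtain ⟨c, hc⟩ := hbit s i hi
    obtain ⟨c', hc'⟩ := hbit s' i' hi'
    let σ : Fin p → Bool := fun l => if l = i then c else c'
    have hσ : σ i = c := if_pos rfl
    have hσ' : σ i' = c' := if_neg (Ne.symm hne)
    rcases lt_or_gt_of_ne (hGu ▸ ht'ne σ k : G (t' σ) k ≠ r k) with hlt2 | hlt2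
    · have := hray s' hs' σ (mul_pos_of_neg_of_neg (by linarith) (by linarith)) i'
      change _ ∈ Seg (u i') (e i' (σ i')) at this
      rw [hσ'] at this
      exact hc' this
    · have := hray s hs σ (mul_pos (by linarith) (by linarith)) i
      change _ ∈ Seg (u i) (e i (σ i)) at this
      rw [hσ] at this
      exact hc this
  set η' := min η (min (r k) (1 - r k)) with hη'
  have hη'pos : 0 < η' := lt_min hη (lt_min (hr k).1 (by linarith [(hr k).2]))
  have hmove : ∀ s, |s - r k| < η' → s ≠ r k → ∃ i, y s i ≠ u i := by
    intro s hs hne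
    by_contra hn
    push Not at hn
    have h1 := hC.Φ_inj (hs01 s hs) hr' (PiLp.ext hn)
    have h2 := congrFun h1 k
    rw [Function.update_self] at h2
    exact hne h2
  have ha : |r k + η' / 2 - r k| < η' := by
    rw [add_sub_cancel_left, abs_of_pos (by linarith)]; linarith
  have hb : |r k - η' / 2 - r k| < η' := by
    rw [show r k - η' / 2 - r k = -(η' / 2) by ring, abs_neg, abs_of_pos (by linarith)]; linarith
  obtain ⟨i₁, hi₁⟩ := hmove _ ha (by linarith)
  obtain ⟨i₂, hi₂⟩ := hmove _ hb (by linarith)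
  have h12 := key _ _ ha hb (by linarith) (by linarith) _ _ hi₁ hi₂
  refine ⟨i₁, η', hη'pos, fun s hs i' hi' => ?_⟩
  by_contra hne
  rcases lt_trichotomy s (r k) with hlt | heq | hgt
  · exact hi' (key _ _ ha hs (by linarith) hlt _ _ hi₁ hne).symm
  · rw [heq, Function.update_eq_self] at hne
    exact hne rfl
  · exact hi' ((key _ _ hs hb hgt (by linarith) _ _ hne hi₂).trans h12.symm)

end Line

theorem IsPreconnected.constant_of_eventually {X Y : Type*} [TopologicalSpace X] {S : Set X}
    (hS : IsPreconnected S) {f : X → Y} (hf : ∀ x ∈ S, ∀ᶠ y in nhdsWithin x S, f y = f x)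
    {x y : X} (hx : x ∈ S) (hy : y ∈ S) : f x = f y := by
  let _ : TopologicalSpace Y := ⊥
  have : DiscreteTopology Y := ⟨rfl⟩
  refine hS.constant (f := f) (fun a ha => ?_) hx hy
  exact tendsto_const_nhds.congr' ((hf a ha).mono fun _ h => h.symm)

section Line

variable {p : ℕ} {T : Fin p → Type*} [∀ i, MetricSpace (T i)] (hT : ∀ i, IsRTree (T i))
  {m : PiLp 1 T → PiLp 1 T → PiLp 1 T → PiLp 1 T} {L : ℝ}
  {w z t : PiLp 1 T} {b : Fin p → PiLp 1 T} {G : PiLp 1 T → Fin p → ℝ}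
  {Φ : (Fin p → ℝ) → PiLp 1 T}

theorem IsChart.exists_ne_of_update (hC : IsChart m w b t G Φ)
    {r : Fin p → ℝ} (hr : ∀ j, r j ∈ Icc (0 : ℝ) 1) (k : Fin p) {s s' : ℝ}
    (hs : s ∈ Icc (0 : ℝ) 1) (hs' : s' ∈ Icc (0 : ℝ) 1) (hne : s ≠ s') :
    ∃ i, Φ (Function.update r k s) i ≠ Φ (Function.update r k s') i := by
  by_contra hn
  push Not at hn
  have hup : ∀ s ∈ Icc (0 : ℝ) 1, ∀ j, Function.update r k s j ∈ Icc (0 : ℝ) 1 := by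
    intro s hs j
    by_cases hj : j = k
    · subst hj; rwa [Function.update_self]
    · rw [Function.update_of_ne hj]; exact hr j
  have h2 := congrFun (hC.Φ_inj (hup s hs) (hup s' hs') (PiLp.ext hn)) k
  rw [Function.update_self, Function.update_self] at h2
  exact hne h2

include hT in
/-- Along an open coordinate line of the chart only one coordinate of the product changes. -/
theorem IsOpenChart.exists_coord_line (hF : ∀ i, Furry (T i)) (h : LipMed m L) (hp : 1 ≤ p)
    (hC : IsOpenChart m w z b t G Φ)
    {r : Fin p → ℝ} (hr : ∀ j, r j ∈ Ioo (0 : ℝ) 1) (k : Fin p) :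
    ∃ i, ∀ s ∈ Ioo (0 : ℝ) 1, ∀ i', i' ≠ i → Φ (Function.update r k s) i' = Φ r i' := by
  have hr' : ∀ j, r j ∈ Icc (0 : ℝ) 1 := fun j => Ioo_subset_Icc_self (hr j)
  have hup : ∀ s ∈ Ioo (0 : ℝ) 1, ∀ j, Function.update r k s j ∈ Ioo (0 : ℝ) 1 := by
    intro s hs j
    by_cases hj : j = k
    · subst hj; rwa [Function.update_self]
    · rw [Function.update_of_ne hj]; exact hr j
  let g : ℝ → PiLp 1 T := fun s => Φ (Function.update r k s)
  have h1 : ∀ s, ∃ i, s ∈ Ioo (0 : ℝ) 1 → ∃ η > 0, ∀ s', |s' - s| < η → ∀ i', i' ≠ i →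
      g s' i' = g s i' := by
    intro s
    by_cases hs : s ∈ Ioo (0 : ℝ) 1
    · obtain ⟨i, η, hη, hi⟩ := hC.exists_coord hT hF h hp (hup s hs) k
      refine ⟨i, fun _ => ⟨η, hη, fun s' hs' i' hi' => ?_⟩⟩
      have := hi s' (by rwa [Function.update_self]) i' hi'
      rwa [Function.update_idem] at this
    · exact ⟨⟨0, hp⟩, fun h => absurd h hs⟩
  choose τ hτ using h1
  have hconst : ∀ s ∈ Ioo (0 : ℝ) 1, τ s = τ (r k) := by
    intro s hs
    refine isPreconnected_Ioo.constant_of_eventually (S := Ioo (0 : ℝ) 1) (fun a ha => ?_) hs (hr k)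
    obtain ⟨η, hη, hηs⟩ := hτ a ha
    filter_upwards [self_mem_nhdsWithin, mem_nhdsWithin_of_mem_nhds (ball_mem_nhds a hη)]
      with a' ha' hd
    rw [mem_ball, Real.dist_eq] at hd
    obtain ⟨η', hη', hηs'⟩ := hτ a' ha'
    set d := min (min (η' / 2) ((1 - a') / 2)) ((η - |a' - a|) / 2) with hd_def
    have hdpos : 0 < d := lt_min (lt_min (by linarith) (by linarith [ha'.2])) (by linarith)
    have hd1 : d ≤ η' / 2 := (min_le_left _ _).trans (min_le_left _ _)
    have hd2 : d ≤ (1 - a') / 2 := (min_le_left _ _).trans (min_le_right _ _)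
    have hd3 : d ≤ (η - |a' - a|) / 2 := min_le_right _ _
    obtain ⟨i, hi⟩ := hC.exists_ne_of_update hr' k (s := a' + d) (s' := a')
      ⟨by linarith [ha'.1], by linarith [ha'.2]⟩ (Ioo_subset_Icc_self ha') (by linarith)
    have e1 : i = τ a' := by
      by_contra hne
      refine hi (hηs' (a' + d) ?_ i hne)
      rw [add_sub_cancel_left, abs_of_pos hdpos]
      linarith
    have e2 : i = τ a := by
      by_contra hne
      refine hi ((hηs (a' + d) ?_ i hne).trans (hηs a' hd i hne).symm)
      have : |a' + d - a| ≤ |a' - a| + |d| := by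
        rw [show a' + d - a = (a' - a) + d by ring]
        exact abs_add_le _ _
      rw [abs_of_pos hdpos] at this
      linarith
    rw [← e1, ← e2]
  refine ⟨τ (r k), fun s hs i' hi' => ?_⟩
  have h2 : g s i' = g (r k) i' := by
    refine isPreconnected_Ioo.constant_of_eventually (S := Ioo (0 : ℝ) 1) (f := fun s => g s i')
      (fun a ha => ?_) hs (hr k)
    obtain ⟨η, hη, hηs⟩ := hτ a ha
    filter_upwards [mem_nhdsWithin_of_mem_nhds (ball_mem_nhds a hη)] with a' hd
    exact hηs a' hd i' (by rw [hconst a ha]; exact hi')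
  simpa [g] using h2

include hT in
/-- The chart matches coordinate lines with coordinate lines of the product. -/
theorem IsOpenChart.exists_perm (hF : ∀ i, Furry (T i)) (h : LipMed m L) (hp : 1 ≤ p)
    (hC : IsOpenChart m w z b t G Φ) :
    ∃ τ : Equiv.Perm (Fin p), ∀ r r' : Fin p → ℝ, (∀ j, r j ∈ Icc (0 : ℝ) 1) →
      (∀ j, r' j ∈ Icc (0 : ℝ) 1) → ∀ k, r k = r' k → Φ r (τ k) = Φ r' (τ k) := by
  classical
  have hm := h.1
  have h1 : ∀ (k : Fin p) (r : Fin p → ℝ), ∃ i, (∀ j, r j ∈ Ioo (0 : ℝ) 1) → ∀ s ∈ Ioo (0 : ℝ) 1,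
      ∀ i', i' ≠ i → Φ (Function.update r k s) i' = Φ r i' := by
    intro k r
    by_cases hr : ∀ j, r j ∈ Ioo (0 : ℝ) 1
    · obtain ⟨i, hi⟩ := hC.exists_coord_line hT hF h hp hr k
      exact ⟨i, fun _ => hi⟩
    · exact ⟨⟨0, hp⟩, fun h => absurd h hr⟩
  choose τ hτ using h1
  let O : Set (Fin p → ℝ) := Set.pi univ fun _ => Ioo 0 1
  have hO : IsPreconnected O := (convex_pi fun _ _ => convex_Ioo _ _).isPreconnected
  let r₀ : Fin p → ℝ := fun _ => 1 / 2
  have hr₀ : r₀ ∈ O := fun j _ => ⟨by norm_num [r₀], by norm_num [r₀]⟩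
  have hcoord : ∀ i : Fin p, Continuous fun r => Φ r i := fun i =>
    (PiLp.continuous_eval_L1 i).comp hC.contΦ
  have hconst : ∀ k, ∀ r ∈ O, τ k r = τ k r₀ := by
    intro k r hr
    refine hO.constant_of_eventually (fun a ha => ?_) hr hr₀
    have ha' : ∀ j, a j ∈ Ioo (0 : ℝ) 1 := fun j => ha j trivial
    obtain ⟨i, hi⟩ := hC.exists_ne_of_update (fun j => Ioo_subset_Icc_self (ha' j)) k
      (s := a k / 2) (s' := a k) ⟨by linarith [(ha' k).1], by linarith [(ha' k).2]⟩
      (Ioo_subset_Icc_self (ha' k)) (by linarith [(ha' k).1])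
    rw [Function.update_eq_self] at hi
    have hopen : IsOpen {a' : Fin p → ℝ | Φ (Function.update a' k (a k / 2)) i ≠ Φ a' i} :=
      isOpen_ne_fun ((hcoord i).comp (continuous_id.update k continuous_const)) (hcoord i)
    filter_upwards [self_mem_nhdsWithin, mem_nhdsWithin_of_mem_nhds (hopen.mem_nhds hi)]
      with a' haO hne
    have hs : a k / 2 ∈ Ioo (0 : ℝ) 1 := ⟨by linarith [(ha' k).1], by linarith [(ha' k).2]⟩
    have e1 : i = τ k a := by
      by_contra hn
      exact hi (hτ k a ha' _ hs i hn)
    have e2 : i = τ k a' := by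
      by_contra hn
      exact hne (hτ k a' (fun j => haO j trivial) _ hs i hn)
    rw [← e1, ← e2]
  have hclosed : ∀ k i, i ≠ τ k r₀ → ∀ r : Fin p → ℝ, (∀ j, r j ∈ Icc (0 : ℝ) 1) →
      ∀ s ∈ Icc (0 : ℝ) 1, Φ (Function.update r k s) i = Φ r i := by
    intro k i hi r hr s hs
    have hcl : IsClosed {q : (Fin p → ℝ) × ℝ | Φ (Function.update q.1 k q.2) i = Φ q.1 i} :=
      isClosed_eq ((hcoord i).comp (continuous_fst.update k continuous_snd))
        ((hcoord i).comp continuous_fst)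
    have hsub : O ×ˢ Ioo (0 : ℝ) 1 ⊆ {q : (Fin p → ℝ) × ℝ | Φ (Function.update q.1 k q.2) i = Φ q.1 i} := by
      rintro ⟨r, s⟩ ⟨hr, hs⟩
      exact hτ k r (fun j => hr j trivial) s hs i (by rw [hconst k r hr]; exact hi)
    have hmem : (r, s) ∈ closure (O ×ˢ Ioo (0 : ℝ) 1) := by
      rw [closure_prod_eq, closure_pi_set, closure_Ioo zero_ne_one]
      exact ⟨fun j _ => hr j, hs⟩
    exact closure_minimal hsub hcl hmem
  have hmany : ∀ i (r r' : Fin p → ℝ), (∀ j, r j ∈ Icc (0 : ℝ) 1) → (∀ j, r' j ∈ Icc (0 : ℝ) 1) →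
      (∀ k, r k ≠ r' k → i ≠ τ k r₀) → Φ r i = Φ r' i := by
    intro i r r' hr hr' hk
    have h2 : ∀ A : Finset (Fin p), Φ (A.piecewise r' r) i = Φ r i := by
      intro A
      induction A using Finset.induction_on with
      | empty => rw [Finset.piecewise_empty]
      | insert a A ha ih =>
        rw [Finset.piecewise_insert, ← ih]
        have hb : ∀ j, A.piecewise r' r j ∈ Icc (0 : ℝ) 1 := by
          intro j
          by_cases hj : j ∈ A
          · rw [Finset.piecewise_eq_of_mem _ _ _ hj]; exact hr' j
          · rw [Finset.piecewise_eq_of_notMem _ _ _ hj]; exact hr j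
        by_cases he : r a = r' a
        · rw [← he, ← Finset.piecewise_eq_of_notMem A r' r ha, Function.update_eq_self]
        · exact hclosed a i (hk a he) _ hb _ (hr' a)
    have h3 := h2 Finset.univ
    rw [Finset.piecewise_univ] at h3
    exact h3.symm
  have hsurj : Function.Surjective fun k => τ k r₀ := by
    intro i
    by_contra hn
    push Not at hn
    have h2 := hmany i r₀ 0 (fun j => Ioo_subset_Icc_self (hr₀ j trivial)) (fun j => by simp)
      fun k _ => (hn k).symm
    rw [hC.Φ_zero hm] at h2
    refine (hC.ne (Φ r₀) (hC.memΦ _) (fun j => ?_) i).1 h2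
    rw [hC.GΦ r₀ fun j => Ioo_subset_Icc_self (hr₀ j trivial)]
    exact hr₀ j trivial
  have hinj := Finite.injective_iff_surjective.2 hsurj
  refine ⟨Equiv.ofBijective _ ⟨hinj, hsurj⟩, fun r r' hr hr' k hk => ?_⟩
  refine hmany _ r r' hr hr' fun l hl e => ?_
  have : k = l := hinj e
  exact hl (this ▸ hk)

end Line

section CoordCube

variable {p : ℕ} {T : Fin p → Type*} [∀ i, MetricSpace (T i)] (hT : ∀ i, IsRTree (T i))
  {m : PiLp 1 T → PiLp 1 T → PiLp 1 T → PiLp 1 T} {L : ℝ}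

include hT

/-- In every direction there is a cube of the median operator with edges parallel to the
factors. -/
theorem LipMed.exists_coord_cube (hF : ∀ i, Furry (T i)) (h : LipMed m L) (hp : 1 ≤ p)
    (w z : PiLp 1 T) (hz : ∀ i, z i ≠ w i) :
    ∃ t ∈ Box w z, (∀ i, t i ≠ w i) ∧ Ortho m w (fun i => upd w i (t i)) t ∧
      ∀ i, medInt m w (upd w i (t i)) ⊆ Box w (upd w i (t i)) := by
  have hm := h.1
  obtain ⟨b, t, G, Φ, ho, hC⟩ := h.exists_openChart hT hF hp w z hz
  obtain ⟨τ, hτ⟩ := hC.exists_perm hT hF h hp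
  have hdep : ∀ y ∈ medInt m w t, ∀ y' ∈ medInt m w t, ∀ k, G y k = G y' k →
      y (τ k) = y' (τ k) := by
    intro y hy y' hy' k hk
    have := hτ (G y) (G y') (hC.memG y) (hC.memG y') k hk
    rwa [hC.ΦG y hy, hC.ΦG y' hy'] at this
  have hwC : w ∈ medInt m w t := hm.left_mem _ _
  have htC : t ∈ medInt m w t := hm.right_mem _ _
  have hbC : ∀ k, b k ∈ medInt m w t := fun k => ho.mem_int hm k
  have hGw : ∀ k, G w k = 0 := fun k => by rw [hC.G_left hm]; rfl
  have hGb : ∀ k, G (b k) k = 1 := fun k => (hC.one_iff _ _).2 (hm.self_right _ _)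
  have hGb' : ∀ k l, l ≠ k → G (b k) l = 0 := fun k l hl => by
    refine (hC.zero_iff _ _).2 ?_
    have h1 : m (b l) (b k) w = w := ho.corner_mem hm hl
    rw [hm.swap12, hm.swap23, h1]
  have hb : ∀ k, b k = upd w (τ k) (t (τ k)) := by
    intro k
    refine PiLp.ext fun i => ?_
    obtain ⟨l, rfl⟩ := τ.surjective i
    by_cases hl : l = k
    · subst hl
      rw [upd_same]
      refine hdep _ (hbC l) _ htC l ?_
      rw [hGb, hC.G_top hm ho]
      rfl
    · rw [upd_ne _ _ fun e => hl (τ.injective e)]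
      refine hdep _ (hbC k) _ hwC l ?_
      rw [hGb' k l hl, hGw]
  have hb' : ∀ i, upd w i (t i) = b (τ.symm i) := fun i => by
    rw [hb, Equiv.apply_symm_apply]
  refine ⟨t, hC.sub htC, fun i e => ?_, ?_, ?_⟩
  · have := hb' i
    rw [e, upd_eq_self] at this
    exact ho.1 _ this.symm
  · simp only [hb']
    refine ⟨fun j => ho.1 _, fun k hk hx => ⟨?_, fun i j hi hj => ?_⟩⟩
    · rw [(ho.2 k hk hx).1]
      exact ⟨fun ⟨j, hj⟩ => ⟨τ j, by simpa using hj⟩, fun ⟨j, hj⟩ => ⟨_, hj⟩⟩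
    · exact τ.symm.injective ((ho.2 k hk hx).2 _ _ hi hj)
  intro i
  obtain ⟨k, rfl⟩ := τ.surjective i
  rw [← hb]
  intro y hy i
  have hyC : y ∈ medInt m w t := hm.int_trans hy (hbC k)
  obtain ⟨l, rfl⟩ := τ.surjective i
  by_cases hl : l = k
  swap
  · have h1 := hC.G_int _ _ _ hy l
    rw [hGw, hGb' k l hl, uIcc_self] at h1
    have h2 : y (τ l) = w (τ l) := hdep _ hyC _ hwC l (by rw [hGw]; exact h1)
    rw [h2]
    exact left_mem_Seg _ _
  subst hl
  let g : ℝ → PiLp 1 T := fun s => Φ (Function.update 0 l s)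
  have h01 : ∀ s ∈ Icc (0 : ℝ) 1, ∀ j, Function.update (0 : Fin p → ℝ) l s j ∈ Icc (0 : ℝ) 1 := by
    intro s hs j
    by_cases hj : j = l
    · subst hj; rwa [Function.update_self]
    · rw [Function.update_of_ne hj]; simp
  have hgC : ∀ s, g s ∈ medInt m w t := fun s => hC.memΦ _
  have hgG : ∀ s ∈ Icc (0 : ℝ) 1, G (g s) l = s := fun s hs => by
    change G (Φ _) l = s
    rw [hC.GΦ _ (h01 s hs), Function.update_self]
  let f : ℝ → ℝ := fun s => dist (w (τ l)) (g s (τ l))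
  have hfc : Continuous f :=
    continuous_const.dist ((PiLp.continuous_eval_L1 _).comp
      (hC.contΦ.comp (continuous_const.update l continuous_id)))
  have hinj : InjOn f (Icc 0 1) := by
    intro s hs s' hs' e
    by_contra hne
    obtain ⟨i, hi⟩ := hC.exists_ne_of_update (r := 0) (fun j => by simp) l hs hs' hne
    obtain ⟨j, rfl⟩ := τ.surjective i
    refine hi ?_
    by_cases hj : j = l
    · subst hj
      exact (hT _).eq_of_mem_Seg (hC.sub (hgC s) _) (hC.sub (hgC s') _) e
    · refine hτ _ _ (h01 s hs) (h01 s' hs') j ?_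
      rw [Function.update_of_ne hj, Function.update_of_ne hj]
  have hg0 : g 0 (τ l) = w (τ l) := hdep _ (hgC 0) _ hwC l (by rw [hgG 0 (by simp), hGw])
  have hf0 : f 0 = 0 := by
    change dist _ _ = _
    rw [hg0, dist_self]
  have hmono := hfc.continuousOn.strictMonoOn_of_injOn_Icc zero_le_one
    (by rw [hf0]; exact dist_nonneg) hinj
  have hy1 := hC.memG y l
  have e1 : y (τ l) = g (G y l) (τ l) := hdep _ hyC _ (hgC _) l (hgG _ hy1).symm
  have e2 : b l (τ l) = g 1 (τ l) := hdep _ (hbC l) _ (hgC _) l (by rw [hgG 1 (by simp), hGb])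
  refine (hT _).mem_Seg_of_le (hC.sub hyC _) (hC.sub (hbC l) _) ?_
  rw [e1, e2]
  exact hmono.monotoneOn hy1 (by simp) hy1.2

end CoordCube

section Straight

variable {p : ℕ} {T : Fin p → Type*} [∀ i, MetricSpace (T i)]

omit [∀ i, MetricSpace (T i)] in
@[simp] theorem upd_upd (x : PiLp 1 T) (i : Fin p) (c d : T i) : upd (upd x i c) i d = upd x i d :=
  PiLp.ext fun j => by
    by_cases h : j = i
    · subst h; simp
    · rw [upd_ne _ _ h, upd_ne _ _ h, upd_ne _ _ h]

omit [∀ i, MetricSpace (T i)] in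
theorem upd_comm (x : PiLp 1 T) {i j : Fin p} (hij : i ≠ j) (c : T i) (d : T j) :
    upd (upd x i c) j d = upd (upd x j d) i c :=
  PiLp.ext fun k => by
    by_cases hi : k = i
    · subst hi; rw [upd_ne _ _ hij, upd_same, upd_same]
    by_cases hj : k = j
    · subst hj; rw [upd_same, upd_ne _ _ hi, upd_same]
    rw [upd_ne _ _ hi, upd_ne _ _ hj, upd_ne _ _ hi, upd_ne _ _ hj]

theorem mem_Box_upd {x y : PiLp 1 T} {i : Fin p} {c : T i} :
    y ∈ Box x (upd x i c) ↔ ∃ d ∈ Seg (x i) c, y = upd x i d := by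
  constructor
  · intro hy
    refine ⟨y i, by simpa using hy i, PiLp.ext fun j => ?_⟩
    by_cases h : j = i
    · subst h; simp
    · have := hy j
      rw [upd_ne _ _ h] at this ⊢
      exact Seg_self this
  · rintro ⟨d, hd, rfl⟩ j
    by_cases h : j = i
    · subst h; simpa using hd
    · rw [upd_ne _ _ h, upd_ne _ _ h]
      exact left_mem_Seg _ _

theorem Box_symm {x y z : PiLp 1 T} (h : z ∈ Box x y) : z ∈ Box y x := fun i => Seg_symm (h i)

variable (hT : ∀ i, IsRTree (T i))
  {m : PiLp 1 T → PiLp 1 T → PiLp 1 T → PiLp 1 T} {L : ℝ}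

include hT

theorem LipMed.Box_subset_medInt_upd (h : LipMed m L) {x : PiLp 1 T} {i : Fin p} {c d : T i}
    (hd : d ∈ Seg (x i) c) (hs : medInt m x (upd x i d) ⊆ Box x (upd x i c)) :
    Box x (upd x i d) ⊆ medInt m x (upd x i d) := by
  intro y hy
  obtain ⟨e, he, rfl⟩ := mem_Box_upd.1 hy
  obtain ⟨E, hE⟩ := exists_pathSystem hT
  obtain ⟨K, hK⟩ := hE.lip x (upd x i d)
  let f : ℝ → ℝ := fun s => dist (x i) (m x (upd x i d) (E x (upd x i d) s) i)
  have hf : Continuous f := continuous_const.dist ((PiLp.continuous_eval_L1 i).comp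
    (h.continuous continuous_const continuous_const hK.continuous))
  have h0 : f 0 = 0 := by
    change dist _ _ = _
    rw [hE.zero, h.1.self_outer, dist_self]
  have h1 : f 1 = dist (x i) d := by
    change dist _ _ = _
    rw [hE.one, h.1.self_right, upd_same]
  have hle : dist (x i) e ≤ dist (x i) d := by
    have := mem_Seg.1 he
    linarith [dist_nonneg (x := e) (y := d)]
  obtain ⟨s, -, hs'⟩ := intermediate_value_Icc zero_le_one hf.continuousOn
    (show dist (x i) e ∈ Icc (f 0) (f 1) by rw [h0, h1]; exact ⟨dist_nonneg, hle⟩)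
  have hq := h.1.med_mem x (upd x i d) (E x (upd x i d) s)
  obtain ⟨e', he', hqe⟩ := mem_Box_upd.1 (hs hq)
  change dist _ _ = _ at hs'
  rw [hqe, upd_same] at hs'
  have := (hT i).eq_of_mem_Seg he' (Seg_trans hd he) hs'
  rw [← this, ← hqe]
  exact hq

theorem LipMed.medInt_subset_Box_of_mem_Seg (h : LipMed m L) {x : PiLp 1 T} {i : Fin p}
    {c d : T i} (hd : d ∈ Seg (x i) c) (hs : medInt m x (upd x i c) ⊆ Box x (upd x i c)) :
    medInt m x (upd x i d) ⊆ Box x (upd x i d) := by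
  have hv : upd x i d ∈ medInt m x (upd x i c) :=
    h.Box_subset_medInt_upd hT (right_mem_Seg _ _) hs (mem_Box_upd.2 ⟨d, hd, rfl⟩)
  have hsub : ∀ q ∈ medInt m x (upd x i d), q ∈ Box x (upd x i c) :=
    fun q hq => hs (h.1.int_trans hq hv)
  intro q hq
  obtain ⟨e, he, rfl⟩ := mem_Box_upd.1 (hsub q hq)
  rcases le_total (dist (x i) e) (dist (x i) d) with hle | hle
  · exact mem_Box_upd.2 ⟨e, (hT i).mem_Seg_of_le he hd hle, rfl⟩
  · have h1 : upd x i d ∈ Box x (upd x i e) :=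
      mem_Box_upd.2 ⟨d, (hT i).mem_Seg_of_le hd he hle, rfl⟩
    have h2 := h.Box_subset_medInt_upd hT he (fun y hy => hsub y (h.1.int_trans hy hq)) h1
    rw [h.1.int_antisymm hq h2]
    exact mem_Box_upd.2 ⟨d, right_mem_Seg _ _, rfl⟩

omit hT in
theorem Box_eq_of_mem {w x y z : PiLp 1 T} (h : ∀ i, w i ∈ Seg (x i) (y i)) (hx : z ∈ Box w x)
    (hy : z ∈ Box w y) : z = w :=
  PiLp.ext fun i => eq_of_mem_Seg_of_mem_Seg (h i) (hx i) (hy i)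

/-- Two opposite directions of the same factor never lie in a common interval. -/
theorem LipMed.not_opposite (hF : ∀ i, Furry (T i)) (h : LipMed m L) (hp : 1 ≤ p)
    {w q : PiLp 1 T} {i : Fin p} {α β : T i} (hα : α ≠ w i) (hβ : β ≠ w i)
    (hw : w i ∈ Seg α β) (hqα : Box w (upd w i α) ⊆ medInt m w q)
    (hqβ : Box w (upd w i β) ⊆ medInt m w q) : False := by
  have hm := h.1
  choose z₀ _ hz₀ _ _ _ _ using fun k => (hT k).exists_branches (hF k) (w k) (w k)
  let z : PiLp 1 T := upd (WithLp.toLp 1 z₀) i α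
  have hz : ∀ k, z k ≠ w k := by
    intro k
    by_cases hk : k = i
    · subst hk
      simpa [z] using hα
    · simp only [z]
      rw [upd_ne _ _ hk]
      exact hz₀ k
  obtain ⟨t, ht, htw, hto, hts⟩ := h.exists_coord_cube hT hF hp w z hz
  have hz' : ∀ k, upd t i β k ≠ w k := by
    intro k
    by_cases hk : k = i
    · subst hk
      simpa using hβ
    · rw [upd_ne _ _ hk]
      exact htw k
  obtain ⟨t', ht', htw', hto', hts'⟩ := h.exists_coord_cube hT hF hp w _ hz'
  have htα : t i ∈ Seg (w i) α := by simpa [z] using ht i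
  have htβ : t' i ∈ Seg (w i) β := by simpa using ht' i
  have hcorner : w ∈ medInt m (upd w i (t i)) (upd w i (t' i)) := by
    have h1 : m (upd w i (t i)) (upd w i (t' i)) w = w := by
      refine Box_eq_of_mem (x := upd w i α) (y := upd w i β) (fun k => ?_) ?_ ?_
      · by_cases hk : k = i
        · subst hk
          simpa using hw
        · rw [upd_ne _ _ hk]
          exact left_mem_Seg _ _
      · exact Box_subset hT (fun _ => left_mem_Seg _ _) (mem_Box_upd.2 ⟨_, htα, rfl⟩)
          (hts i (hm.int_symm (hm.med_mem'' _ _ _)))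
      · exact Box_subset hT (fun _ => left_mem_Seg _ _) (mem_Box_upd.2 ⟨_, htβ, rfl⟩)
          (hts' i (hm.int_symm (hm.med_mem' _ _ _)))
    exact h1
  have hle : ∀ k, k ≠ i → upd w k (t' k) ∈ medInt m w (upd w k (t k)) := by
    intro k hk
    refine h.Box_subset_medInt_upd hT (right_mem_Seg _ _) (hts k) (mem_Box_upd.2 ⟨_, ?_, rfl⟩)
    have := ht' k
    rwa [upd_ne _ _ hk] at this
  have hx0 : ∀ k, w ∈ medInt m (upd w i (t i)) (upd w k (t' k)) := by
    intro k
    by_cases hk : k = i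
    · subst hk
      exact hcorner
    · exact hm.int_symm (hm.int_shift (hm.int_symm (hle k hk)) (hto.corner_mem hm hk))
  have hq0 : ∀ k, ∃ q, upd w i (t i) ∈ medInt m w q ∧ upd w k (t' k) ∈ medInt m w q := by
    intro k
    by_cases hk : k = i
    · subst hk
      exact ⟨q, hqα (mem_Box_upd.2 ⟨_, htα, rfl⟩), hqβ (mem_Box_upd.2 ⟨_, htβ, rfl⟩)⟩
    · exact ⟨t, hto.mem_int hm i, hm.int_trans (hle k hk) (hto.mem_int hm k)⟩
  obtain ⟨v, hv⟩ := exists_ortho_of_flag (m := m) (x := w)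
    (b := (Fin.cons (upd w i (t i)) fun k => upd w k (t' k) : Fin (p + 1) → PiLp 1 T))
    (fun j => by
      refine Fin.cases ?_ (fun k => ?_) j
      · exact hto.1 i
      · exact hto'.1 k)
    (fun j k => by
      refine Fin.cases ?_ (fun j => ?_) j <;> refine Fin.cases ?_ (fun k => ?_) k <;> intro hjk
      · exact absurd rfl hjk
      · exact hx0 k
      · exact hm.int_symm (hx0 j)
      · exact hto'.corner_mem hm fun e : j = k => hjk (by rw [e]))
    (fun j k => by
      refine Fin.cases ?_ (fun j => ?_) j <;> refine Fin.cases ?_ (fun k => ?_) k <;> intro hjk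
      · exact absurd rfl hjk
      · exact hq0 k
      · obtain ⟨q, h1, h2⟩ := hq0 j
        exact ⟨q, h2, h1⟩
      · exact ⟨t', hto'.mem_int hm j, hto'.mem_int hm k⟩)
  exact h.not_ortho hT w v _ hv

theorem LipMed.medInt_subset_Box_trans (hF : ∀ i, Furry (T i)) (h : LipMed m L) (hp : 1 ≤ p)
    {x : PiLp 1 T} {i : Fin p} {c d : T i} (hcd : c ∈ Seg (x i) d)
    (h₁ : medInt m x (upd x i c) ⊆ Box x (upd x i c))
    (h₂ : medInt m (upd x i c) (upd (upd x i c) i d) ⊆ Box (upd x i c) (upd (upd x i c) i d)) :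
    medInt m x (upd x i d) ⊆ Box x (upd x i d) := by
  have hm := h.1
  set w := upd x i c with hw
  have hwi : w i = c := upd_same _ _ _
  have hwd : upd w i d = upd x i d := upd_upd _ _ _ _
  have hwx : upd w i (x i) = x := by rw [hw, upd_upd, upd_eq_self]
  have hwB : w ∈ Box x (upd x i d) := mem_Box_upd.2 ⟨c, hcd, rfl⟩
  have hxB : x ∈ Box x (upd x i d) := fun _ => left_mem_Seg _ _
  have hdB : upd x i d ∈ Box x (upd x i d) := fun _ => right_mem_Seg _ _
  have h₂' := h₂
  rw [hwd] at h₂'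
  intro q hq
  obtain ⟨a, ha, hαa⟩ := mem_Box_upd.1 (h₁ (hm.med_mem x w q))
  obtain ⟨b, hb, hβb⟩ := mem_Box_upd.1 (h₂ (hm.med_mem w (upd w i d) q))
  by_cases hac : a = c
  · have hα : w ∈ medInt m x q := by
      have := hm.med_mem'' x w q
      rwa [hαa, hac] at this
    exact Box_subset hT hwB hdB (h₂' (hm.int_shift hα hq))
  by_cases hbc : b = c
  · have hβ : w ∈ medInt m (upd x i d) q := by
      have := hm.med_mem' w (upd w i d) q
      rwa [hβb, hbc, ← hwi, upd_eq_self, hwd] at this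
    exact Box_subset hT hxB hwB (h₁ (hm.int_symm (hm.int_shift hβ (hm.int_symm hq))))
  rw [hwi] at hb
  have haw : upd w i a ∈ medInt m w x := by
    rw [hw, upd_upd, ← hαa]
    exact hm.int_symm (hm.med_mem _ _ _)
  have haq : upd w i a ∈ medInt m w q := by
    rw [hw, upd_upd, ← hαa]
    exact hm.med_mem' _ _ _
  have hbq : upd w i b ∈ medInt m w q := by
    rw [← hβb]
    exact hm.med_mem'' _ _ _
  refine (h.not_opposite hT hF hp (w := w) (q := q) (i := i) (α := a) (β := b) (by rwa [hwi])
    (by rwa [hwi]) ?_ ?_ ?_).elim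
  · rw [hwi]
    exact Seg_symm (Seg_shift (Seg_symm (Seg_shift hcd ha)) (Seg_symm hb))
  · refine (h.Box_subset_medInt_upd hT (c := x i) (by rw [hwi]; exact Seg_symm ha) ?_).trans
      fun y hy => hm.int_trans hy haq
    rw [hwx]
    exact fun y hy => Box_symm (h₁ (hm.int_symm (hm.int_trans hy haw)))
  · refine (h.Box_subset_medInt_upd hT (right_mem_Seg _ _) ?_).trans
      fun y hy => hm.int_trans hy hbq
    exact h.medInt_subset_Box_of_mem_Seg hT (by rwa [hwi]) h₂

theorem LipMed.medInt_subset_Box_upd (hF : ∀ i, Furry (T i)) (h : LipMed m L) (hp : 1 ≤ p)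
    (x : PiLp 1 T) (i : Fin p) (c : T i) :
    medInt m x (upd x i c) ⊆ Box x (upd x i c) := by
  have hm := h.1
  have hself : medInt m x x ⊆ Box x x := by
    intro y hy
    have e : m x x y = y := hy
    rw [← e, hm.self_left]
    exact fun _ => left_mem_Seg _ _
  by_cases hc : x i = c
  · subst hc
    rw [upd_eq_self]
    exact hself
  obtain ⟨γ, hγ, hγ0, hγ1, hγd, hγL⟩ := (hT i).exists_path (x i) c
  have hpos : 0 < dist (x i) c := dist_pos.2 hc
  have hupd : Continuous fun s => upd x i (γ s) := by
    refine LipschitzWith.continuous (K := nndist (x i) c) (LipschitzWith.of_dist_le_mul ?_)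
    intro s s'
    rw [dist_upd]
    exact hγL.dist_le_mul s s'
  have hmono : ∀ s s', 0 ≤ s → s ≤ s' → s' ≤ 1 → γ s ∈ Seg (x i) (γ s') := by
    intro s s' h0 hs h1
    refine (hT i).mem_Seg_of_le (hγ s) (hγ s') ?_
    rw [hγd s ⟨h0, hs.trans h1⟩, hγd s' ⟨h0.trans hs, h1⟩]
    gcongr
  let S : Set ℝ := {s | medInt m x (upd x i (γ s)) ⊆ Box x (upd x i (γ s))}
  have hS : S = ⋂ (q : PiLp 1 T) (j : Fin p), {s | dist (x j) (m x (upd x i (γ s)) q j) +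
      dist (m x (upd x i (γ s)) q j) (upd x i (γ s) j) = dist (x j) (upd x i (γ s) j)} := by
    ext s
    simp only [mem_iInter]
    constructor
    · exact fun hs q j => hs (hm.med_mem _ _ q) j
    · intro hs y hy j
      have e : m x (upd x i (γ s)) y = y := hy
      rw [← e]
      exact hs y j
  have hclosed : IsClosed S := by
    rw [hS]
    refine isClosed_iInter fun q => isClosed_iInter fun j => ?_
    have h1 : Continuous fun s => m x (upd x i (γ s)) q j := (PiLp.continuous_eval_L1 j).comp
      (h.continuous continuous_const hupd continuous_const)
    have h2 : Continuous fun s => upd x i (γ s) j := (PiLp.continuous_eval_L1 j).comp hupd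
    exact isClosed_eq ((continuous_const.dist h1).add (h1.dist h2)) (continuous_const.dist h2)
  have hall : Icc (0 : ℝ) 1 ⊆ S := by
    refine (hclosed.inter isClosed_Icc).Icc_subset_of_forall_exists_gt ?_ ?_
    · change medInt m x (upd x i (γ 0)) ⊆ Box x (upd x i (γ 0))
      rw [hγ0, upd_eq_self]
      exact hself
    rintro s ⟨hs, hs0, hs1⟩ y (hy : s < y)
    change medInt m x (upd x i (γ s)) ⊆ Box x (upd x i (γ s)) at hs
    have hsc : c ≠ γ s := by
      intro e
      have := hγd s ⟨hs0, hs1.le⟩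
      rw [← e] at this
      nlinarith
    choose z₀ _ hz₀ _ _ _ _ using fun k =>
      (hT k).exists_branches (hF k) (upd x i (γ s) k) (upd x i (γ s) k)
    obtain ⟨t, ht, htw, -, hts⟩ := h.exists_coord_cube hT hF hp (upd x i (γ s))
      (upd (WithLp.toLp 1 z₀) i c) (by
        intro k
        by_cases hk : k = i
        · subst hk
          simpa using hsc
        · rw [upd_ne (WithLp.toLp 1 z₀) _ hk]
          exact hz₀ k)
    have hti : t i ∈ Seg (γ s) c := by simpa using ht i
    have htne : 0 < dist (γ s) (t i) := dist_pos.2 fun e => htw i (by simpa using e.symm)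
    let s' : ℝ := min (min y 1) (s + dist (γ s) (t i) / dist (x i) c)
    have hss' : s < s' := lt_min (lt_min hy hs1) (by linarith [div_pos htne hpos])
    have hs'1 : s' ≤ 1 := (min_le_left _ _).trans (min_le_right _ _)
    have hs'y : s' ≤ y := (min_le_left _ _).trans (min_le_left _ _)
    refine ⟨s', ?_, hss', hs'y⟩
    have hseg := hmono s s' hs0 hss'.le hs'1
    have hdist : dist (γ s) (γ s') ≤ dist (γ s) (t i) := by
      have h1 := mem_Seg.1 hseg
      rw [hγd s ⟨hs0, hs1.le⟩, hγd s' ⟨hs0.trans hss'.le, hs'1⟩] at h1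
      have h2 : s' - s ≤ dist (γ s) (t i) / dist (x i) c := by
        linarith [min_le_right (min y 1) (s + dist (γ s) (t i) / dist (x i) c)]
      rw [le_div_iff₀ hpos] at h2
      linarith
    have hmem : γ s' ∈ Seg (γ s) (t i) :=
      (hT i).mem_Seg_of_le (Seg_shift (hγ s') hseg) hti hdist
    have hstr := h.medInt_subset_Box_of_mem_Seg hT (x := upd x i (γ s)) (i := i) (c := t i)
      (d := γ s') (by simpa using hmem) (hts i)
    change medInt m x (upd x i (γ s')) ⊆ Box x (upd x i (γ s'))
    exact h.medInt_subset_Box_trans hT hF hp hseg hs hstr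
  have := hall (right_mem_Icc.2 zero_le_one)
  change medInt m x (upd x i (γ 1)) ⊆ Box x (upd x i (γ 1)) at this
  rwa [hγ1] at this

end Straight

section Global

variable {p : ℕ} {T : Fin p → Type*}

/-- Replace the coordinates of a point in a finite set by those of another point. -/
noncomputable def mix (x z : PiLp 1 T) (S : Finset (Fin p)) : PiLp 1 T :=
  WithLp.toLp 1 fun k => if k ∈ S then z k else x k

theorem mix_of_mem (x z : PiLp 1 T) {S : Finset (Fin p)} {k : Fin p} (hk : k ∈ S) :
    mix x z S k = z k := if_pos hk

theorem mix_of_notMem (x z : PiLp 1 T) {S : Finset (Fin p)} {k : Fin p} (hk : k ∉ S) :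
    mix x z S k = x k := if_neg hk

theorem mix_empty (x z : PiLp 1 T) : mix x z ∅ = x :=
  PiLp.ext fun _ => mix_of_notMem _ _ (Finset.notMem_empty _)

theorem mix_univ (x z : PiLp 1 T) : mix x z Finset.univ = z :=
  PiLp.ext fun _ => mix_of_mem _ _ (Finset.mem_univ _)

theorem mix_insert (x z : PiLp 1 T) (S : Finset (Fin p)) (k : Fin p) :
    mix x z (insert k S) = upd (mix x z S) k (z k) :=
  PiLp.ext fun j => by
    by_cases hj : j = k
    · subst hj
      rw [mix_of_mem _ _ (Finset.mem_insert_self _ _), upd_same]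
    rw [upd_ne _ _ hj]
    by_cases hS : j ∈ S
    · rw [mix_of_mem _ _ hS, mix_of_mem _ _ (Finset.mem_insert_of_mem hS)]
    · rw [mix_of_notMem _ _ hS, mix_of_notMem _ _ (by simp [hj, hS])]

variable [∀ i, MetricSpace (T i)] (hT : ∀ i, IsRTree (T i))
  {m : PiLp 1 T → PiLp 1 T → PiLp 1 T → PiLp 1 T} {L : ℝ}

include hT

theorem LipMed.mem_medInt_upd_upd (hF : ∀ i, Furry (T i)) (h : LipMed m L) (hp : 1 ≤ p)
    (v : PiLp 1 T) {i j : Fin p} (hij : i ≠ j) (c : T i) (d : T j) :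
    v ∈ medInt m (upd v i c) (upd v j d) := by
  have hm := h.1
  have h1 : m (upd v i c) (upd v j d) v = v := by
    refine Box_eq_of_mem (x := upd v i c) (y := upd v j d) (fun k => ?_) ?_ ?_
    · by_cases hk : k = i
      · subst hk
        rw [upd_ne v d hij]
        exact right_mem_Seg _ _
      · rw [upd_ne v c hk]
        exact left_mem_Seg _ _
    · exact h.medInt_subset_Box_upd hT hF hp _ _ _ (hm.int_symm (hm.med_mem'' _ _ _))
    · exact h.medInt_subset_Box_upd hT hF hp _ _ _ (hm.int_symm (hm.med_mem' _ _ _))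
  exact h1

/-- A half-space separating two points which differ in one coordinate depends only on that
coordinate. -/
theorem LipMed.half_of_upd (hF : ∀ i, Furry (T i)) (h : LipMed m L) (hp : 1 ≤ p)
    {k : Set (PiLp 1 T)} (hk : IsHalf m k) {v : PiLp 1 T} {i : Fin p} {c : T i} (hv : v ∈ k)
    (hc : upd v i c ∉ k) {v' : PiLp 1 T} (hi : v' i = v i) : v' ∈ k ∧ upd v' i c ∉ k := by
  have key : ∀ S : Finset (Fin p), mix v v' S ∈ k ∧ upd (mix v v' S) i c ∉ k := by
    intro S
    induction S using Finset.induction_on with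
    | empty => rw [mix_empty]; exact ⟨hv, hc⟩
    | insert j S _ ih =>
      obtain ⟨ih1, ih2⟩ := ih
      rw [mix_insert]
      generalize hu : mix v v' S = u at ih1 ih2
      by_cases hj : j = i
      · subst hj
        have : u j = v' j := by
          rw [← hu]
          by_cases hS : j ∈ S
          · exact mix_of_mem _ _ hS
          · rw [mix_of_notMem _ _ hS, hi]
        rw [← this, upd_eq_self]
        exact ⟨ih1, ih2⟩
      · have h1 := h.mem_medInt_upd_upd hT hF hp u (Ne.symm hj) c (v' j)
        refine ⟨hk.mem_of_int h1 ih2 ih1, fun h3 => ih2 ?_⟩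
        have h2 := h.mem_medInt_upd_upd hT hF hp (upd u i c) (Ne.symm hj) (u i) (v' j)
        rw [upd_upd, upd_eq_self, upd_comm _ (Ne.symm hj)] at h2
        exact hk.int h2 ih1 h3
  simpa only [mix_univ] using key Finset.univ

theorem LipMed.Box_subset_medInt (hF : ∀ i, Furry (T i)) (h : LipMed m L) (hp : 1 ≤ p)
    (x y : PiLp 1 T) : Box x y ⊆ medInt m x y := by
  intro z hz
  rw [h.1.mem_int_iff]
  intro k hk hx hy
  have key : ∀ S : Finset (Fin p), mix x z S ∈ k := by
    intro S
    induction S using Finset.induction_on with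
    | empty => rwa [mix_empty]
    | insert j S hj ih =>
      rw [mix_insert]
      have hu : mix x z S j = x j := mix_of_notMem _ _ hj
      generalize mix x z S = u at ih hu
      have h1 : upd u j (y j) ∈ k := by
        by_contra h2
        have h3 := (h.half_of_upd hT hF hp hk ih h2 (v' := upd y j (u j)) (upd_same _ _ _)).2
        rw [upd_upd, upd_eq_self] at h3
        exact h3 hy
      refine hk.int (h.Box_subset_medInt_upd hT (right_mem_Seg _ _)
        (h.medInt_subset_Box_upd hT hF hp u j (y j)) (mem_Box_upd.2 ⟨z j, ?_, rfl⟩)) ih h1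
      rw [hu]
      exact hz j
  simpa only [mix_univ] using key Finset.univ

theorem LipMed.eq_pmed (hF : ∀ i, Furry (T i)) (h : LipMed m L) (hp : 1 ≤ p) : m = pmed := by
  funext x y z
  have hm := (pmed_lipMed hT).1
  have hB := fun a b => h.Box_subset_medInt hT hF hp a b
  exact (h.1.eq_med (hB _ _ ((mem_medInt_pmed hT).1 (hm.med_mem x y z)))
    (hB _ _ ((mem_medInt_pmed hT).1 (hm.med_mem' x y z)))
    (hB _ _ ((mem_medInt_pmed hT).1 (hm.med_mem'' x y z)))).symm

end Global

/-- Proposition 4.1 (uniqueness): a finite product of furry `ℝ`-trees, with the `ℓ¹` product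
metric, admits at most one Lipschitz median operator. -/
theorem unique_median_product_furry_trees
    (p : ℕ) (hp : 1 ≤ p) (T : Fin p → Type*) [∀ i, MetricSpace (T i)]
    (htree : ∀ i, IsRTree (T i)) (hfurry : ∀ i, Furry (T i))
    (ν ν' : PiLp 1 T → PiLp 1 T → PiLp 1 T → PiLp 1 T)
    (hν : IsLipschitzMedianOp ν) (hν' : IsLipschitzMedianOp ν') :
    ν = ν' := by
  obtain ⟨h, L, hL, hl⟩ := hν
  obtain ⟨h', L', hL', hl'⟩ := hν'
  rw [LipMed.eq_pmed htree hfurry (m := ν) ⟨h, hL, hl⟩ hp,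
    LipMed.eq_pmed htree hfurry (m := ν') ⟨h', hL', hl'⟩ hp]
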